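/- arXiv:1307.1297 — 3 statements merged into one kernel-verified Lean document; each statement's English description precedes it below -/
import Mathlib

section
/- Let I be a compact interval of ℝ and let f: I → I be an interval map of class C^3 with non-flat critical points that is topologically exact. Suppose f satisfies the Topological Collet–Eckmann condition, i.e. there is a constant χ > 0 such that every f-invariant Borel probability measure ν on I satisfies ∫_I ln|f'| dν ≥ χ. Then every Hölder continuous potential φ: I → ℝ is hyperbolic for f. -/
open MeasureTheory Filter Set Metric

noncomputable section

/-- Shannon entropy of the law of a finitely-valued map `p` under the measure `μ`. -/
def partitionEntropy {X ι : Type*} [MeasurableSpace X] [Fintype ι]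
    (μ : Measure X) (p : X → ι) : ℝ :=
  ∑ i, Real.negMulLog (μ (p ⁻¹' {i})).toReal

/-- Kolmogorov–Sinai (measure-theoretic) entropy of `f` with respect to `μ`:
the supremum over finite measurable partitions (coded by maps into `Fin k`) of the
limit (here: infimum, by subadditivity) of the normalized entropies of the joins. -/
def ksEntropy {X : Type*} [MeasurableSpace X] (μ : Measure X) (f : X → X) : ℝ :=
  ⨆ k : ℕ, ⨆ p : { p : X → Fin k // Measurable p },
    ⨅ n : ℕ, partitionEntropy μ (fun x (i : Fin (n + 1)) => p.1 (f^[(i : ℕ)] x)) / (n + 1)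

/-- `μ` is an `f`-invariant Borel probability measure giving full mass to `I`. -/
def InvariantProb (f : ℝ → ℝ) (I : Set ℝ) (μ : Measure ℝ) : Prop :=
  IsProbabilityMeasure μ ∧ μ I = 1 ∧ ∀ A : Set ℝ, MeasurableSet A → μ (f ⁻¹' A) = μ A

/-- Topological pressure of `f : I → I` for the potential `φ`, defined via the
variational principle. -/
def pressure (f : ℝ → ℝ) (I : Set ℝ) (φ : ℝ → ℝ) : ℝ :=
  sSup { r : ℝ | ∃ μ : Measure ℝ, InvariantProb f I μ ∧ r = ksEntropy μ f + ∫ x, φ x ∂μ }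

/-- An equilibrium state of `f` for the potential `φ`. -/
def IsEquilibriumState (f : ℝ → ℝ) (I : Set ℝ) (φ : ℝ → ℝ) (μ : Measure ℝ) : Prop :=
  InvariantProb f I μ ∧ ksEntropy μ f + ∫ x, φ x ∂μ = pressure f I φ

/-- `φ` is Hölder continuous on `I`. -/
def HolderOn (φ : ℝ → ℝ) (I : Set ℝ) : Prop :=
  ∃ C α : ℝ, 0 < α ∧ α ≤ 1 ∧ 0 ≤ C ∧ ∀ x ∈ I, ∀ y ∈ I, |φ x - φ y| ≤ C * |x - y| ^ α

/-- `φ` is hyperbolic for `f`: for some `n ≥ 1`, `sup_I (1/n) Sₙ(φ) < P(f, φ)`. -/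
def HyperbolicPotential (f : ℝ → ℝ) (I : Set ℝ) (φ : ℝ → ℝ) : Prop :=
  ∃ n : ℕ, 1 ≤ n ∧ sSup ((fun x => birkhoffSum f φ n x / n) '' I) < pressure f I φ

/-- `g` is a `C³` diffeomorphism of `ℝ`. -/
def IsC3Diffeo (g : ℝ → ℝ) : Prop :=
  ContDiff ℝ 3 g ∧ Function.Bijective g ∧ ∀ x, deriv g x ≠ 0

/-- `f` is an interval map of class `C³` with non-flat critical points on `I = [a, b]`. -/
structure IsC3NonflatIntervalMap (f : ℝ → ℝ) (a b : ℝ) : Prop where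
  lt : a < b
  mapsTo : MapsTo f (Icc a b) (Icc a b)
  diff : ∀ x ∈ Icc a b, DifferentiableAt ℝ f x
  critFinite : {x | x ∈ Icc a b ∧ deriv f x = 0}.Finite
  smooth : ContDiffOn ℝ 3 f ((Icc a b) \ {x | deriv f x = 0})
  nonflat : ∀ c ∈ Icc a b, deriv f c = 0 →
    ∃ ℓ : ℝ, 1 < ℓ ∧ ∃ φ ψ : ℝ → ℝ, IsC3Diffeo φ ∧ IsC3Diffeo ψ ∧
      φ c = 0 ∧ ψ (f c) = 0 ∧
      ∀ᶠ x in nhdsWithin c (Icc a b), |ψ (f x)| = |φ x| ^ ℓ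

/-- `f : I → I` is topologically exact. -/
def TopExact (f : ℝ → ℝ) (I : Set ℝ) : Prop :=
  ∀ U : Set ℝ, IsOpen U → (U ∩ I).Nonempty → ∃ n : ℕ, 1 ≤ n ∧ f^[n] '' (U ∩ I) = I

section InvariantLimits

variable {X : Type*} [MetricSpace X] [CompactSpace X] [MeasurableSpace X] [BorelSpace X]

/-- **Krylov–Bogoliubov**: asymptotically invariant probability measures on a compact metric space
accumulate on an invariant probability measure. -/
theorem exists_invariant_limit {F : X → X} (hF : Continuous F) (P : ℕ → ProbabilityMeasure X)
    (h : ∀ g : BoundedContinuousFunction X ℝ, Tendsto (fun n => ∫ x, g (F x) ∂(P n : Measure X) -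
      ∫ x, g x ∂(P n : Measure X)) atTop (nhds 0)) :
    ∃ μ : ProbabilityMeasure X, ∃ L : Filter ℕ, L.NeBot ∧ L ≤ atTop ∧ Tendsto P L (nhds μ) ∧
      MeasurePreserving F (μ : Measure X) (μ : Measure X) := by
  set U : Ultrafilter ℕ := Ultrafilter.of atTop with hU
  obtain ⟨μ, -, hμ⟩ := (isCompact_univ (X := ProbabilityMeasure X)).ultrafilter_le_nhds
    (U.map P) (by simp)
  have hUat : (U : Filter ℕ) ≤ atTop := Ultrafilter.of_le atTop
  have hlim : Tendsto P U (nhds μ) := hμ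
  refine ⟨μ, U, U.neBot, hUat, hlim, hF.measurable, ?_⟩
  have : IsProbabilityMeasure ((μ : Measure X).map F) :=
    Measure.isProbabilityMeasure_map hF.measurable.aemeasurable
  refine ext_of_forall_integral_eq_of_IsFiniteMeasure fun g => ?_
  rw [integral_map hF.measurable.aemeasurable g.continuous.aestronglyMeasurable]
  have hall := ProbabilityMeasure.tendsto_iff_forall_integral_tendsto.1 hlim
  have h1 := hall (g.compContinuous ⟨F, hF⟩)
  have h2 := (h1.sub (hall g))
  have h3 := tendsto_nhds_unique h2 ((h g).mono_left hUat)
  simpa [sub_eq_zero] using h3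

/-- The average of the first `n + 1` terms of a sequence of measures. -/
def averageMeasure {Y : Type*} [MeasurableSpace Y] (m : ℕ → Measure Y) (n : ℕ) : Measure Y :=
  ((n : ENNReal) + 1)⁻¹ • ∑ i ∈ Finset.range (n + 1), m i

theorem averageMeasure_apply {Y : Type*} [MeasurableSpace Y] (m : ℕ → Measure Y) (n : ℕ)
    (s : Set Y) : averageMeasure m n s =
      ((n : ENNReal) + 1)⁻¹ * ∑ i ∈ Finset.range (n + 1), m i s := by
  simp [averageMeasure]

instance averageMeasure.isProbabilityMeasure {Y : Type*} [MeasurableSpace Y] (m : ℕ → Measure Y)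
    [∀ i, IsProbabilityMeasure (m i)] (n : ℕ) : IsProbabilityMeasure (averageMeasure m n) := by
  refine ⟨?_⟩
  rw [averageMeasure_apply]
  simp only [measure_univ, Finset.sum_const, Finset.card_range, nsmul_eq_mul, mul_one]
  push_cast
  exact ENNReal.inv_mul_cancel (by simp) (by simp)

/-- The average of the first `n + 1` terms of a sequence of probability measures. -/
def averageProbabilityMeasure {Y : Type*} [MeasurableSpace Y] (m : ℕ → Measure Y)
    [∀ i, IsProbabilityMeasure (m i)] (n : ℕ) : ProbabilityMeasure Y :=
  ⟨averageMeasure m n, inferInstance⟩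

theorem coe_averageProbabilityMeasure {Y : Type*} [MeasurableSpace Y] (m : ℕ → Measure Y)
    [∀ i, IsProbabilityMeasure (m i)] (n : ℕ) :
    (averageProbabilityMeasure m n : Measure Y) = averageMeasure m n := rfl

theorem integral_averageMeasure {Y : Type*} [MeasurableSpace Y] (m : ℕ → Measure Y) (n : ℕ)
    {h : Y → ℝ} (hh : ∀ i, Integrable h (m i)) :
    ∫ y, h y ∂(averageMeasure m n) =
      ((n : ℝ) + 1)⁻¹ * ∑ i ∈ Finset.range (n + 1), ∫ y, h y ∂(m i) := by
  rw [averageMeasure, integral_smul_measure, integral_finsetSum_measure (fun i _ => hh i)]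
  have : (((n : ENNReal) + 1)⁻¹).toReal = ((n : ℝ) + 1)⁻¹ := by
    rw [ENNReal.toReal_inv, ENNReal.toReal_add (by simp) (by simp)]; simp
  rw [this, smul_eq_mul]

theorem integrable_of_continuous {h : X → ℝ} (hh : Continuous h) (μ : Measure X)
    [IsProbabilityMeasure μ] : Integrable h μ := by
  exact hh.integrable_of_hasCompactSupport (HasCompactSupport.of_compactSpace _)

/-- Averages of a sequence of probability measures related by the dynamics accumulate on an
invariant measure. -/
theorem exists_invariant_limit_average {F : X → X} (hF : Continuous F) (m : ℕ → ℕ → Measure X)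
    [∀ n i, IsProbabilityMeasure (m n i)]
    (hm : ∀ n, (∀ i, (m n i).map F = m n (i + 1)) ∨ (∀ i, (m n (i + 1)).map F = m n i)) :
    ∃ μ : ProbabilityMeasure X, ∃ L : Filter ℕ, L.NeBot ∧ L ≤ atTop ∧
      Tendsto (fun n => averageProbabilityMeasure (m n) n) L (nhds μ) ∧ MeasurePreserving F (μ : Measure X) (μ : Measure X) := by
  refine exists_invariant_limit hF _ fun g => ?_
  simp only [coe_averageProbabilityMeasure]
  have hint : ∀ n i, Integrable g (m n i) := fun n i => integrable_of_continuous g.continuous _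
  have hint' : ∀ n i, Integrable (fun x => g (F x)) (m n i) :=
    fun n i => integrable_of_continuous (g.continuous.comp hF) _
  have hb : ∀ n i, |∫ x, g x ∂(m n i)| ≤ ‖g‖ := fun n i => by
    have := norm_integral_le_of_norm_le_const (μ := m n i) (f := g) (C := ‖g‖)
      (Eventually.of_forall fun x => g.norm_coe_le_norm x)
    simpa using this
  have hmap : ∀ n i, ∫ x, g x ∂((m n i).map F) = ∫ x, g (F x) ∂(m n i) := fun n i =>
    integral_map hF.measurable.aemeasurable g.continuous.aestronglyMeasurable
  have hb' : ∀ n i, |∫ x, g (F x) ∂(m n i)| ≤ ‖g‖ := fun n i => by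
    have := norm_integral_le_of_norm_le_const (μ := m n i) (f := fun x => g (F x)) (C := ‖g‖)
      (Eventually.of_forall fun x => g.norm_coe_le_norm _)
    simpa using this
  have key : ∀ n : ℕ, |∫ x, g (F x) ∂(averageMeasure (m n) n) - ∫ x, g x ∂(averageMeasure (m n) n)|
      ≤ 2 * ‖g‖ * ((n : ℝ) + 1)⁻¹ := by
    intro n
    rw [integral_averageMeasure _ _ (hint n), integral_averageMeasure _ _ (hint' n), ← mul_sub,
      ← Finset.sum_sub_distrib, abs_mul, abs_of_pos (by positivity : (0 : ℝ) < ((n : ℝ) + 1)⁻¹),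
      mul_comm]
    gcongr
    rcases hm n with h | h
    · have : ∀ i, ∫ x, g (F x) ∂(m n i) = ∫ x, g x ∂(m n (i + 1)) := fun i => by
        rw [← hmap, h]
      simp only [this]
      rw [Finset.sum_range_sub (fun i => ∫ x, g x ∂(m n i))]
      have h1 := abs_le.1 (hb n (n + 1))
      have h2 := abs_le.1 (hb n 0)
      exact abs_le.2 ⟨by linarith, by linarith⟩
    · have h1 : ∀ i, ∫ x, g (F x) ∂(m n (i + 1)) = ∫ x, g x ∂(m n i) := fun i => by
        rw [← hmap, h]
      rw [Finset.sum_sub_distrib, Finset.sum_range_succ', Finset.sum_range_succ _ n]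
      simp only [h1]
      have : ∀ u v w : ℝ, (u + v) - (u + w) = v - w := fun u v w => by ring
      rw [this]
      have h1 := abs_le.1 (hb n n)
      have h2 := abs_le.1 (hb' n 0)
      exact abs_le.2 ⟨by linarith, by linarith⟩
  refine squeeze_zero_norm key ?_
  have : Tendsto (fun n : ℕ => ((n : ℝ) + 1)⁻¹) atTop (nhds 0) := by
    simpa using tendsto_one_div_add_atTop_nhds_zero_nat (𝕜 := ℝ)
  simpa using this.const_mul (2 * ‖g‖)

/-- A continuous function whose Birkhoff averages reach `c` at every time has integral at least
`c` for some invariant probability measure. -/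
theorem exists_invariant_integral_ge {F : X → X} (hF : Continuous F) {h : X → ℝ}
    (hh : Continuous h) {c : ℝ} (hc : ∀ n : ℕ, 1 ≤ n → ∃ x, n * c ≤ birkhoffSum F h n x) :
    ∃ ν : Measure X, IsProbabilityMeasure ν ∧ MeasurePreserving F ν ν ∧ c ≤ ∫ x, h x ∂ν := by
  choose x hx using fun n : ℕ => hc (n + 1) (by omega)
  obtain ⟨μ, L, hL, hLat, hlim, hinv⟩ := exists_invariant_limit_average hF
    (fun n i => Measure.dirac (F^[i] (x n))) (fun n => Or.inl fun i => by
      rw [Measure.map_dirac' hF.measurable, Function.iterate_succ_apply'])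
  refine ⟨μ, inferInstance, hinv, ?_⟩
  have h1 := ProbabilityMeasure.tendsto_iff_forall_integral_tendsto.1 hlim
    (BoundedContinuousFunction.mkOfCompact ⟨h, hh⟩)
  refine ge_of_tendsto h1 (Eventually.of_forall fun n => ?_)
  simp only [coe_averageProbabilityMeasure, BoundedContinuousFunction.mkOfCompact_apply,
    ContinuousMap.coe_mk]
  rw [integral_averageMeasure _ _ (fun i => integrable_of_continuous hh _)]
  simp only [integral_dirac]
  have := hx n
  rw [birkhoffSum] at this
  rw [inv_mul_eq_div, le_div_iff₀ (by positivity)]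
  push_cast at this
  linarith

/-- Points whose first `n` iterates under `G` follow the itinerary `u` through the sets `J`. -/
def itinerarySet {Y κ : Type*} (G : Y → Y) (J : κ → Set Y) (u : ℕ → κ) (n : ℕ) : Set Y :=
  {x | ∀ i < n, G^[i] x ∈ J (u i)}

theorem itinerarySet_zero {Y κ : Type*} (G : Y → Y) (J : κ → Set Y) (u : ℕ → κ) :
    itinerarySet G J u 0 = univ := by
  ext; simp [itinerarySet]

theorem mem_itinerarySet_succ {Y κ : Type*} {G : Y → Y} {J : κ → Set Y} {u : ℕ → κ} {n : ℕ}
    {x : Y} : x ∈ itinerarySet G J u (n + 1) ↔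
      x ∈ J (u 0) ∧ G x ∈ itinerarySet G J (fun i => u (i + 1)) n := by
  constructor
  · intro h
    exact ⟨h 0 (by omega), fun i hi => by
      simpa using h (i + 1) (by omega)⟩
  · rintro ⟨h0, h1⟩ i hi
    rcases i with _ | i
    · simpa using h0
    · simpa using h1 i (by omega)

theorem isClosed_itinerarySet {Y κ : Type*} [TopologicalSpace Y] {G : Y → Y} (hG : Continuous G)
    {J : κ → Set Y} (hJ : ∀ k, IsClosed (J k)) (u : ℕ → κ) (n : ℕ) :
    IsClosed (itinerarySet G J u n) := by
  have : itinerarySet G J u n = ⋂ i, ⋂ (_ : i < n), G^[i] ⁻¹' J (u i) := by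
    ext; simp [itinerarySet]
  rw [this]
  exact isClosed_iInter fun i => isClosed_iInter fun _ => (hJ _).preimage (hG.iterate i)

/-- The uniform distribution on the `n`-fold preimages of `x` along the inverse branches `b`. -/
def branchMeasure {Y κ : Type*} [MeasurableSpace Y] [Fintype κ] (b : κ → Y → Y) :
    ℕ → Y → Measure Y
  | 0, x => Measure.dirac x
  | n + 1, x => (Fintype.card κ : ENNReal)⁻¹ • ∑ k, branchMeasure b n (b k x)

section BranchMeasure

variable {Y κ : Type*} [MeasurableSpace Y] [Fintype κ] [Nonempty κ] {b : κ → Y → Y} {G : Y → Y}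

instance branchMeasure.isProbabilityMeasure (b : κ → Y → Y) (n : ℕ) (x : Y) :
    IsProbabilityMeasure (branchMeasure b n x) := by
  induction n generalizing x with
  | zero => simp only [branchMeasure]; infer_instance
  | succ n ih =>
    refine ⟨?_⟩
    have : ∀ k, branchMeasure b n (b k x) univ = 1 := fun k => (ih (b k x)).measure_univ
    simp only [branchMeasure, Measure.smul_apply, Measure.coe_finsetSum, Finset.sum_apply, this,
      smul_eq_mul, Finset.sum_const, Finset.card_univ, nsmul_eq_mul, mul_one]
    exact ENNReal.inv_mul_cancel (by simp) (by simp)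

theorem map_branchMeasure (hG : Measurable G) (hb : ∀ k x, G (b k x) = x) (n : ℕ) (x : Y) :
    (branchMeasure b (n + 1) x).map G = branchMeasure b n x := by
  induction n generalizing x with
  | zero =>
    simp only [branchMeasure, Measure.map_smul]
    rw [Measure.map_finset_sum hG.aemeasurable]
    simp only [Measure.map_dirac' hG, hb, Finset.sum_const, Finset.card_univ]
    rw [← Nat.cast_smul_eq_nsmul ENNReal, smul_smul, ENNReal.inv_mul_cancel (by simp) (by simp),
      one_smul]
  | succ n ih =>
    rw [branchMeasure, Measure.map_smul, Measure.map_finset_sum hG.aemeasurable]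
    simp only [ih]
    rfl

theorem le_branchMeasure_of_mem {J : κ → Set Y} (hJ : ∀ k x, b k x ∈ J k)
    (hb : ∀ k x, G (b k x) = x) (u : ℕ → κ) (n r : ℕ) (y : Y)
    (hy : y ∈ itinerarySet G J (fun i => u (n + i)) r) :
    ((Fintype.card κ : ENNReal)⁻¹) ^ n ≤ branchMeasure b n y (itinerarySet G J u (n + r)) := by
  induction n generalizing r y with
  | zero =>
    simp only [Nat.zero_add] at hy ⊢
    simp only [branchMeasure, pow_zero]
    exact (indicator_of_mem hy (1 : Y → ENNReal)).symm.le.trans Measure.le_dirac_apply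
  | succ n ih =>
    have h1 : b (u n) y ∈ itinerarySet G J (fun i => u (n + i)) (r + 1) := by
      rw [mem_itinerarySet_succ, hb]
      have e : (fun i => u (n + 1 + i)) = fun i => u (n + (i + 1)) := by
        funext i
        rw [Nat.add_assoc, Nat.add_comm 1 i]
      exact ⟨hJ _ _, e ▸ hy⟩
    have h2 := ih _ _ h1
    simp only [branchMeasure, Measure.smul_apply, Measure.coe_finsetSum, Finset.sum_apply,
      smul_eq_mul]
    rw [pow_succ', show n + 1 + r = n + (r + 1) by ring]
    gcongr
    exact h2.trans (Finset.single_le_sum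
      (f := fun k => branchMeasure b n (b k y) (itinerarySet G J u (n + (r + 1))))
      (fun _ _ => zero_le) (Finset.mem_univ (u n)))

theorem le_branchMeasure {J : κ → Set Y} (hJ : ∀ k x, b k x ∈ J k)
    (hb : ∀ k x, G (b k x) = x) (u : ℕ → κ) {l n : ℕ} (hln : l ≤ n) (y : Y) :
    ((Fintype.card κ : ENNReal)⁻¹) ^ l ≤ branchMeasure b n y (itinerarySet G J u l) := by
  induction n, hln using Nat.le_induction generalizing y with
  | base =>
    exact le_branchMeasure_of_mem hJ hb u l 0 y (by simp [itinerarySet_zero])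
  | succ n hn ih =>
    simp only [branchMeasure, Measure.smul_apply, Measure.coe_finsetSum, Finset.sum_apply,
      smul_eq_mul]
    calc ((Fintype.card κ : ENNReal)⁻¹) ^ l
        = (Fintype.card κ : ENNReal)⁻¹ * ∑ _k : κ, ((Fintype.card κ : ENNReal)⁻¹) ^ l := by
          rw [Finset.sum_const, Finset.card_univ, nsmul_eq_mul, ← mul_assoc,
            ENNReal.inv_mul_cancel (by simp) (by simp), one_mul]
      _ ≤ _ := by
          gcongr with k
          exact ih _

end BranchMeasure

/-- A full horseshoe for `G` carries an invariant probability measure giving every cylinder of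
length `n` mass at least `(card κ)⁻¹ ^ n`. -/
theorem exists_horseshoe_measure [Nonempty X] {κ : Type*} [Fintype κ] [Nonempty κ] {G : X → X}
    (hG : Continuous G) {J : κ → Set X} (hJc : ∀ k, IsClosed (J k))
    (hJ : ∀ k x, ∃ y ∈ J k, G y = x) :
    ∃ μ : Measure X, IsProbabilityMeasure μ ∧ MeasurePreserving G μ μ ∧
      ∀ u n, ((Fintype.card κ : ENNReal)⁻¹) ^ n ≤ μ (itinerarySet G J u n) := by
  choose b hbJ hbG using hJ
  obtain ⟨x₀⟩ := ‹Nonempty X›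
  obtain ⟨μ, L, hL, hLat, hlim, hinv⟩ := exists_invariant_limit_average hG
    (fun n i => branchMeasure b (i + n) x₀) (fun n => Or.inr fun i => by
      have := map_branchMeasure hG.measurable hbG (i + n) x₀
      rwa [show i + n + 1 = i + 1 + n by ring] at this)
  refine ⟨μ, inferInstance, hinv, fun u l => ?_⟩
  have hlimsup := ProbabilityMeasure.limsup_measure_closed_le_of_tendsto hlim
    (isClosed_itinerarySet hG hJc u l)
  refine le_trans ?_ hlimsup
  refine le_limsup_of_frequently_le (Eventually.frequently ?_)
  filter_upwards [hLat (eventually_ge_atTop l)] with n hn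
  rw [coe_averageProbabilityMeasure, averageMeasure_apply]
  calc ((Fintype.card κ : ENNReal)⁻¹) ^ l
      = ((n : ENNReal) + 1)⁻¹ * ∑ _i ∈ Finset.range (n + 1), ((Fintype.card κ : ENNReal)⁻¹) ^ l := by
        rw [Finset.sum_const, Finset.card_range, nsmul_eq_mul, ← mul_assoc, Nat.cast_add_one,
          ENNReal.inv_mul_cancel (by simp) (by simp), one_mul]
    _ ≤ _ := by
        gcongr with i
        exact le_branchMeasure hbJ hbG u (by omega) x₀

theorem mul_le_negMulLog {x c : ℝ} (hx : 0 ≤ x) (hxc : x ≤ Real.exp (-c)) :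
    c * x ≤ Real.negMulLog x := by
  rcases hx.eq_or_lt with rfl | hx
  · simp
  · have : Real.log x ≤ -c := by
      rwa [Real.log_le_iff_le_exp hx]
    rw [Real.negMulLog]
    nlinarith

theorem average_le_sum_negMulLog {ι : Type*} [Fintype ι] (t : ℕ) (q : ℕ → ι → ℝ) (c : ℕ → ℝ)
    (h0 : ∀ i w, 0 ≤ q i w) (h1 : ∀ i, ∑ w, q i w = 1) (hc : ∀ i w, q i w ≤ Real.exp (-c i)) :
    ((t : ℝ) + 1)⁻¹ * ∑ i ∈ Finset.range (t + 1), c i ≤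
      ∑ w, Real.negMulLog (((t : ℝ) + 1)⁻¹ * ∑ i ∈ Finset.range (t + 1), q i w) := by
  have h2 : ∀ w, ((t : ℝ) + 1)⁻¹ * ∑ i ∈ Finset.range (t + 1), c i * q i w ≤
      Real.negMulLog (((t : ℝ) + 1)⁻¹ * ∑ i ∈ Finset.range (t + 1), q i w) := by
    intro w
    have := Real.concaveOn_negMulLog.le_map_sum (t := Finset.range (t + 1))
      (w := fun _ => ((t : ℝ) + 1)⁻¹) (p := fun i => q i w) (fun _ _ => by positivity)
      (by
        rw [Finset.sum_const, Finset.card_range, nsmul_eq_mul]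
        push_cast
        field_simp) (fun i _ => h0 i w)
    simp only [smul_eq_mul, ← Finset.mul_sum] at this
    refine le_trans ?_ this
    gcongr with i
    exact mul_le_negMulLog (h0 i w) (hc i w)
  refine le_trans (le_of_eq ?_) (Finset.sum_le_sum fun w _ => h2 w)
  rw [← Finset.mul_sum, Finset.sum_comm]
  simp only [← Finset.mul_sum, h1, mul_one]

theorem measure_itinerarySet_le {Y κ : Type*} [MeasurableSpace Y] [Fintype κ]
    [MeasurableSpace κ] [MeasurableSingletonClass κ] {G : Y → Y} (hG : Measurable G)
    {μ : Measure Y} [IsProbabilityMeasure μ] {p : Y → κ} (hp : Measurable p)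
    (hlow : ∀ u n, ((Fintype.card κ : ENNReal)⁻¹) ^ n ≤
      μ (itinerarySet G (fun k => p ⁻¹' {k}) u n)) (u : ℕ → κ) (n : ℕ) :
    (μ (itinerarySet G (fun k => p ⁻¹' {k}) u n)).toReal ≤ ((Fintype.card κ : ℝ)⁻¹) ^ n := by
  classical
  have hne : Nonempty κ := ⟨u 0⟩
  set W : Y → (Fin n → κ) := fun x i => p (G^[(i : ℕ)] x) with hW
  have hWm : Measurable W := measurable_pi_lambda _ fun i => hp.comp (hG.iterate i)
  have hfib : ∀ v : ℕ → κ, W ⁻¹' {(fun i : Fin n => v i)} = itinerarySet G (fun k => p ⁻¹' {k}) v n := by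
    intro v
    ext x
    simp only [mem_preimage, mem_singleton_iff, itinerarySet, mem_ofPred_eq, hW, funext_iff]
    exact ⟨fun h i hi => h ⟨i, hi⟩, fun h i => h i i.2⟩
  have hlow' : ∀ w : Fin n → κ, ((Fintype.card κ : ℝ)⁻¹) ^ n ≤ (μ (W ⁻¹' {w})).toReal := by
    intro w
    have e : w = fun i : Fin n => (fun j : ℕ => if h : j < n then w ⟨j, h⟩ else u 0) i := by
      funext i; simp
    rw [e, hfib (fun j : ℕ => if h : j < n then w ⟨j, h⟩ else u 0)]
    have := ENNReal.toReal_mono (measure_ne_top _ _)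
      (hlow (fun j : ℕ => if h : j < n then w ⟨j, h⟩ else u 0) n)
    simpa using this
  have hsum : ∑ w : Fin n → κ, (μ (W ⁻¹' {w})).toReal = 1 := by
    rw [← ENNReal.toReal_sum (fun _ _ => measure_ne_top _ _),
      sum_measure_preimage_singleton _ (fun y _ => hWm (measurableSet_singleton y))]
    simp
  have hcard : ∑ _w : Fin n → κ, ((Fintype.card κ : ℝ)⁻¹) ^ n = 1 := by
    rw [Finset.sum_const, Finset.card_univ, Fintype.card_fun, Fintype.card_fin, nsmul_eq_mul]
    push_cast
    rw [← mul_pow, mul_inv_cancel₀ (by simp), one_pow]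
  have heq := (Finset.sum_eq_sum_iff_of_le (fun w _ => hlow' w)).1 (hcard.trans hsum.symm)
  rw [← hfib]
  exact (heq _ (Finset.mem_univ _)).symm.le

theorem sum_ceilDiv_sub (t n : ℕ) :
    ∑ i ∈ Finset.range (t + 1), (((i + n + t) / (t + 1) : ℕ) : ℝ) =
      ∑ i ∈ Finset.range (t + 1), (((i + t) / (t + 1) : ℕ) : ℝ) + n := by
  induction n with
  | zero => simp
  | succ n ih =>
    have h1 : ∑ i ∈ Finset.range (t + 1), ((((i + 1) + n + t) / (t + 1) : ℕ) : ℝ) -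
        ∑ i ∈ Finset.range (t + 1), (((i + n + t) / (t + 1) : ℕ) : ℝ) = 1 := by
      rw [← Finset.sum_sub_distrib,
        Finset.sum_range_sub (fun i => (((i + n + t) / (t + 1) : ℕ) : ℝ)),
        show t + 1 + n + t = 0 + n + t + (t + 1) by ring, Nat.add_div_right _ (by omega)]
      push_cast
      ring
    have h2 : ∑ i ∈ Finset.range (t + 1), (((i + (n + 1) + t) / (t + 1) : ℕ) : ℝ) =
        ∑ i ∈ Finset.range (t + 1), ((((i + 1) + n + t) / (t + 1) : ℕ) : ℝ) :=
      Finset.sum_congr rfl fun i _ => by rw [show i + (n + 1) + t = i + 1 + n + t by ring]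
    rw [h2]
    push_cast
    linarith

/-- Averaging a measure with uniform cylinders for `F^[t + 1]` along `t + 1` steps of the orbit
gives entropy at least `log (card κ) / (t + 1)` for `F`. -/
theorem le_partitionEntropy_average {κ : Type*} [Fintype κ]
    [MeasurableSpace κ] [MeasurableSingletonClass κ] {F : X → X} (hF : Continuous F) (t : ℕ)
    {μ : Measure X} [IsProbabilityMeasure μ] (hμ : MeasurePreserving F^[t + 1] μ μ)
    {p : X → κ} (hp : Measurable p)
    (hlow : ∀ u n, ((Fintype.card κ : ENNReal)⁻¹) ^ n ≤
      μ (itinerarySet F^[t + 1] (fun k => p ⁻¹' {k}) u n)) (n : ℕ) :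
    n * (Real.log (Fintype.card κ) / (t + 1)) ≤
      partitionEntropy (averageMeasure (fun i => μ.map F^[i]) t)
        (fun x (i : Fin n) => p (F^[(i : ℕ)] x)) := by
  classical
  have hne : Nonempty κ := by
    obtain ⟨x⟩ : Nonempty X := nonempty_of_isProbabilityMeasure μ
    exact ⟨p x⟩
  set W : X → (Fin n → κ) := fun x i => p (F^[(i : ℕ)] x) with hW
  have hWm : Measurable W := measurable_pi_lambda _ fun i => hp.comp (hF.measurable.iterate i)
  have hprob : ∀ i, IsProbabilityMeasure (μ.map F^[i]) := fun i =>
    Measure.isProbabilityMeasure_map (hF.iterate i).measurable.aemeasurable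
  set c : ℕ → ℕ := fun i => (i + n + t) / (t + 1) - (i + t) / (t + 1) with hc
  have hcle : ∀ i, (i + t) / (t + 1) ≤ (i + n + t) / (t + 1) := fun i =>
    Nat.div_le_div_right (by omega)
  have hatom : ∀ i w, ((μ.map F^[i]) (W ⁻¹' {w})).toReal ≤
      Real.exp (-(c i * Real.log (Fintype.card κ))) := by
    intro i w
    rw [Measure.map_apply (hF.iterate i).measurable (hWm (measurableSet_singleton w)),
      Real.exp_neg, mul_comm, Real.exp_mul, Real.exp_log (by simp [Fintype.card_pos]),
      Real.rpow_natCast, ← inv_pow]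
    set k₀ := (i + t) / (t + 1) with hk₀
    have hk : i ≤ k₀ * (t + 1) := by
      have := Nat.lt_div_mul_add (a := i + t) (b := t + 1) (by omega)
      rw [← hk₀] at this
      omega
    set u : ℕ → κ := fun s => if h : (k₀ + s) * (t + 1) - i < n then w ⟨_, h⟩
      else Classical.arbitrary κ with hu
    refine le_trans (ENNReal.toReal_mono (measure_ne_top _ _)
      (measure_mono (t := (F^[t + 1])^[k₀] ⁻¹'
        itinerarySet F^[t + 1] (fun k => p ⁻¹' {k}) u (c i)) ?_)) ?_
    · intro x hx s hs
      simp only [mem_preimage, mem_singleton_iff] at hx ⊢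
      have h1 : (k₀ + s) * (t + 1) < i + n := by
        have hci : c i = (i + n + t) / (t + 1) - k₀ := rfl
        have h2 : k₀ + s + 1 ≤ (i + n + t) / (t + 1) := by
          rw [hci] at hs
          omega
        have h3 := Nat.mul_le_of_le_div _ _ _ h2
        have h4 : (k₀ + s + 1) * (t + 1) = (k₀ + s) * (t + 1) + (t + 1) := by ring
        omega
      have h5 : k₀ * (t + 1) ≤ (k₀ + s) * (t + 1) := Nat.mul_le_mul_right _ (by omega)
      have h6 : (k₀ + s) * (t + 1) - i < n := by omega
      have h7 := congrFun hx ⟨_, h6⟩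
      simp only [hW, ← Function.iterate_add_apply] at h7
      simp only [hu, h6, dite_true, ← h7, ← Function.iterate_add_apply, ← Function.iterate_mul]
      congr 2
      rw [Nat.sub_add_cancel (hk.trans h5)]
      ring
    · rw [(hμ.iterate k₀).measure_preimage]
      · exact measure_itinerarySet_le hμ.measurable hp hlow u (c i)
      · have : itinerarySet F^[t + 1] (fun k => p ⁻¹' {k}) u (c i) =
            ⋂ i', ⋂ (_ : i' < c i), (F^[t + 1])^[i'] ⁻¹' (p ⁻¹' {u i'}) := by
          ext; simp [itinerarySet]
        rw [this]
        exact (MeasurableSet.iInter fun i' => MeasurableSet.iInter fun _ =>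
          (hμ.measurable.iterate i') (hp (measurableSet_singleton _))).nullMeasurableSet
  have hmain := average_le_sum_negMulLog t (fun i w => ((μ.map F^[i]) (W ⁻¹' {w})).toReal)
    (fun i => c i * Real.log (Fintype.card κ)) (fun _ _ => ENNReal.toReal_nonneg)
    (fun i => by
      rw [← ENNReal.toReal_sum (fun _ _ => measure_ne_top _ _),
        sum_measure_preimage_singleton _ (fun y _ => hWm (measurableSet_singleton y))]
      simp) hatom
  have hcsum : ∑ i ∈ Finset.range (t + 1), (c i : ℝ) = n := by
    have := sum_ceilDiv_sub t n
    simp only [hc, Nat.cast_sub (hcle _), Finset.sum_sub_distrib]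
    linarith
  rw [← Finset.sum_mul, hcsum] at hmain
  refine le_trans (le_of_eq ?_) (hmain.trans (le_of_eq ?_))
  · field_simp
  · rw [partitionEntropy]
    refine Finset.sum_congr rfl fun w _ => ?_
    rw [averageMeasure_apply, ENNReal.toReal_mul, ENNReal.toReal_sum (fun _ _ => measure_ne_top _ _),
      ENNReal.toReal_inv, ENNReal.toReal_add (by simp) (by simp)]
    simp

end InvariantLimits

section EntropyBound

theorem negMulLog_add_mul_log_le {p q : ℝ} (hp : 0 ≤ p) (hq : 0 < q) :
    Real.negMulLog p ≤ p * (-Real.log q) + (q - p) := by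
  rcases hp.eq_or_lt with rfl | hp
  · simpa using hq.le
  · have h1 := Real.log_le_sub_one_of_pos (div_pos hq hp)
    rw [Real.log_div hq.ne' hp.ne'] at h1
    have h2 : p * (q / p) = q := by field_simp
    rw [Real.negMulLog]
    nlinarith

/-- Gibbs inequality: the entropy of a partition is at most its cross entropy with respect to any
positive probability vector. -/
theorem partitionEntropy_le_integral {Y ι : Type*} [MeasurableSpace Y] [Fintype ι]
    [MeasurableSpace ι] [MeasurableSingletonClass ι] {μ : Measure Y} [IsProbabilityMeasure μ]
    {W : Y → ι} (hW : Measurable W) {Q : ι → ℝ} (hQ : ∀ u, 0 < Q u) (hQ1 : ∑ u, Q u = 1) :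
    partitionEntropy μ W ≤ ∫ x, -Real.log (Q (W x)) ∂μ := by
  have hprob : IsProbabilityMeasure (μ.map W) := Measure.isProbabilityMeasure_map hW.aemeasurable
  have h1 : ∫ x, -Real.log (Q (W x)) ∂μ = ∑ u, (μ (W ⁻¹' {u})).toReal * -Real.log (Q u) := by
    rw [← integral_map (f := fun u => -Real.log (Q u)) hW.aemeasurable
      (measurable_of_finite _).aestronglyMeasurable, integral_fintype (Integrable.of_finite)]
    simp [Measure.real, Measure.map_apply hW (measurableSet_singleton _)]
  have h2 : ∑ u, (μ (W ⁻¹' {u})).toReal = 1 := by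
    rw [← ENNReal.toReal_sum (fun _ _ => measure_ne_top _ _),
      sum_measure_preimage_singleton _ (fun y _ => hW (measurableSet_singleton y))]
    simp
  rw [h1]
  calc partitionEntropy μ W ≤ ∑ u, ((μ (W ⁻¹' {u})).toReal * -Real.log (Q u) +
        (Q u - (μ (W ⁻¹' {u})).toReal)) :=
        Finset.sum_le_sum fun u _ => negMulLog_add_mul_log_le ENNReal.toReal_nonneg (hQ u)
    _ = _ := by
      rw [Finset.sum_add_distrib, Finset.sum_sub_distrib, hQ1, h2]
      ring

/-- The path of a deterministic automaton with states `α` reading the letters `d`. -/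
def automatonPath {α β : Type*} (step : α → β → α) (s : α) (d : ℕ → β) : ℕ → α
  | 0 => s
  | n + 1 => step (automatonPath step s d n) (d n)

/-- If the orbits of `F` can be followed by an automaton with alphabet `β` and the partition `p` is
almost a function of the state, then the entropy of the words of length `n` is at most
`log (card θ) + n (log (card β) + log 2 + 1)`. -/
theorem partitionEntropy_le_of_automaton {Y α β θ : Type*} [MeasurableSpace Y] [Fintype β]
    [Nonempty β] [Fintype θ] {F : Y → Y} {μ : Measure Y} [IsProbabilityMeasure μ]
    (hμ : MeasurePreserving F μ μ) {k : ℕ} {p : Y → Fin k} (hp : Measurable p)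
    {cell : Y → α} {step : α → β → α} (hstep : ∀ x, ∃ d, cell (F x) = step (cell x) d)
    {init : θ → α} (hinit : ∀ x, ∃ m, cell x = init m) {r : α → Fin k}
    (hr : Measurable fun x => r (cell x))
    (hη : μ.real {x | p x ≠ r (cell x)} * Real.log k ≤ 1) (n : ℕ) :
    partitionEntropy μ (fun x (i : Fin n) => p (F^[(i : ℕ)] x)) ≤
      Real.log (Fintype.card θ) + n * (Real.log (Fintype.card β) + Real.log 2 + 1) := by
  classical
  obtain ⟨x₀⟩ : Nonempty Y := nonempty_of_isProbabilityMeasure μ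
  have hkpos : 0 < k := (p x₀).pos
  have hkR : (0 : ℝ) < k := by exact_mod_cast hkpos
  have hk1 : (1 : ℝ) ≤ k := by exact_mod_cast hkpos
  have hθ : Nonempty θ := ⟨(hinit x₀).choose⟩
  choose d hd using hstep
  choose m hm using hinit
  set ext : (Fin n → β) → ℕ → β := fun w i => if h : i < n then w ⟨i, h⟩ else
    Classical.arbitrary β with hext
  set e : Fin k → Fin k → ℝ := fun s t => (if s = t then 2⁻¹ else 0) + (2 * (k : ℝ))⁻¹ with he
  have hepos : ∀ s t, 0 < e s t := fun s t => by
    simp only [he]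
    split_ifs <;> positivity
  have hesum : ∀ s, ∑ t, e s t = 1 := fun s => by
    simp only [he, Finset.sum_add_distrib, Finset.sum_ite_eq, Finset.mem_univ, if_true,
      Finset.sum_const, Finset.card_univ, Fintype.card_fin, nsmul_eq_mul]
    field_simp
    norm_num
  set v : θ × (Fin n → β) → ℕ → α := fun t => automatonPath step (init t.1) (ext t.2) with hv
  obtain ⟨N, hN⟩ : ∃ N : ℝ, N = (Fintype.card (θ × (Fin n → β)) : ℝ) := ⟨_, rfl⟩
  have hNpos : 0 < N := by
    rw [hN]; exact_mod_cast Fintype.card_pos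
  set Q : (Fin n → Fin k) → ℝ := fun u => N⁻¹ * ∑ t, ∏ i : Fin n, e (r (v t i)) (u i) with hQ
  have hQpos : ∀ u, 0 < Q u := fun u =>
    mul_pos (by positivity) (Finset.sum_pos (fun t _ => Finset.prod_pos fun i _ => hepos _ _)
      Finset.univ_nonempty)
  have hQ1 : ∑ u, Q u = 1 := by
    simp only [hQ]
    rw [← Finset.mul_sum, Finset.sum_comm]
    have : ∀ t, ∑ u : Fin n → Fin k, ∏ i : Fin n, e (r (v t i)) (u i) = 1 := fun t => by
      rw [← Fintype.prod_sum]
      simp [hesum]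
    simp only [this, Finset.sum_const, Finset.card_univ, nsmul_eq_mul, mul_one]
    rw [← hN]
    exact inv_mul_cancel₀ hNpos.ne'
  have hFm := hμ.measurable
  have hWm : Measurable fun x (i : Fin n) => p (F^[(i : ℕ)] x) :=
    measurable_pi_lambda _ fun i => hp.comp (hFm.iterate i)
  refine (partitionEntropy_le_integral hWm hQpos hQ1).trans ?_
  set E : Set Y := {x | p x ≠ r (cell x)} with hE
  have hEm : MeasurableSet E := (measurableSet_eq_fun hp hr).compl
  have hpt : ∀ x, -Real.log (Q fun i => p (F^[(i : ℕ)] x)) ≤ Real.log N +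
      ∑ i ∈ Finset.range n, (Real.log 2 + (F^[i] ⁻¹' E).indicator (fun _ => Real.log k) x) := by
    intro x
    set t : θ × (Fin n → β) := (m x, fun i => d (F^[(i : ℕ)] x)) with ht
    have hvt : ∀ i ≤ n, v t i = cell (F^[i] x) := by
      intro i hi
      induction i with
      | zero => exact (hm x).symm
      | succ i ih =>
        have h1 : v t (i + 1) = step (v t i) (ext t.2 i) := rfl
        rw [h1, ih (by omega), Function.iterate_succ_apply', hd]
        congr 1
        simp [hext, ht, show i < n by omega]
    have h1 : N⁻¹ * ∏ i : Fin n, e (r (v t i)) (p (F^[(i : ℕ)] x)) ≤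
        Q fun i => p (F^[(i : ℕ)] x) := by
      simp only [hQ]
      gcongr
      exact Finset.single_le_sum
        (f := fun t => ∏ i : Fin n, e (r (v t i)) (p (F^[(i : ℕ)] x)))
        (fun t _ => Finset.prod_nonneg fun i _ => (hepos _ _).le)
        (Finset.mem_univ t)
    have hprod : 0 < ∏ i : Fin n, e (r (v t i)) (p (F^[(i : ℕ)] x)) :=
      Finset.prod_pos fun i _ => hepos _ _
    have h2 := Real.log_le_log (mul_pos (inv_pos.2 hNpos) hprod) h1
    rw [Real.log_mul (inv_pos.2 hNpos).ne' hprod.ne', Real.log_inv,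
      Real.log_prod (fun i _ => (hepos _ _).ne')] at h2
    have h3 : ∀ i : Fin n, -Real.log (e (r (v t i)) (p (F^[(i : ℕ)] x))) ≤
        Real.log 2 + (F^[(i : ℕ)] ⁻¹' E).indicator (fun _ => Real.log k) x := by
      intro i
      rw [hvt i i.2.le]
      by_cases hx : F^[(i : ℕ)] x ∈ E
      · rw [indicator_of_mem (by exact hx)]
        have : e (r (cell (F^[(i : ℕ)] x))) (p (F^[(i : ℕ)] x)) = (2 * (k : ℝ))⁻¹ := by
          simp only [he]
          rw [if_neg (fun h => hx h.symm), zero_add]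
        rw [this, Real.log_inv, neg_neg, Real.log_mul (by norm_num) hkR.ne']
      · rw [indicator_of_notMem (by exact hx), add_zero, ← neg_neg (Real.log 2), neg_le_neg_iff,
          ← Real.log_inv]
        apply Real.log_le_log (by norm_num)
        have hx' : p (F^[(i : ℕ)] x) = r (cell (F^[(i : ℕ)] x)) := by
          by_contra h
          exact hx h
        simp only [he]
        rw [if_pos hx'.symm]
        have : (0 : ℝ) < (2 * (k : ℝ))⁻¹ := by positivity
        linarith
    have h4 := Finset.sum_le_sum fun i (_ : i ∈ Finset.univ) => h3 i
    rw [Finset.sum_neg_distrib, Fin.sum_univ_eq_sum_range (fun i => Real.log 2 +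
      (F^[i] ⁻¹' E).indicator (fun _ => Real.log k) x)] at h4
    linarith
  have hind : ∀ i, Integrable ((F^[i] ⁻¹' E).indicator fun _ => Real.log k) μ := fun i =>
    (integrable_const _).indicator (hFm.iterate i hEm)
  have hind' : ∀ i, Integrable (fun x => Real.log 2 +
      (F^[i] ⁻¹' E).indicator (fun _ => Real.log k) x) μ := fun i =>
    (integrable_const _).add (hind i)
  have hright : Integrable (fun x => Real.log N +
      ∑ i ∈ Finset.range n, (Real.log 2 + (F^[i] ⁻¹' E).indicator (fun _ => Real.log k) x)) μ :=
    (integrable_const _).add (integrable_finsetSum _ fun i _ => hind' i)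
  have hleft : Integrable (fun x => -Real.log (Q fun i => p (F^[(i : ℕ)] x))) μ := by
    have hprob : IsProbabilityMeasure (μ.map fun x (i : Fin n) => p (F^[(i : ℕ)] x)) :=
      Measure.isProbabilityMeasure_map hWm.aemeasurable
    exact (Integrable.of_finite (f := fun u => -Real.log (Q u))
      (μ := μ.map fun x (i : Fin n) => p (F^[(i : ℕ)] x))).comp_measurable hWm
  refine (integral_mono hleft hright hpt).trans ?_
  rw [integral_add (integrable_const _)
    (integrable_finsetSum _ fun i _ => hind' i), integral_finsetSum _ fun i _ => hind' i]
  have hi : ∀ i, ∫ x, (Real.log 2 + (F^[i] ⁻¹' E).indicator (fun _ => Real.log k) x) ∂μ ≤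
      Real.log 2 + 1 := fun i => by
    rw [integral_add (integrable_const _) (hind i), integral_indicator (hFm.iterate i hEm)]
    simp only [integral_const, smul_eq_mul, Measure.real, measure_univ, Measure.restrict_apply,
      MeasurableSet.univ, univ_inter, (hμ.iterate i).measure_preimage hEm.nullMeasurableSet]
    have : (μ E).toReal * Real.log k ≤ 1 := hη
    simp only [ENNReal.toReal_one, one_mul]
    linarith
  have hsum := Finset.sum_le_sum fun i (_ : i ∈ Finset.range n) => hi i
  rw [Finset.sum_const, Finset.card_range, nsmul_eq_mul] at hsum
  have hlogN : Real.log N = Real.log (Fintype.card θ) + n * Real.log (Fintype.card β) := by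
    rw [hN, Fintype.card_prod, Fintype.card_fun, Fintype.card_fin]
    push_cast
    rw [Real.log_mul (by simp) (by simp), Real.log_pow]
  simp only [integral_const, smul_eq_mul, Measure.real, measure_univ, ENNReal.toReal_one, one_mul]
  rw [hlogN]
  linarith

end EntropyBound

section IntervalEntropyBound

theorem partitionEntropy_nonneg {Y ι : Type*} [MeasurableSpace Y] [Fintype ι]
    (μ : Measure Y) [IsProbabilityMeasure μ] (p : Y → ι) : 0 ≤ partitionEntropy μ p :=
  Finset.sum_nonneg fun i _ => Real.negMulLog_nonneg ENNReal.toReal_nonneg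
    (by simpa using ENNReal.toReal_mono ENNReal.one_ne_top (prob_le_one (μ := μ)))

theorem bddBelow_partitionEntropy_div {Y κ : Type*} [MeasurableSpace Y] [Fintype κ]
    (μ : Measure Y) [IsProbabilityMeasure μ] (F : Y → Y) (p : Y → κ) :
    BddBelow (range fun n : ℕ =>
      partitionEntropy μ (fun x (i : Fin (n + 1)) => p (F^[(i : ℕ)] x)) / ((n : ℝ) + 1)) :=
  ⟨0, by
    rintro _ ⟨n, rfl⟩
    exact div_nonneg (partitionEntropy_nonneg _ _) (by positivity)⟩

theorem abs_floor_sub_floor_le {x y D : ℝ} {N : ℕ} (h : |x - y| ≤ D) (hD : D ≤ N) :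
    ⌊x⌋ - ⌊y⌋ ∈ Finset.Icc (-(N + 1 : ℤ)) (N + 1) := by
  have h1 := Int.floor_le x
  have h2 := Int.lt_floor_add_one x
  have h3 := Int.floor_le y
  have h4 := Int.lt_floor_add_one y
  have h5 := abs_le.1 (h.trans hD)
  rw [Finset.mem_Icc]
  constructor
  · have : (-(N + 1 : ℤ) : ℝ) < ⌊x⌋ - ⌊y⌋ + 1 := by push_cast; linarith
    have h6 : -(N + 1 : ℤ) < ⌊x⌋ - ⌊y⌋ + 1 := by exact_mod_cast this
    omega
  · have : (⌊x⌋ - ⌊y⌋ : ℝ) < (N + 1 : ℤ) + 1 := by push_cast; linarith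
    have h6 : ⌊x⌋ - ⌊y⌋ < (N + 1 : ℤ) + 1 := by exact_mod_cast this
    omega

/-- A finite measurable partition of an interval is, up to small measure, a function of the cell
of a fine grid. -/
theorem exists_grid_approx {a b : ℝ} {k : ℕ} (μ : Measure (Icc a b)) [IsProbabilityMeasure μ]
    {p : Icc a b → Fin k} (hp : Measurable p) :
    ∃ (R : ℝ) (r : ℤ → Fin k), 0 < R ∧
      μ.real {x | p x ≠ r ⌊(x : ℝ) * R⌋} * Real.log k ≤ 1 := by
  classical
  obtain ⟨x₀⟩ : Nonempty (Icc a b) := nonempty_of_isProbabilityMeasure μ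
  set q : Icc a b → ℝ := fun x => ((p x : ℕ) : ℝ) with hq
  have hqm : Measurable q := (measurable_of_finite fun i : Fin k => ((i : ℕ) : ℝ)).comp hp
  have hqi : Integrable q μ := Integrable.of_bound hqm.aestronglyMeasurable k
    (Eventually.of_forall fun x => by
      simp only [hq, Real.norm_natCast]
      exact_mod_cast (p x).2.le)
  have hlog : 0 ≤ Real.log k := Real.log_natCast_nonneg k
  obtain ⟨g, -, hg1, hg2, hg3⟩ := hqi.exists_hasCompactSupport_integral_sub_le
    (ε := (4 * (Real.log k + 1))⁻¹) (by positivity)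
  have huc : UniformContinuous g := CompactSpace.uniformContinuous_of_continuous hg2
  obtain ⟨δ, hδ, hδg⟩ := Metric.uniformContinuous_iff.1 huc (1 / 4) (by norm_num)
  set R : ℝ := 2 / δ with hR
  have hRpos : 0 < R := by positivity
  set rep : ℤ → Icc a b := fun z => if h : ∃ y : Icc a b, ⌊(y : ℝ) * R⌋ = z then h.choose else x₀
    with hrep
  set r : ℤ → Fin k := fun z => if h : ∃ j : Fin k, |((j : ℕ) : ℝ) - g (rep z)| < 1 / 2 then
    h.choose else p x₀ with hr
  refine ⟨R, r, hRpos, ?_⟩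
  have hsub : {x | p x ≠ r ⌊(x : ℝ) * R⌋} ⊆ {x | 1 / 4 ≤ ‖q x - g x‖} := by
    intro x hx
    by_contra hlt
    simp only [mem_ofPred_eq, not_le, Real.norm_eq_abs] at hlt
    apply hx
    have hex : ∃ y : Icc a b, ⌊(y : ℝ) * R⌋ = ⌊(x : ℝ) * R⌋ := ⟨x, rfl⟩
    have hrepx : ⌊(rep ⌊(x : ℝ) * R⌋ : ℝ) * R⌋ = ⌊(x : ℝ) * R⌋ := by
      simp only [hrep, dif_pos hex]
      exact hex.choose_spec
    have hdist : dist x (rep ⌊(x : ℝ) * R⌋) < δ := by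
      have h1 := Int.abs_sub_lt_one_of_floor_eq_floor hrepx.symm
      rw [← sub_mul, abs_mul, abs_of_pos hRpos, hR, ← lt_div_iff₀ (by positivity)] at h1
      rw [Subtype.dist_eq, Real.dist_eq]
      refine h1.trans_le ?_
      rw [one_div_div]
      linarith
    have hg4 := hδg hdist
    rw [Real.dist_eq] at hg4
    have h5 : |((p x : ℕ) : ℝ) - g (rep ⌊(x : ℝ) * R⌋)| < 1 / 2 := by
      have h6 : ((p x : ℕ) : ℝ) - g (rep ⌊(x : ℝ) * R⌋) =
        (q x - g x) + (g x - g (rep ⌊(x : ℝ) * R⌋)) := by simp only [hq]; ring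
      rw [h6]
      exact (abs_add_le _ _).trans_lt (by linarith)
    have hex2 : ∃ j : Fin k, |((j : ℕ) : ℝ) - g (rep ⌊(x : ℝ) * R⌋)| < 1 / 2 := ⟨p x, h5⟩
    have h7 : r ⌊(x : ℝ) * R⌋ = hex2.choose := by
      simp only [hr, dif_pos hex2]
    rw [h7]
    have h8 := hex2.choose_spec
    have h9 : |((p x : ℕ) : ℝ) - ((hex2.choose : ℕ) : ℝ)| < 1 := by
      rw [abs_lt] at h5 h8 ⊢
      constructor <;> linarith
    have h10 : |((p x : ℕ) : ℤ) - ((hex2.choose : ℕ) : ℤ)| < 1 := by exact_mod_cast h9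
    rw [Int.abs_lt_one_iff] at h10
    exact Fin.ext (by omega)
  have hnorm : Integrable (fun x => ‖q x - g x‖) μ := (hqi.sub hg3).norm
  have hmk := mul_meas_ge_le_integral_of_nonneg (μ := μ)
    (Eventually.of_forall fun x => norm_nonneg (q x - g x)) hnorm (1 / 4)
  have hle : μ.real {x | p x ≠ r ⌊(x : ℝ) * R⌋} ≤ μ.real {x | 1 / 4 ≤ ‖q x - g x‖} :=
    measureReal_mono hsub
  have h11 : μ.real {x | p x ≠ r ⌊(x : ℝ) * R⌋} ≤ (Real.log k + 1)⁻¹ := by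
    have : (4 * (Real.log k + 1))⁻¹ = (1 / 4) * (Real.log k + 1)⁻¹ := by
      rw [mul_inv]; norm_num
    rw [this] at hg1
    linarith
  calc _ ≤ (Real.log k + 1)⁻¹ * Real.log k := by gcongr
    _ ≤ 1 := by
      rw [inv_mul_le_iff₀ (by positivity)]
      linarith

/-- The entropies of a Lipschitz self-map of an interval are uniformly bounded. -/
theorem exists_entropy_bound {a b : ℝ} {F : Icc a b → Icc a b} {L : NNReal}
    (hF : LipschitzWith L F) :
    ∃ C : ℝ, 0 ≤ C ∧ ∀ μ : Measure (Icc a b), IsProbabilityMeasure μ → MeasurePreserving F μ μ →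
      ∀ (k : ℕ) (p : Icc a b → Fin k), Measurable p →
        ⨅ n : ℕ, partitionEntropy μ (fun x (i : Fin (n + 1)) => p (F^[(i : ℕ)] x)) /
          ((n : ℝ) + 1) ≤ C := by
  classical
  obtain ⟨D, hD⟩ := exists_nat_ge (L : ℝ)
  set β := ↥(Finset.Icc (-(D + 1 : ℤ)) (D + 1)) with hβ
  have hβne : Nonempty β := ⟨⟨0, by rw [Finset.mem_Icc]; omega⟩⟩
  set C : ℝ := Real.log (Fintype.card β) + Real.log 2 + 1 with hC
  have hC0 : 0 ≤ C := by
    have := Real.log_natCast_nonneg (Fintype.card β)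
    have := Real.log_nonneg (one_le_two (α := ℝ))
    positivity
  refine ⟨C, hC0, fun μ hμ hinv k p hp => ?_⟩
  obtain ⟨x₀⟩ : Nonempty (Icc a b) := nonempty_of_isProbabilityMeasure μ
  obtain ⟨R, r, hR, hη⟩ := exists_grid_approx μ hp
  set cell : Icc a b → ℤ := fun x => ⌊(x : ℝ) * R⌋ with hcell
  set rep : ℤ → Icc a b := fun z => if h : ∃ y : Icc a b, cell y = z then h.choose else x₀
    with hrep
  set θ := ↥(Finset.Icc ⌊a * R⌋ ⌊b * R⌋) with hθ
  have hbound := fun n => partitionEntropy_le_of_automaton (β := β) (θ := θ) hinv hp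
    (cell := cell) (step := fun z d => cell (F (rep z)) + d) (fun x => by
      have hex : ∃ y : Icc a b, cell y = cell x := ⟨x, rfl⟩
      have hrepx : cell (rep (cell x)) = cell x := by
        simp only [hrep, dif_pos hex]
        exact hex.choose_spec
      have h1 := (Int.abs_sub_lt_one_of_floor_eq_floor hrepx.symm).le
      rw [← sub_mul, abs_mul, abs_of_pos hR] at h1
      have h2 := hF.dist_le_mul x (rep (cell x))
      rw [Subtype.dist_eq, Subtype.dist_eq, Real.dist_eq, Real.dist_eq] at h2
      have h3 : |(F x : ℝ) * R - (F (rep (cell x)) : ℝ) * R| ≤ L := by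
        rw [← sub_mul, abs_mul, abs_of_pos hR]
        calc _ ≤ (L * |(x : ℝ) - rep (cell x)|) * R := by gcongr
          _ = L * (|(x : ℝ) - rep (cell x)| * R) := by ring
          _ ≤ L * 1 := by gcongr
          _ = L := mul_one _
      exact ⟨⟨_, abs_floor_sub_floor_le h3 hD⟩, by simp [hcell]⟩)
    (init := fun z => (z : ℤ)) (fun x => by
      refine ⟨⟨cell x, ?_⟩, rfl⟩
      rw [Finset.mem_Icc]
      exact ⟨Int.floor_le_floor (by gcongr; exact x.2.1),
        Int.floor_le_floor (by gcongr; exact x.2.2)⟩)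
    (r := r) ((measurable_of_countable r).comp
      (Int.measurable_floor.comp (measurable_subtype_coe.mul_const R))) hη n
  refine le_of_forall_pos_le_add fun ε hε => ?_
  obtain ⟨n, hn⟩ := exists_nat_ge (Real.log (Fintype.card θ) / ε)
  refine (ciInf_le (bddBelow_partitionEntropy_div μ F p) n).trans ?_
  rw [div_le_iff₀ (by positivity)]
  refine (hbound (n + 1)).trans ?_
  rw [div_le_iff₀ hε] at hn
  push_cast
  nlinarith

end IntervalEntropyBound

section Pressure

variable {a b : ℝ} {f : ℝ → ℝ} (hmaps : MapsTo f (Icc a b) (Icc a b))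

theorem measurableEmbedding_val_Icc : MeasurableEmbedding ((↑) : Icc a b → ℝ) :=
  MeasurableEmbedding.subtype_coe measurableSet_Icc

theorem val_iterate_restrict (n : ℕ) (x : Icc a b) :
    ((hmaps.restrict f _ _)^[n] x : ℝ) = f^[n] x := by
  induction n with
  | zero => rfl
  | succ n ih => rw [Function.iterate_succ_apply', Function.iterate_succ_apply', ← ih]; rfl

theorem invariantProb_map_val {μ : Measure (Icc a b)} [IsProbabilityMeasure μ]
    (hμ : MeasurePreserving (hmaps.restrict f _ _) μ μ) :
    InvariantProb f (Icc a b) (μ.map (↑)) := by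
  have he := measurableEmbedding_val_Icc (a := a) (b := b)
  refine ⟨Measure.isProbabilityMeasure_map he.measurable.aemeasurable, ?_, fun A hA => ?_⟩
  · rw [he.map_apply]
    have : ((↑) : Icc a b → ℝ) ⁻¹' Icc a b = univ := by ext x; simp
    rw [this, measure_univ]
  · rw [he.map_apply, he.map_apply,
      ← hμ.measure_preimage (he.measurable hA).nullMeasurableSet]
    rfl

theorem exists_map_val_eq {μ' : Measure ℝ} (hμ' : InvariantProb f (Icc a b) μ') :
    ∃ μ : Measure (Icc a b), IsProbabilityMeasure μ ∧
      (Measurable (hmaps.restrict f _ _) → MeasurePreserving (hmaps.restrict f _ _) μ μ) ∧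
      μ.map (↑) = μ' := by
  obtain ⟨hp, h1, h2⟩ := hμ'
  have he := measurableEmbedding_val_Icc (a := a) (b := b)
  have hae : ∀ᵐ x ∂μ', x ∈ Icc a b := by
    rw [← prob_compl_eq_zero_iff measurableSet_Icc] at h1
    exact h1
  have hmap : (μ'.comap ((↑) : Icc a b → ℝ)).map (↑) = μ' := by
    rw [he.map_comap, Subtype.range_coe, Measure.restrict_eq_self_of_ae_mem hae]
  have happ : ∀ A : Set ℝ, (μ'.comap ((↑) : Icc a b → ℝ)) ((↑) ⁻¹' A) = μ' A := fun A => by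
    rw [← he.map_apply, hmap]
  refine ⟨μ'.comap (↑), ⟨?_⟩, fun hm => ⟨hm, ?_⟩, hmap⟩
  · rw [← preimage_univ (f := ((↑) : Icc a b → ℝ)), happ]
    exact hp.measure_univ
  · ext A hA
    rw [Measure.map_apply hm hA]
    obtain ⟨A', hA', rfl⟩ := hA
    rw [happ, ← h2 A' hA', ← happ]
    rfl

theorem partitionEntropy_map_val {κ : Type*} [Fintype κ] (μ : Measure (Icc a b)) (p : ℝ → κ)
    (n : ℕ) :
    partitionEntropy (μ.map (↑)) (fun x (i : Fin n) => p (f^[(i : ℕ)] x)) =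
      partitionEntropy μ (fun x (i : Fin n) => p ((hmaps.restrict f _ _)^[(i : ℕ)] x : Icc a b)) := by
  simp only [partitionEntropy]
  refine Finset.sum_congr rfl fun u _ => ?_
  rw [measurableEmbedding_val_Icc.map_apply]
  congr 3
  ext x
  simp [val_iterate_restrict hmaps]

theorem exists_pressure_bounds {L : NNReal} (hL : LipschitzWith L (hmaps.restrict f _ _))
    {φ : ℝ → ℝ} (hφ : Continuous fun x : Icc a b => φ x) :
    ∀ (μ : Measure (Icc a b)) [IsProbabilityMeasure μ],
      MeasurePreserving (hmaps.restrict f _ _) μ μ → ∀ (k : ℕ) (p : Icc a b → Fin k),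
      Measurable p → (⨅ n : ℕ, partitionEntropy μ
        (fun x (i : Fin (n + 1)) => p ((hmaps.restrict f _ _)^[(i : ℕ)] x)) / ((n : ℝ) + 1)) +
        ∫ x, φ x ∂μ ≤ pressure f (Icc a b) φ := by
  intro μ _ hμ k p hp
  obtain ⟨C, hC0, hC⟩ := exists_entropy_bound hL
  have he := measurableEmbedding_val_Icc (a := a) (b := b)
  obtain ⟨M, hM⟩ : ∃ M, ∀ x : Icc a b, ‖φ x‖ ≤ M := by
    obtain ⟨M, hM⟩ := (isCompact_range hφ).isBounded.exists_norm_le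
    exact ⟨M, fun x => hM _ ⟨x, rfl⟩⟩
  have hval : ∀ (μ : Measure (Icc a b)), IsProbabilityMeasure μ →
      MeasurePreserving (hmaps.restrict f _ _) μ μ → ∀ (k : ℕ)
      (p : {p : ℝ → Fin k // Measurable p}), ⨅ n : ℕ, partitionEntropy (μ.map (↑))
        (fun x (i : Fin (n + 1)) => p.1 (f^[(i : ℕ)] x)) / ((n : ℝ) + 1) ≤ C := by
    intro μ hp hμ k p
    simp only [partitionEntropy_map_val hmaps]
    exact hC μ hp hμ k (fun x => p.1 x) (p.2.comp measurable_subtype_coe)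
  have hbdd : BddAbove {r : ℝ | ∃ μ : Measure ℝ, InvariantProb f (Icc a b) μ ∧
      r = ksEntropy μ f + ∫ x, φ x ∂μ} := by
    refine ⟨C + M, ?_⟩
    rintro _ ⟨μ', hμ', rfl⟩
    obtain ⟨μ, hprob, hinv, rfl⟩ := exists_map_val_eq hmaps hμ'
    have hinv' := hinv hL.continuous.measurable
    refine add_le_add ?_ ?_
    · exact Real.iSup_le (fun k => Real.iSup_le (hval μ hprob hinv' k) hC0) hC0
    · rw [he.integral_map]
      have := norm_integral_le_of_norm_le_const (μ := μ) (Eventually.of_forall hM)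
      simp only [Measure.real, measure_univ, ENNReal.toReal_one, mul_one] at this
      exact (le_abs_self _).trans this
  refine le_trans ?_ (le_csSup hbdd ⟨μ.map (↑), invariantProb_map_val hmaps hμ, rfl⟩)
  rw [he.integral_map]
  refine add_le_add ?_ le_rfl
  obtain ⟨x₀⟩ : Nonempty (Icc a b) := nonempty_of_isProbabilityMeasure μ
  obtain ⟨p', hp', rfl⟩ := he.exists_measurable_extend hp fun _ => ⟨p x₀⟩
  have h1 := le_ciSup (f := fun p : {p : ℝ → Fin k // Measurable p} =>
      ⨅ n : ℕ, partitionEntropy (μ.map (↑))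
        (fun x (i : Fin (n + 1)) => p.1 (f^[(i : ℕ)] x)) / ((n : ℝ) + 1))
    ⟨C, by rintro _ ⟨p, rfl⟩; exact hval μ inferInstance hμ k p⟩ ⟨p', hp'⟩
  have h2 := le_ciSup (f := fun k : ℕ => ⨆ p : {p : ℝ → Fin k // Measurable p},
      ⨅ n : ℕ, partitionEntropy (μ.map (↑))
        (fun x (i : Fin (n + 1)) => p.1 (f^[(i : ℕ)] x)) / ((n : ℝ) + 1))
    ⟨C, by
      rintro _ ⟨k, rfl⟩
      exact Real.iSup_le (hval μ inferInstance hμ k) hC0⟩ k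
  refine le_trans (le_of_eq ?_) (h1.trans h2)
  simp only [partitionEntropy_map_val hmaps]
  rfl

theorem measurePreserving_average {X : Type*} [MeasurableSpace X] {F : X → X} (hF : Measurable F)
    {t : ℕ} {μ : Measure X} (hμ : MeasurePreserving F^[t + 1] μ μ) :
    MeasurePreserving F (averageMeasure (fun i => μ.map F^[i]) t)
      (averageMeasure (fun i => μ.map F^[i]) t) := by
  refine ⟨hF, ?_⟩
  have h1 : ∀ i, (μ.map F^[i]).map F = μ.map F^[i + 1] := fun i => by
    rw [Measure.map_map hF (hF.iterate i), Function.iterate_succ']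
  rw [averageMeasure, Measure.map_smul, Measure.map_finset_sum hF.aemeasurable]
  simp only [h1]
  rw [Finset.sum_range_succ, hμ.map_eq, Finset.sum_range_succ' (fun i => μ.map F^[i])]
  simp

/-- A full horseshoe for an iterate of `f` on which the Birkhoff sums are bounded below bounds the
pressure from below. -/
theorem le_pressure_of_horseshoe (hab : a ≤ b) {L : NNReal}
    (hL : LipschitzWith L (hmaps.restrict f _ _))
    {φ : ℝ → ℝ} (hφ : Continuous fun x : Icc a b => φ x) {κ : Type*} [Fintype κ] [Nonempty κ]
    {J : κ → Set (Icc a b)} (hJc : ∀ k, IsClosed (J k)) (hJd : Pairwise fun k l => Disjoint (J k) (J l))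
    (t : ℕ) (hJ : ∀ k x, ∃ y ∈ J k, (hmaps.restrict f _ _)^[t + 1] y = x) {c : ℝ}
    (hc : ∀ k, ∀ x ∈ J k, c ≤ birkhoffSum (hmaps.restrict f _ _) (fun x => φ x) (t + 1) x) :
    (Real.log (Fintype.card κ) + c) / (t + 1) ≤ pressure f (Icc a b) φ := by
  classical
  have hX : Nonempty (Icc a b) := ⟨⟨a, le_rfl, hab⟩⟩
  set F := hmaps.restrict f _ _ with hF
  have hFc : Continuous F := hL.continuous
  obtain ⟨N, ⟨e⟩⟩ := Finite.exists_equiv_fin κ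
  let : MeasurableSpace κ := ⊤
  obtain ⟨μ, hμp, hμ, hlow⟩ := exists_horseshoe_measure (hFc.iterate (t + 1)) hJc hJ
  set p : Icc a b → κ := fun x => if h : ∃ k, x ∈ J k then h.choose else Classical.arbitrary κ
    with hp
  have hpJ : ∀ k, ∀ x ∈ J k, p x = k := by
    intro k x hx
    have hex : ∃ k, x ∈ J k := ⟨k, hx⟩
    simp only [hp, dif_pos hex]
    by_contra hne
    exact (hJd hne).le_bot ⟨hex.choose_spec, hx⟩
  have hUm : MeasurableSet (⋃ k, J k) := MeasurableSet.iUnion fun k => (hJc k).measurableSet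
  have hpm : Measurable p := by
    refine measurable_to_countable' fun k => ?_
    have : p ⁻¹' {k} = J k ∪ (if k = Classical.arbitrary κ then (⋃ k, J k)ᶜ else ∅) := by
      ext x
      simp only [mem_preimage, mem_singleton_iff, mem_union]
      by_cases hex : ∃ k, x ∈ J k
      · obtain ⟨l, hl⟩ := hex
        rw [hpJ l x hl]
        constructor
        · rintro rfl; exact Or.inl hl
        · rintro (h | h)
          · rw [← hpJ l x hl, hpJ k x h]
          · split_ifs at h
            · exact absurd (mem_iUnion.2 ⟨l, hl⟩) h
            · exact h.elim
      · have h1 : p x = Classical.arbitrary κ := by simp only [hp, dif_neg hex]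
        rw [h1]
        constructor
        · rintro rfl
          right
          simpa using hex
        · rintro (h | h)
          · exact absurd ⟨k, h⟩ hex
          · split_ifs at h with h2
            · exact h2.symm
            · exact h.elim
    rw [this]
    refine (hJc k).measurableSet.union ?_
    split_ifs
    · exact hUm.compl
    · exact MeasurableSet.empty
  have hlow' : ∀ u n, ((Fintype.card κ : ENNReal)⁻¹) ^ n ≤
      μ (itinerarySet F^[t + 1] (fun k => p ⁻¹' {k}) u n) := fun u n =>
    (hlow u n).trans (measure_mono fun x hx i hi => hpJ _ _ (hx i hi))
  have hfull : ∀ᵐ x ∂μ, x ∈ ⋃ k, J k := by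
    have h1 : (1 : ENNReal) ≤ μ (⋃ k, J k) := by
      rw [measure_iUnion hJd fun k => (hJc k).measurableSet, tsum_fintype]
      calc (1 : ENNReal) = ∑ _k : κ, (Fintype.card κ : ENNReal)⁻¹ := by
            rw [Finset.sum_const, Finset.card_univ, nsmul_eq_mul,
              ENNReal.mul_inv_cancel (by simp) (by simp)]
        _ ≤ _ := Finset.sum_le_sum fun k _ => by
            have := hlow (fun _ => k) 1
            rw [pow_one] at this
            refine this.trans (measure_mono fun x hx => ?_)
            simpa using hx 0 one_pos
    have h2 : μ (⋃ k, J k) = 1 := le_antisymm prob_le_one h1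
    rw [← prob_compl_eq_zero_iff hUm] at h2
    exact h2
  have hprob : ∀ i, IsProbabilityMeasure (μ.map F^[i]) := fun i =>
    Measure.isProbabilityMeasure_map (hFc.iterate i).measurable.aemeasurable
  have hint : ∀ i, Integrable (fun x : Icc a b => φ x) (μ.map F^[i]) := fun i =>
    integrable_of_continuous hφ _
  have hinvA := measurePreserving_average (μ := μ) hFc.measurable hμ
  have hq := exists_pressure_bounds hmaps hL hφ
    (averageMeasure (fun i => μ.map F^[i]) t) hinvA N (fun x => e (p x))
    ((measurable_of_finite e).comp hpm)
  refine le_trans ?_ hq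
  rw [add_div]
  refine add_le_add (le_ciInf fun n => ?_) ?_
  · rw [le_div_iff₀ (by positivity)]
    have h1 := le_partitionEntropy_average (κ := Fin N) hFc t (μ := μ) hμ
      ((measurable_of_finite e).comp hpm) (fun u n => by
        have := hlow' (fun i => e.symm (u i)) n
        rw [Fintype.card_congr e] at this
        refine this.trans (measure_mono fun x hx i hi => ?_)
        have := hx i hi
        simp only [mem_preimage, mem_singleton_iff] at this ⊢
        exact e.symm_apply_eq.1 this.symm |>.symm) (n + 1)
    rw [← Fintype.card_congr e] at h1
    push_cast at h1
    rw [mul_comm]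
    exact h1
  · rw [integral_averageMeasure _ _ hint, div_eq_inv_mul]
    gcongr
    have h1 : ∀ i, ∫ y : Icc a b, φ y ∂(μ.map F^[i]) = ∫ y, φ (F^[i] y) ∂μ := fun i =>
      integral_map (hFc.iterate i).measurable.aemeasurable (hint i).aestronglyMeasurable
    simp only [h1]
    have h2 : ∀ i, Integrable (fun y => φ (F^[i] y)) μ := fun i =>
      integrable_of_continuous (hφ.comp (hFc.iterate i)) _
    rw [← integral_finsetSum _ fun i _ => h2 i]
    have h3 : ∫ _x, c ∂μ ≤ ∫ x, ∑ i ∈ Finset.range (t + 1), φ (F^[i] x) ∂μ := by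
      refine integral_mono_ae (integrable_const _) (integrable_finsetSum _ fun i _ => h2 i) ?_
      filter_upwards [hfull] with x hx
      obtain ⟨k, hk⟩ := mem_iUnion.1 hx
      exact hc k x hk
    simpa using h3

end Pressure

section ReturnWords

variable {X κ : Type*} (F : X → X) (A : κ → Set X) (τ : κ → ℕ)

/-- Total duration of a word of return branches. -/
def wordTime (l : List κ) : ℕ := (l.map τ).sum

/-- Points whose successive returns follow the branches of the word `l`. -/
def wordSet : List κ → Set X
  | [] => univ
  | k :: l => A k ∩ F^[τ k] ⁻¹' wordSet l

variable {F A τ}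

theorem wordTime_cons (k : κ) (l : List κ) : wordTime τ (k :: l) = τ k + wordTime τ l := by
  simp [wordTime]

theorem isClosed_wordSet [TopologicalSpace X] (hF : Continuous F) (hA : ∀ k, IsClosed (A k))
    (l : List κ) : IsClosed (wordSet F A τ l) := by
  induction l with
  | nil => exact isClosed_univ
  | cons k l ih => exact (hA k).inter (ih.preimage (hF.iterate _))

theorem disjoint_wordSet (hA : Pairwise fun k l => Disjoint (A k) (A l)) {l l' : List κ}
    (hlen : l.length = l'.length) (hne : l ≠ l') :
    Disjoint (wordSet F A τ l) (wordSet F A τ l') := by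
  induction l generalizing l' with
  | nil => exact absurd (List.length_eq_zero_iff.1 hlen.symm).symm hne
  | cons k l ih =>
    cases l' with
    | nil => simp at hlen
    | cons k' l' =>
      rw [Set.disjoint_left]
      rintro x ⟨h1, h2⟩ ⟨h3, h4⟩
      by_cases hk : k = k'
      · subst hk
        exact Set.disjoint_left.1 (ih (by simpa using hlen) (by simpa using hne)) h2 h4
      · exact Set.disjoint_left.1 (hA hk) h1 h3

theorem exists_mem_wordSet (hA : ∀ k x, ∃ y ∈ A k, F^[τ k] y = x) (l : List κ) (x : X) :
    ∃ y ∈ wordSet F A τ l, F^[wordTime τ l] y = x := by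
  induction l with
  | nil => exact ⟨x, mem_univ _, rfl⟩
  | cons k l ih =>
    obtain ⟨z, hz, rfl⟩ := ih
    obtain ⟨y, hy, rfl⟩ := hA k z
    exact ⟨y, ⟨hy, hz⟩, by rw [wordTime_cons, add_comm, Function.iterate_add_apply]⟩

theorem le_birkhoffSum_of_mem_wordSet {ψ : X → ℝ} {C : ℝ}
    (hA : ∀ k, ∀ x ∈ A k, -C ≤ birkhoffSum F ψ (τ k) x) (l : List κ) {x : X}
    (hx : x ∈ wordSet F A τ l) : -(C * l.length) ≤ birkhoffSum F ψ (wordTime τ l) x := by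
  induction l generalizing x with
  | nil => simp [wordTime]
  | cons k l ih =>
    rw [wordTime_cons, birkhoffSum_add]
    have h1 := hA k x hx.1
    have h2 := ih hx.2
    push_cast [List.length_cons]
    linarith

theorem wordTime_le {M : ℕ} (hτ : ∀ k, τ k ≤ M) (l : List κ) : wordTime τ l ≤ l.length * M := by
  induction l with
  | nil => simp [wordTime]
  | cons k l ih =>
    rw [wordTime_cons, List.length_cons, add_mul, one_mul]
    have := hτ k
    omega

theorem length_le_wordTime (hτ : ∀ k, 1 ≤ τ k) (l : List κ) : l.length ≤ wordTime τ l := by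
  induction l with
  | nil => simp
  | cons k l ih =>
    rw [wordTime_cons, List.length_cons]
    have := hτ k
    omega

end ReturnWords

theorem exists_mul_lt_two_pow (M : ℕ) : ∃ q, 1 ≤ q ∧ q * M + 1 < 2 ^ q := by
  refine ⟨2 * (2 * M + 1), by omega, ?_⟩
  have h : 2 * M + 1 + 1 ≤ 2 ^ (2 * M + 1) := Nat.lt_two_pow_self
  rw [pow_mul', sq]
  have := Nat.mul_le_mul h h
  nlinarith

/-- Sufficiently many full branches, with possibly different return times, force the pressure above
`m`. -/
theorem lt_pressure_of_returns {a b : ℝ} {f : ℝ → ℝ} (hmaps : MapsTo f (Icc a b) (Icc a b))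
    (hab : a ≤ b) {L : NNReal} (hL : LipschitzWith L (hmaps.restrict f _ _))
    {φ : ℝ → ℝ} (hφ : Continuous fun x : Icc a b => φ x) {m C : ℝ} {K : ℕ}
    (hK : 2 * Real.exp C ≤ K) {A : Fin K → Set (Icc a b)} (hAc : ∀ k, IsClosed (A k))
    (hAd : Pairwise fun k l => Disjoint (A k) (A l)) {τ : Fin K → ℕ} (hτ : ∀ k, 1 ≤ τ k)
    (hA : ∀ k x, ∃ y ∈ A k, (hmaps.restrict f _ _)^[τ k] y = x)
    (hC : ∀ k, ∀ x ∈ A k, -C ≤ birkhoffSum (hmaps.restrict f _ _) (fun x => φ x - m) (τ k) x) :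
    m < pressure f (Icc a b) φ := by
  classical
  set F := hmaps.restrict f _ _ with hF
  set M := Finset.univ.sup τ with hM
  have hτM : ∀ k, τ k ≤ M := fun k => Finset.le_sup (Finset.mem_univ k)
  obtain ⟨q, hq1, hq⟩ := exists_mul_lt_two_pow M
  set B : ℝ := (K : ℝ) ^ q / (q * M + 1) with hB
  obtain ⟨T, -, hT⟩ := Finset.exists_le_card_fiber_of_nsmul_le_card_of_maps_to
    (s := (Finset.univ : Finset (List.Vector (Fin K) q))) (t := Finset.range (q * M + 1))
    (f := fun v => wordTime τ v.toList) (b := B)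
    (fun v _ => by
      have := wordTime_le hτM v.toList
      rw [v.toList_length] at this
      rw [Finset.mem_range]
      omega) ⟨0, by simp⟩
    (by
      rw [Finset.card_range, Finset.card_univ, card_vector, Fintype.card_fin, nsmul_eq_mul, hB]
      push_cast
      rw [mul_div_cancel₀]
      positivity)
  rw [← Fintype.card_subtype] at hT
  have hBexp : Real.exp (C * q) < B := by
    rw [hB, lt_div_iff₀ (by positivity), mul_comm C, Real.exp_nat_mul]
    calc Real.exp C ^ q * (q * M + 1) < Real.exp C ^ q * 2 ^ q := by
          gcongr
          exact_mod_cast hq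
      _ = (2 * Real.exp C) ^ q := by rw [mul_pow, mul_comm]
      _ ≤ K ^ q := by gcongr
  set W := {v : List.Vector (Fin K) q // wordTime τ v.toList = T} with hW
  have hcard : Real.exp (C * q) < Fintype.card W := hBexp.trans_le (by
    convert hT using 2)
  have hWpos : 0 < Fintype.card W := by
    have := (Real.exp_pos (C * q)).trans hcard
    exact_mod_cast this
  have hWne : Nonempty W := Fintype.card_pos_iff.1 hWpos
  have hlog : C * q < Real.log (Fintype.card W) := by
    rwa [Real.lt_log_iff_exp_lt (by exact_mod_cast hWpos)]
  have hTpos : 1 ≤ T := by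
    obtain ⟨v, hv⟩ := hWne
    rw [← hv]
    have := length_le_wordTime hτ v.toList
    rw [v.toList_length] at this
    omega
  obtain ⟨t, rfl⟩ : ∃ t, T = t + 1 := ⟨T - 1, by omega⟩
  have hmain := le_pressure_of_horseshoe hmaps hab hL hφ (κ := W)
    (J := fun v => wordSet F A τ v.1.toList) (fun v => isClosed_wordSet hL.continuous hAc _)
    (fun v w hvw => disjoint_wordSet hAd (by simp) (fun h => hvw (Subtype.ext
      (List.Vector.toList_injective h)))) t
    (fun v x => by
      have := exists_mem_wordSet hA v.1.toList x
      rwa [v.2] at this)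
    (c := (t + 1) * m - C * q) (fun v x hx => by
      have h1 := le_birkhoffSum_of_mem_wordSet hC _ hx
      rw [v.2, v.1.toList_length] at h1
      have h2 : birkhoffSum F (fun x => φ x - m) (t + 1) x =
          birkhoffSum F (fun x => φ x) (t + 1) x - (t + 1) * m := by
        simp [birkhoffSum, Finset.sum_sub_distrib]
      rw [h2] at h1
      linarith)
  refine lt_of_lt_of_le ?_ hmain
  rw [lt_div_iff₀ (by positivity)]
  linarith

section LocalHolder

/-- `g` is Hölder continuous on a relative neighbourhood of `x` in `s`. -/
def HolderNear (g : ℝ → ℝ) (s : Set ℝ) (x : ℝ) : Prop :=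
  ∃ C β : ℝ, 0 ≤ C ∧ 0 < β ∧ β ≤ 1 ∧ ∃ t ∈ nhdsWithin x s,
    ∀ y ∈ t, ∀ z ∈ t, |g y - g z| ≤ C * |y - z| ^ β

theorem LipschitzOnWith.holderNear {g : ℝ → ℝ} {s t : Set ℝ} {x : ℝ} {K : NNReal}
    (h : LipschitzOnWith K g t) (ht : t ∈ nhdsWithin x s) : HolderNear g s x :=
  ⟨K, 1, K.2, one_pos, le_rfl, t, ht, fun y hy z hz => by
    have := h.dist_le_mul y hy z hz
    rwa [Real.dist_eq, Real.dist_eq, ← Real.rpow_one |y - z|] at this⟩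

theorem ContDiff.holderNear {g : ℝ → ℝ} (hg : ContDiff ℝ 1 g) (s : Set ℝ) (x : ℝ) :
    HolderNear g s x := by
  obtain ⟨K, t, ht, h⟩ := hg.contDiffAt (x := x) |>.exists_lipschitzOnWith
  exact h.holderNear (mem_nhdsWithin_of_mem_nhds ht)

theorem HolderNear.of_univ {g : ℝ → ℝ} {x : ℝ} (hg : HolderNear g univ x) (s : Set ℝ) :
    HolderNear g s x := by
  obtain ⟨C, β, hC, hβ, hβ1, t, ht, H⟩ := hg
  rw [nhdsWithin_univ] at ht
  exact ⟨C, β, hC, hβ, hβ1, t, mem_nhdsWithin_of_mem_nhds ht, H⟩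

theorem HolderNear.congr {g h : ℝ → ℝ} {s : Set ℝ} {x : ℝ} (hg : HolderNear g s x)
    (hgh : ∀ᶠ y in nhdsWithin x s, g y = h y) : HolderNear h s x := by
  obtain ⟨C, β, hC, hβ, hβ1, t, ht, H⟩ := hg
  refine ⟨C, β, hC, hβ, hβ1, t ∩ {y | g y = h y}, inter_mem ht hgh, fun y hy z hz => ?_⟩
  have h1 : g y = h y := hy.2
  have h2 : g z = h z := hz.2
  rw [← h1, ← h2]
  exact H y hy.1 z hz.1

/-- Bounded Hölder form: the Hölder estimate can be taken on a neighbourhood of diameter at most one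
with any smaller exponent. -/
theorem HolderNear.exists_bound {g : ℝ → ℝ} {s : Set ℝ} {x : ℝ} (hx : x ∈ s)
    (hg : HolderNear g s x) :
    ∃ C M β : ℝ, 0 ≤ C ∧ 0 ≤ M ∧ 0 < β ∧ β ≤ 1 ∧ ∃ t ∈ nhdsWithin x s, (∀ y ∈ t, |g y| ≤ M) ∧
      (∀ y ∈ t, ∀ z ∈ t, |y - z| ≤ 1) ∧
      ∀ γ, 0 < γ → γ ≤ β → ∀ y ∈ t, ∀ z ∈ t, |g y - g z| ≤ C * |y - z| ^ γ := by
  obtain ⟨C, β, hC, hβ, hβ1, t, ht, H⟩ := hg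
  have hball : Metric.ball x (1 / 2) ∈ nhdsWithin x s :=
    mem_nhdsWithin_of_mem_nhds (Metric.ball_mem_nhds x (by norm_num))
  have hd : ∀ y ∈ t ∩ Metric.ball x (1 / 2), ∀ z ∈ t ∩ Metric.ball x (1 / 2), |y - z| ≤ 1 := by
    intro y hy z hz
    have h1 := hy.2
    have h2 := hz.2
    rw [Metric.mem_ball, Real.dist_eq, abs_lt] at h1 h2
    rw [abs_le]
    constructor <;> linarith
  have hH : ∀ γ, 0 < γ → γ ≤ β → ∀ y ∈ t ∩ Metric.ball x (1 / 2),
      ∀ z ∈ t ∩ Metric.ball x (1 / 2), |g y - g z| ≤ C * |y - z| ^ γ := by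
    intro γ hγ hγβ y hy z hz
    refine (H y hy.1 z hz.1).trans ?_
    exact mul_le_mul_of_nonneg_left (Real.rpow_le_rpow_of_exponent_ge_of_imp (abs_nonneg _)
      (hd y hy z hz) hγβ (fun _ h => absurd h hβ.ne')) hC
  have hxt : x ∈ t := mem_of_mem_nhdsWithin hx ht
  refine ⟨C, |g x| + C, β, hC, by positivity, hβ, hβ1, t ∩ Metric.ball x (1 / 2),
    inter_mem ht hball, fun y hy => ?_, hd, hH⟩
  have h1 := H y hy.1 x hxt
  have h2 : |y - x| ^ β ≤ 1 :=
    Real.rpow_le_one (abs_nonneg _) (hd y hy x ⟨hxt, Metric.mem_ball_self (by norm_num)⟩) hβ.le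
  have h3 : C * |y - x| ^ β ≤ C := mul_le_of_le_one_right hC h2
  have h4 : |g y| ≤ |g x| + |g y - g x| := by
    have := abs_add_le (g x) (g y - g x)
    rwa [add_sub_cancel] at this
  linarith

theorem HolderNear.mul {g h : ℝ → ℝ} {s : Set ℝ} {x : ℝ} (hx : x ∈ s) (hg : HolderNear g s x)
    (hh : HolderNear h s x) : HolderNear (fun y => g y * h y) s x := by
  obtain ⟨C, M, β, hC, hM, hβ, hβ1, t, ht, hb, -, H⟩ := hg.exists_bound hx
  obtain ⟨C', M', β', hC', hM', hβ', hβ1', t', ht', hb', -, H'⟩ := hh.exists_bound hx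
  refine ⟨M * C' + C * M', min β β', by positivity, lt_min hβ hβ', (min_le_left _ _).trans hβ1,
    t ∩ t', inter_mem ht ht', fun y hy z hz => ?_⟩
  have h1 := H _ (lt_min hβ hβ') (min_le_left _ _) y hy.1 z hz.1
  have h2 := H' _ (lt_min hβ hβ') (min_le_right _ _) y hy.2 z hz.2
  have e : g y * h y - g z * h z = g y * (h y - h z) + (g y - g z) * h z := by ring
  rw [e]
  refine (abs_add_le _ _).trans ?_
  rw [abs_mul, abs_mul, add_mul]
  have h3 := mul_le_mul (hb y hy.1) h2 (abs_nonneg _) hM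
  have h4 := mul_le_mul h1 (hb' z hz.2) (abs_nonneg _) (by positivity)
  nlinarith

theorem HolderNear.tendsto {g : ℝ → ℝ} {s : Set ℝ} {x : ℝ} (hx : x ∈ s)
    (hg : HolderNear g s x) : Tendsto g (nhdsWithin x s) (nhds (g x)) := by
  obtain ⟨C, β, hC, hβ, hβ1, t, ht, H⟩ := hg
  have hxt : x ∈ t := mem_of_mem_nhdsWithin hx ht
  rw [tendsto_iff_dist_tendsto_zero]
  have h0 : Tendsto (fun y => C * |y - x| ^ β) (nhdsWithin x s) (nhds 0) := by
    have : ContinuousAt (fun y => C * |y - x| ^ β) x := by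
      apply ContinuousAt.mul continuousAt_const
      exact ContinuousAt.rpow_const (by fun_prop) (Or.inr hβ.le)
    have h1 := this.tendsto
    simp only [sub_self, abs_zero, Real.zero_rpow hβ.ne', mul_zero] at h1
    exact h1.mono_left nhdsWithin_le_nhds
  refine squeeze_zero' (Eventually.of_forall fun _ => dist_nonneg) ?_ h0
  filter_upwards [ht] with y hy
  rw [Real.dist_eq]
  exact H y hy x hxt

theorem HolderNear.comp {G g : ℝ → ℝ} {s : Set ℝ} {x : ℝ} (hx : x ∈ s)
    (hG : HolderNear G univ (g x)) (hg : HolderNear g s x) :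
    HolderNear (fun y => G (g y)) s x := by
  have hlim := hg.tendsto hx
  obtain ⟨C, β, hC, hβ, hβ1, t, ht, H⟩ := hg
  obtain ⟨C', β', hC', hβ', hβ1', t', ht', H'⟩ := hG
  rw [nhdsWithin_univ] at ht'
  refine ⟨C' * C ^ β', β * β', by positivity, by positivity, by nlinarith, t ∩ g ⁻¹' t',
    inter_mem ht (hlim ht'), fun y hy z hz => ?_⟩
  refine (H' _ hy.2 _ hz.2).trans ?_
  rw [mul_assoc]
  gcongr
  rw [Real.rpow_mul (abs_nonneg _), ← Real.mul_rpow hC (by positivity)]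
  exact Real.rpow_le_rpow (abs_nonneg _) (H y hy.1 z hz.1) hβ'.le

theorem holderNear_abs (s : Set ℝ) (x : ℝ) : HolderNear (fun y => |y|) s x :=
  ⟨1, 1, zero_le_one, one_pos, le_rfl, univ, univ_mem, fun y _ z _ => by
    simpa using abs_abs_sub_abs_le y z⟩

theorem abs_rpow_sub_rpow_le {u v p : ℝ} (hu : 0 ≤ u) (hv : 0 ≤ v) (hp : 0 < p) (hp1 : p ≤ 1) :
    |u ^ p - v ^ p| ≤ |u - v| ^ p := by
  wlog h : v ≤ u generalizing u v
  · rw [abs_sub_comm, abs_sub_comm u]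
    exact this hv hu (le_of_not_ge h)
  rw [abs_of_nonneg (sub_nonneg.2 (Real.rpow_le_rpow hv h hp.le)), abs_of_nonneg (sub_nonneg.2 h)]
  have := Real.rpow_add_le_add_rpow hv (sub_nonneg.2 h) hp.le hp1
  rw [add_sub_cancel] at this
  linarith

theorem holderNear_abs_rpow {p : ℝ} (hp : 0 < p) (s : Set ℝ) (x : ℝ) :
    HolderNear (fun y => |y| ^ p) s x := by
  rcases le_total p 1 with h | h
  · refine ⟨1, p, zero_le_one, hp, h, univ, univ_mem, fun y _ z _ => ?_⟩
    rw [one_mul]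
    refine (abs_rpow_sub_rpow_le (abs_nonneg y) (abs_nonneg z) hp h).trans ?_
    exact Real.rpow_le_rpow (abs_nonneg _) (abs_abs_sub_abs_le y z) hp.le
  · have h1 : ContDiff ℝ 1 fun y : ℝ => y ^ p := by
      exact_mod_cast Real.contDiff_rpow_const_of_le (n := 1) (by exact_mod_cast h)
    have := (h1.holderNear univ |x|).comp (g := fun y => |y|) (mem_univ x) (holderNear_abs _ _)
    exact this.of_univ s

theorem IsC3Diffeo.contDiff_deriv {g : ℝ → ℝ} (hg : IsC3Diffeo g) : ContDiff ℝ 1 (deriv g) :=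
  ContDiff.deriv' (hg.1.of_le (by norm_num))

variable {a b : ℝ} {f : ℝ → ℝ}

/-- Modulus of the derivative of a map satisfying a power relation at a critical point. -/
theorem abs_deriv_of_power_relation (hab : a < b) {x ℓ : ℝ} (hx : x ∈ Icc a b) (hℓ : 1 < ℓ)
    {φ ψ : ℝ → ℝ} (hf : DifferentiableAt ℝ f x) (hφ : IsC3Diffeo φ) (hψ : IsC3Diffeo ψ) (h0 : φ x ≠ 0)
    (h : ∀ᶠ y in nhdsWithin x (Icc a b), |ψ (f y)| = |φ y| ^ ℓ) :
    |deriv f x| = ℓ * |φ x| ^ (ℓ - 1) * |deriv φ x| * |deriv ψ (f x)|⁻¹ := by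
  have hx' := h.self_of_nhdsWithin hx
  have hφpos : 0 < |φ x| := abs_pos.2 h0
  have h1 : ψ (f x) ≠ 0 := by
    rw [← abs_pos, hx']
    positivity
  have hφd : HasDerivAt φ (deriv φ x) x :=
    (hφ.1.differentiable (by norm_num)).differentiableAt.hasDerivAt
  have hψd : HasDerivAt ψ (deriv ψ (f x)) (f x) :=
    (hψ.1.differentiable (by norm_num)).differentiableAt.hasDerivAt
  have hl := ((hasDerivAt_abs h1).comp x (hψd.comp x hf.hasDerivAt)).hasDerivWithinAt
    (s := Icc a b)
  have hr := (((hasDerivAt_abs h0).comp x hφd).rpow_const (p := ℓ)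
    (Or.inl (by simpa using h0))).hasDerivWithinAt (s := Icc a b)
  have hl' := hl.congr_of_eventuallyEq (f₁ := fun y => |φ y| ^ ℓ)
    (h.mono fun y hy => hy.symm) hx'.symm
  have heq := (uniqueDiffOn_Icc hab x hx).eq_deriv _ hl' hr
  have hs : ∀ y : ℝ, y ≠ 0 → |((SignType.sign y : SignType) : ℝ)| = 1 := fun y hy => by
    rcases lt_or_gt_of_ne hy with h | h
    · simp [sign_neg h]
    · simp [sign_pos h]
  have habs := congrArg abs heq
  simp only [abs_mul, hs _ h1, hs _ h0, Function.comp, one_mul] at habs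
  have hψ0 : |deriv ψ (f x)| ≠ 0 := abs_ne_zero.2 (hψ.2.2 _)
  rw [abs_of_nonneg (Real.rpow_nonneg (abs_nonneg (φ x)) _)] at habs
  rw [abs_of_pos (zero_lt_one.trans hℓ)] at habs
  field_simp
  linarith

theorem holderNear_abs_deriv_of_deriv_eq_zero (hf : IsC3NonflatIntervalMap f a b) {c : ℝ}
    (hc : c ∈ Icc a b) (h0 : deriv f c = 0) : HolderNear (fun x => |deriv f x|) (Icc a b) c := by
  obtain ⟨ℓ, hℓ, φ, ψ, hφ, hψ, hφc, hψc, hrel⟩ := hf.nonflat c hc h0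
  have hfc : Tendsto f (nhdsWithin c (Icc a b)) (nhds (f c)) :=
    (hf.diff c hc).continuousAt.continuousWithinAt
  have hφc1 : ContDiff ℝ 1 φ := hφ.1.of_le (by norm_num)
  have hform : ∀ᶠ x in nhdsWithin c (Icc a b),
      ℓ * |φ x| ^ (ℓ - 1) * |deriv φ x| * |deriv ψ (f x)|⁻¹ = |deriv f x| := by
    filter_upwards [eventually_eventually_nhdsWithin.2 hrel, self_mem_nhdsWithin] with x hx hxI
    by_cases hφx : φ x = 0
    · have : x = c := hφ.2.1.injective (hφx.trans hφc.symm)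
      subst this
      simp [h0, hφc, Real.zero_rpow (sub_pos.2 hℓ).ne']
    · exact (abs_deriv_of_power_relation hf.lt hxI hℓ (hf.diff x hxI) hφ hψ hφx hx).symm
  have hA : HolderNear (fun x => |φ x| ^ (ℓ - 1)) (Icc a b) c :=
    HolderNear.comp (G := fun y => |y| ^ (ℓ - 1)) (g := φ) hc
      (holderNear_abs_rpow (sub_pos.2 hℓ) _ _) (hφc1.holderNear _ _)
  have hB : HolderNear (fun x => |deriv φ x|) (Icc a b) c :=
    HolderNear.comp (G := fun y => |y|) (g := deriv φ) hc (holderNear_abs _ _)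
      (hφ.contDiff_deriv.holderNear _ _)
  have hψinv : ContinuousAt (fun y => |deriv ψ y|⁻¹) (f c) :=
    (hψ.contDiff_deriv.continuous.continuousAt.abs).inv₀ (abs_ne_zero.2 (hψ.2.2 _))
  have hlim : Tendsto (fun x => ℓ * |φ x| ^ (ℓ - 1) * |deriv φ x| * |deriv ψ (f x)|⁻¹)
      (nhdsWithin c (Icc a b)) (nhds 0) := by
    have := ((hA.tendsto hc).const_mul ℓ).mul (hB.tendsto hc) |>.mul (hψinv.tendsto.comp hfc)
    simpa [hφc, Real.zero_rpow (sub_pos.2 hℓ).ne'] using this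
  have hsmall : ∀ᶠ x in nhdsWithin c (Icc a b), |deriv f x| < 1 := by
    filter_upwards [hform, hlim.eventually (gt_mem_nhds one_pos)] with x h1 h2
    rwa [← h1]
  obtain ⟨ε, hε, hball⟩ := Metric.mem_nhdsWithin_iff.1 hsmall
  have hfl : HolderNear f (Icc a b) c := by
    refine LipschitzOnWith.holderNear (K := 1) (t := Metric.ball c ε ∩ Icc a b)
      (Convex.lipschitzOnWith_of_nnnorm_deriv_le (fun x hx => hf.diff x hx.2) (fun x hx => ?_)
        ((convex_ball c ε).inter (convex_Icc a b)))
      (inter_mem (mem_nhdsWithin_of_mem_nhds (Metric.ball_mem_nhds c hε)) self_mem_nhdsWithin)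
    have h1 : |deriv f x| < 1 := hball hx
    rw [← NNReal.coe_le_coe, coe_nnnorm, Real.norm_eq_abs]
    exact h1.le
  have hD : HolderNear (fun x => deriv ψ (f x)) (Icc a b) c :=
    HolderNear.comp (G := deriv ψ) (g := f) hc (hψ.contDiff_deriv.holderNear _ _) hfl
  have hD' : HolderNear (fun x => |deriv ψ (f x)|) (Icc a b) c :=
    HolderNear.comp (G := fun y => |y|) (g := fun x => deriv ψ (f x)) hc (holderNear_abs _ _) hD
  have hinv : HolderNear (fun y : ℝ => y⁻¹) univ |deriv ψ (f c)| := by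
    have h1 : ContDiffAt ℝ 1 (fun y : ℝ => y⁻¹) |deriv ψ (f c)| :=
      contDiffAt_inv ℝ (abs_ne_zero.2 (hψ.2.2 _))
    obtain ⟨K, t, ht, h⟩ := h1.exists_lipschitzOnWith
    exact h.holderNear (mem_nhdsWithin_of_mem_nhds ht)
  have hE : HolderNear (fun x => |deriv ψ (f x)|⁻¹) (Icc a b) c :=
    HolderNear.comp (G := fun y => y⁻¹) (g := fun x => |deriv ψ (f x)|) hc hinv hD'
  have hconst : HolderNear (fun _ => ℓ) (Icc a b) c :=
    (contDiff_const (𝕜 := ℝ) (n := 1) (c := ℓ)).holderNear _ _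
  exact (((hconst.mul hc hA).mul hc hB).mul hc hE).congr hform

theorem holderNear_abs_deriv_of_deriv_ne_zero (hf : IsC3NonflatIntervalMap f a b) {x : ℝ}
    (hx : x ∈ Icc a b) (h0 : deriv f x ≠ 0) : HolderNear (fun x => |deriv f x|) (Icc a b) x := by
  have hnear : ({y | y ∈ Icc a b ∧ deriv f y = 0})ᶜ ∈ nhds x :=
    hf.critFinite.isClosed.isOpen_compl.mem_nhds fun h => h0 h.2
  obtain ⟨ε, hε, hball⟩ := Metric.nhds_basis_closedBall.mem_iff.1 hnear
  set t := Icc (max a (x - ε)) (min b (x + ε)) with ht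
  have htlt : max a (x - ε) < min b (x + ε) := by
    rw [max_lt_iff, lt_min_iff, lt_min_iff]
    have := hf.lt
    have h1 := hx.1
    have h2 := hx.2
    exact ⟨⟨this, by linarith⟩, by linarith, by linarith⟩
  have htsub : t ⊆ Icc a b := Icc_subset_Icc (le_max_left _ _) (min_le_left _ _)
  have htball : t ⊆ Metric.closedBall x ε := fun y hy => by
    rw [Real.closedBall_eq_Icc]
    exact ⟨(le_max_right _ _).trans hy.1, hy.2.trans (min_le_right _ _)⟩
  have hts : t ⊆ Icc a b \ {y | deriv f y = 0} := fun y hy =>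
    ⟨htsub hy, fun h => hball (htball hy) ⟨htsub hy, h⟩⟩
  have hud : UniqueDiffOn ℝ t := uniqueDiffOn_Icc htlt
  have hcd : ContDiffOn ℝ (2 + 1) f t := by
    have := hf.smooth.mono hts
    norm_num
    exact this
  have hder := ((contDiffOn_succ_iff_derivWithin hud).1 hcd).2.2
  have hxt : x ∈ t := ⟨max_le hx.1 (by linarith), le_min hx.2 (by linarith)⟩
  have hder' : ContDiffOn ℝ 1 (deriv f) t :=
    (hder.of_le (by norm_num)).congr fun y hy =>
      ((hf.diff y (htsub hy)).derivWithin (hud y hy)).symm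
  obtain ⟨K, u, hu, hK⟩ := (hder' x hxt).exists_lipschitzOnWith (convex_Icc _ _)
  have htn : t ∈ nhdsWithin x (Icc a b) := by
    have : t = Icc a b ∩ Icc (x - ε) (x + ε) := Icc_inter_Icc.symm
    rw [this]
    exact inter_mem self_mem_nhdsWithin
      (mem_nhdsWithin_of_mem_nhds (Icc_mem_nhds (by linarith) (by linarith)))
  have hu' : u ∈ nhdsWithin x (Icc a b) := by
    have h1 := nhdsWithin_le_of_mem htn
    exact h1 hu
  exact HolderNear.comp (G := fun y => |y|) hx (holderNear_abs _ _) (hK.holderNear hu')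

/-- The modulus of the derivative of an interval map with non-flat critical points is Hölder
continuous. -/
theorem exists_holder_abs_deriv (hf : IsC3NonflatIntervalMap f a b) :
    ∃ C β δ : ℝ, 0 ≤ C ∧ 0 < β ∧ β ≤ 1 ∧ 0 < δ ∧ δ ≤ 1 ∧ ∀ x ∈ Icc a b, ∀ y ∈ Icc a b,
      |x - y| < δ → |(|deriv f x| - |deriv f y|)| ≤ C * |x - y| ^ β := by
  have hloc : ∀ x ∈ Icc a b, HolderNear (fun x => |deriv f x|) (Icc a b) x := fun x hx => by
    by_cases h : deriv f x = 0
    · exact holderNear_abs_deriv_of_deriv_eq_zero hf hx h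
    · exact holderNear_abs_deriv_of_deriv_ne_zero hf hx h
  choose! C β hC hβ hβ1 t ht H using hloc
  have hmem : ∀ x ∈ Icc a b, ∃ ε > 0, Metric.ball x ε ∩ Icc a b ⊆ t x := fun x hx =>
    Metric.mem_nhdsWithin_iff.1 (ht x hx)
  choose! ε hε hball using hmem
  obtain ⟨s, hsI, hs⟩ := isCompact_Icc.elim_nhds_subcover (fun x => Metric.ball x (ε x / 2))
    fun x hx => Metric.ball_mem_nhds x (half_pos (hε x hx))
  have hsne : s.Nonempty := by
    by_contra h
    rw [Finset.not_nonempty_iff_eq_empty] at h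
    have := hs (left_mem_Icc.2 hf.lt.le)
    simp [h] at this
  have hC0 : ∀ x ∈ s, 0 ≤ C x := fun x hx => hC x (hsI x hx)
  refine ⟨∑ x ∈ s, C x, s.inf' hsne β, min 1 (s.inf' hsne fun x => ε x / 2), Finset.sum_nonneg hC0,
    (Finset.lt_inf'_iff hsne).2 fun x hx => hβ x (hsI x hx), ?_,
    lt_min one_pos ((Finset.lt_inf'_iff hsne).2 fun x hx => half_pos (hε x (hsI x hx))),
    min_le_left _ _, fun x hx y hy hxy => ?_⟩
  · obtain ⟨x, hx⟩ := hsne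
    exact (Finset.inf'_le _ hx).trans (hβ1 x (hsI x hx))
  · obtain ⟨z, hz, hxz⟩ := mem_iUnion₂.1 (hs hx)
    have h1 : |x - y| < 1 := hxy.trans_le (min_le_left _ _)
    have h2 : |x - y| < ε z / 2 := hxy.trans_le ((min_le_right _ _).trans (Finset.inf'_le _ hz))
    rw [Metric.mem_ball, Real.dist_eq] at hxz
    have hε' := hε z (hsI z hz)
    have hxt : x ∈ t z := hball z (hsI z hz) ⟨by rw [Metric.mem_ball, Real.dist_eq]; linarith, hx⟩
    have hyt : y ∈ t z := hball z (hsI z hz) ⟨by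
      rw [Metric.mem_ball, Real.dist_eq]
      have := abs_sub_le y x z
      rw [abs_sub_comm y x] at this
      linarith, hy⟩
    refine (H z (hsI z hz) x hxt y hyt).trans ?_
    refine mul_le_mul (Finset.single_le_sum hC0 hz) ?_ (by positivity) (Finset.sum_nonneg hC0)
    exact Real.rpow_le_rpow_of_exponent_ge_of_imp (abs_nonneg _) h1.le (Finset.inf'_le _ hz)
      (fun _ h => absurd h (hβ z (hsI z hz)).ne')

theorem continuousOn_abs_deriv (hf : IsC3NonflatIntervalMap f a b) :
    ContinuousOn (fun x => |deriv f x|) (Icc a b) := fun x hx => by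
  by_cases h : deriv f x = 0
  · exact (holderNear_abs_deriv_of_deriv_eq_zero hf hx h).tendsto hx
  · exact (holderNear_abs_deriv_of_deriv_ne_zero hf hx h).tendsto hx

theorem exists_abs_deriv_le (hf : IsC3NonflatIntervalMap f a b) :
    ∃ M : ℝ, 1 ≤ M ∧ ∀ x ∈ Icc a b, |deriv f x| ≤ M := by
  obtain ⟨M, hM⟩ := isCompact_Icc.exists_bound_of_continuousOn (continuousOn_abs_deriv hf)
  refine ⟨max 1 M, le_max_left _ _, fun x hx => ?_⟩
  have := hM x hx
  rw [Real.norm_eq_abs, abs_abs] at this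
  exact this.trans (le_max_right _ _)

theorem exists_lipschitzWith_restrict (hf : IsC3NonflatIntervalMap f a b) :
    ∃ L : NNReal, LipschitzWith L (hf.mapsTo.restrict f _ _) := by
  obtain ⟨M, hM1, hM⟩ := exists_abs_deriv_le hf
  refine ⟨M.toNNReal, LipschitzWith.of_dist_le_mul fun x y => ?_⟩
  have := Convex.norm_image_sub_le_of_norm_deriv_le hf.diff hM (convex_Icc a b) y.2 x.2
  rw [Real.coe_toNNReal M (by linarith)]
  exact this

end LocalHolder

section Exactness

variable {a b : ℝ} {f : ℝ → ℝ}

theorem TopExact.image_iterate (hab : a < b) (hmaps : MapsTo f (Icc a b) (Icc a b))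
    (hex : TopExact f (Icc a b)) (n : ℕ) : f^[n] '' Icc a b = Icc a b := by
  have h1 : f '' Icc a b = Icc a b := by
    refine Subset.antisymm hmaps.image_subset ?_
    obtain ⟨n, hn, h⟩ := hex univ isOpen_univ ⟨a, mem_univ _, left_mem_Icc.2 hab.le⟩
    rw [univ_inter] at h
    obtain ⟨m, rfl⟩ : ∃ m, n = m + 1 := ⟨n - 1, by omega⟩
    intro x hx
    rw [← h] at hx
    obtain ⟨y, hy, rfl⟩ := hx
    exact ⟨f^[m] y, hmaps.iterate m hy, (Function.iterate_succ_apply' f m y).symm⟩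
  induction n with
  | zero => simp
  | succ k ih => rw [Function.iterate_succ, image_comp, h1, ih]

theorem TopExact.image_iterate_of_le (hab : a < b) (hmaps : MapsTo f (Icc a b) (Icc a b))
    (hex : TopExact f (Icc a b)) {s t : Set ℝ} (hst : s ⊆ t) (ht : t ⊆ Icc a b) {m n : ℕ}
    (hmn : m ≤ n) (h : f^[m] '' s = Icc a b) : f^[n] '' t = Icc a b := by
  refine Subset.antisymm ((hmaps.iterate n).mono_left ht).image_subset ?_
  obtain ⟨k, rfl⟩ := Nat.exists_eq_add_of_le' hmn
  calc Icc a b = f^[k] '' (f^[m] '' s) := by rw [h, hex.image_iterate hab hmaps]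
    _ = f^[k + m] '' s := by rw [Function.iterate_add, image_comp]
    _ ⊆ f^[k + m] '' t := image_mono hst

theorem TopExact.exists_image_Icc (hab : a < b) (hmaps : MapsTo f (Icc a b) (Icc a b))
    (hex : TopExact f (Icc a b)) {r : ℝ} (hr : 0 < r) :
    ∃ N : ℕ, ∀ u v, a ≤ u → v ≤ b → r ≤ v - u → f^[N] '' Icc u v = Icc a b := by
  obtain ⟨p, hp⟩ := exists_nat_gt (2 * (b - a) / r)
  have hp0 : (0 : ℝ) < p := lt_trans (by have := sub_pos.2 hab; positivity) hp
  set h := (b - a) / p with hh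
  have hpos : 0 < h := div_pos (sub_pos.2 hab) hp0
  have hhr : 2 * h < r := by
    rw [div_lt_iff₀ hr] at hp
    rw [hh, ← mul_div_assoc, div_lt_iff₀ hp0]
    linarith
  have hph : p * h = b - a := by rw [hh]; field_simp
  have key : ∀ i : ℕ, ∃ n, i < p → f^[n] '' (Ioo (a + i * h) (a + (i + 1) * h) ∩ Icc a b) = Icc a b := by
    intro i
    by_cases hi : i < p
    · obtain ⟨n, -, hn⟩ := hex (Ioo (a + i * h) (a + (i + 1) * h)) isOpen_Ioo (by
        refine ⟨a + i * h + h / 2, ⟨by linarith, by linarith⟩, ?_, ?_⟩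
        · have : 0 ≤ i * h := by positivity
          linarith
        · have : ((i : ℝ) + 1) ≤ p := by exact_mod_cast hi
          nlinarith)
      exact ⟨n, fun _ => hn⟩
    · exact ⟨0, fun h => absurd h hi⟩
  choose n hn using key
  refine ⟨∑ i ∈ Finset.range p, n i, fun u v hu hv huv => ?_⟩
  set i := ⌈(u - a) / h⌉₊ with hi
  have h1 : (u - a) / h ≤ i := Nat.le_ceil _
  have h2 : (i : ℝ) < (u - a) / h + 1 := Nat.ceil_lt_add_one (div_nonneg (by linarith) hpos.le)
  rw [div_le_iff₀ hpos] at h1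
  rw [← sub_lt_iff_lt_add, lt_div_iff₀ hpos] at h2
  have h3 : a + (i + 1) * h ≤ v := by nlinarith
  have hip : i < p := by
    have : (i : ℝ) < p := by
      by_contra hcon
      push Not at hcon
      nlinarith
    exact_mod_cast this
  refine hex.image_iterate_of_le hab hmaps (fun x hx => ?_) (Icc_subset_Icc hu hv)
    (Finset.single_le_sum (f := n) (fun _ _ => Nat.zero_le _) (Finset.mem_range.2 hip)) (hn i hip)
  exact ⟨by linarith [hx.1.1], by linarith [hx.1.2]⟩

theorem IsC3NonflatIntervalMap.hasDerivAt_iterate (hf : IsC3NonflatIntervalMap f a b) {x : ℝ}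
    (hx : x ∈ Icc a b) (n : ℕ) :
    HasDerivAt f^[n] (∏ i ∈ Finset.range n, deriv f (f^[i] x)) x := by
  induction n with
  | zero => simpa using hasDerivAt_id x
  | succ n ih =>
    rw [Finset.prod_range_succ, mul_comm, Function.iterate_succ']
    exact (hf.diff _ (hf.mapsTo.iterate n hx)).hasDerivAt.comp x ih

/-- A topologically exact map has no periodic critical point. -/
theorem TopExact.iterate_ne_of_deriv_eq_zero (hf : IsC3NonflatIntervalMap f a b)
    (hex : TopExact f (Icc a b)) {c : ℝ} (hc : c ∈ Icc a b) (hc0 : deriv f c = 0) {p : ℕ}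
    (hp : 1 ≤ p) : f^[p] c ≠ c := by
  intro hper
  have hd := hf.hasDerivAt_iterate hc p
  rw [Finset.prod_eq_zero (Finset.mem_range.2 hp) (by simpa using hc0)] at hd
  rw [hasDerivAt_iff_isLittleO, Asymptotics.isLittleO_iff] at hd
  obtain ⟨ε, hε, hball⟩ := Metric.eventually_nhds_iff.1 (hd (c := 1) one_pos)
  have hab := sub_pos.2 hf.lt
  set ρ := min ε ((b - a) / 2) with hρ
  have hρ0 : 0 < ρ := lt_min hε (by linarith)
  have hstep : MapsTo f^[p] (ball c ρ ∩ Icc a b) (ball c ρ ∩ Icc a b) := by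
    rintro y ⟨hy, hyI⟩
    refine ⟨?_, hf.mapsTo.iterate p hyI⟩
    have := hball (lt_of_lt_of_le hy (min_le_left _ _))
    rw [hper] at this
    simp only [smul_zero, sub_zero, Real.norm_eq_abs, one_mul] at this
    rw [mem_ball, Real.dist_eq] at hy ⊢
    exact this.trans_lt hy
  obtain ⟨n, hn, him⟩ := hex (ball c ρ) isOpen_ball ⟨c, mem_ball_self hρ0, hc⟩
  have h2 : f^[p * n] '' (ball c ρ ∩ Icc a b) = Icc a b :=
    hex.image_iterate_of_le hf.lt hf.mapsTo Subset.rfl inter_subset_right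
      (Nat.le_mul_of_pos_left n hp) him
  have h3 : Icc a b ⊆ ball c ρ := by
    rw [← h2, Function.iterate_mul]
    exact (hstep.iterate n).image_subset.trans inter_subset_left
  have ha := h3 (left_mem_Icc.2 hf.lt.le)
  have hb := h3 (right_mem_Icc.2 hf.lt.le)
  rw [mem_ball, Real.dist_eq, abs_lt] at ha hb
  have : ρ ≤ (b - a) / 2 := min_le_right _ _
  linarith

theorem TopExact.measure_critical (hf : IsC3NonflatIntervalMap f a b) (hex : TopExact f (Icc a b))
    (μ : Measure (Icc a b)) [IsProbabilityMeasure μ]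
    (hμ : MeasurePreserving (hf.mapsTo.restrict f _ _) μ μ) :
    μ {x | deriv f x = 0} = 0 := by
  have hfin : {x : Icc a b | deriv f x = 0}.Finite := by
    have := hf.critFinite.preimage (f := ((↑) : Icc a b → ℝ)) Subtype.val_injective.injOn
    exact this.subset fun x hx => ⟨x.2, hx⟩
  rw [measure_null_iff_singleton hfin.countable]
  intro c hc
  by_contra hne
  obtain ⟨x, hx, m, hm, hmx⟩ :=
    hμ.exists_mem_iterate_mem (measurableSet_singleton c).nullMeasurableSet hne
  rw [mem_singleton_iff] at hx hmx
  subst hx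
  refine hex.iterate_ne_of_deriv_eq_zero hf x.2 hc (Nat.one_le_iff_ne_zero.2 hm) ?_
  rw [← val_iterate_restrict hf.mapsTo, hmx]

theorem integrable_log_abs_deriv (hf : IsC3NonflatIntervalMap f a b) {χ : ℝ} (hχ : 0 < χ)
    (hTCE : ∀ ν : Measure ℝ, InvariantProb f (Icc a b) ν → χ ≤ ∫ x, Real.log |deriv f x| ∂ν)
    (μ : Measure (Icc a b)) [IsProbabilityMeasure μ]
    (hμ : MeasurePreserving (hf.mapsTo.restrict f _ _) μ μ) :
    Integrable (fun x : Icc a b => Real.log |deriv f x|) μ ∧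
      χ ≤ ∫ x : Icc a b, Real.log |deriv f x| ∂μ := by
  have h := hTCE _ (invariantProb_map_val hf.mapsTo hμ)
  rw [measurableEmbedding_val_Icc.integral_map] at h
  refine ⟨?_, h⟩
  by_contra hcon
  rw [integral_undef hcon] at h
  linarith

end Exactness

section HyperbolicTimes

variable {a b : ℝ} {f : ℝ → ℝ}

theorem exists_distortion (hf : IsC3NonflatIntervalMap f a b) {σ : ℝ} (hσ : 0 < σ) :
    ∃ s κ ρ : ℝ, 0 < s ∧ 0 < κ ∧ 0 < ρ ∧ ∀ x ∈ Icc a b, ∀ y ∈ Icc a b, |y - x| ≤ ρ →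
      |y - x| ≤ κ * |deriv f x| ^ s → Real.exp (-σ) * |deriv f x| ≤ |deriv f y| := by
  obtain ⟨C, β, δ, hC, hβ, -, hδ, -, h⟩ := exists_holder_abs_deriv hf
  have he : 0 < 1 - Real.exp (-σ) := sub_pos.2 (Real.exp_lt_one_iff.2 (by linarith))
  set q := (1 - Real.exp (-σ)) / (C + 1) with hq
  have hq0 : 0 < q := by positivity
  refine ⟨1 / β, q ^ (1 / β), δ / 2, by positivity, by positivity, by positivity, ?_⟩
  intro x hx y hy hxy hxy'
  have h1 := h x hx y hy (by rw [abs_sub_comm]; linarith)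
  have h2 : |x - y| ^ β ≤ q * |deriv f x| := by
    rw [abs_sub_comm]
    calc |y - x| ^ β ≤ (q ^ (1 / β) * |deriv f x| ^ (1 / β)) ^ β :=
          Real.rpow_le_rpow (abs_nonneg _) hxy' hβ.le
      _ = q * |deriv f x| := by
          rw [← Real.mul_rpow hq0.le (abs_nonneg _), ← Real.rpow_mul (by positivity),
            one_div_mul_cancel hβ.ne', Real.rpow_one]
  have h3 : C * q ≤ 1 - Real.exp (-σ) := by
    rw [hq, ← mul_div_assoc, div_le_iff₀ (by linarith)]
    nlinarith
  have h4 := (abs_le.1 h1).2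
  have h5 : C * |x - y| ^ β ≤ (1 - Real.exp (-σ)) * |deriv f x| :=
    calc C * |x - y| ^ β ≤ C * (q * |deriv f x|) := mul_le_mul_of_nonneg_left h2 hC
      _ = (C * q) * |deriv f x| := by ring
      _ ≤ _ := mul_le_mul_of_nonneg_right h3 (abs_nonneg _)
  linarith

theorem exists_abs_sub_eq_deriv_mul (hf : IsC3NonflatIntervalMap f a b) {x y : ℝ}
    (hx : x ∈ Icc a b) (hy : y ∈ Icc a b) :
    ∃ z ∈ uIcc x y, |f y - f x| = |deriv f z| * |y - x| := by
  wlog h : x ≤ y generalizing x y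
  · obtain ⟨z, hz, h⟩ := this hy hx (le_of_not_ge h)
    exact ⟨z, by rwa [uIcc_comm], by rw [abs_sub_comm, h, abs_sub_comm x y]⟩
  rcases h.eq_or_lt with rfl | h
  · exact ⟨x, by simp, by simp⟩
  have hsub : Icc x y ⊆ Icc a b := Icc_subset_Icc hx.1 hy.2
  obtain ⟨z, hz, hd⟩ := exists_deriv_eq_slope f h
    (fun z hz => (hf.diff z (hsub hz)).continuousAt.continuousWithinAt)
    (fun z hz => (hf.diff z (hsub (Ioo_subset_Icc_self hz))).differentiableWithinAt)
  refine ⟨z, by rw [uIcc_of_le h.le]; exact Ioo_subset_Icc_self hz, ?_⟩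
  rw [← abs_mul, hd, div_mul_cancel₀ _ (sub_pos.2 h).ne']

theorem exists_mem_uIcc_abs_sub_eq {x y r : ℝ} (hr : 0 ≤ r) (h : r ≤ |y - x|) :
    ∃ z ∈ uIcc x y, |z - x| = r := by
  rcases le_total x y with hxy | hxy
  · rw [abs_of_nonneg (by linarith)] at h
    exact ⟨x + r, by rw [uIcc_of_le hxy]; exact ⟨by linarith, by linarith⟩,
      by rw [add_sub_cancel_left, abs_of_nonneg hr]⟩
  · rw [abs_of_nonpos (by linarith)] at h
    exact ⟨x - r, by rw [uIcc_of_ge hxy]; exact ⟨by linarith, by linarith⟩,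
      by rw [sub_sub_cancel_left, abs_neg, abs_of_nonneg hr]⟩

theorem exists_pullback_chain (hf : IsC3NonflatIntervalMap f a b) {x : ℝ} (hx : x ∈ Icc a b)
    {j : ℕ} {R : ℕ → ℝ} (hR : ∀ l ≤ j, 0 ≤ R l) (hR0 : R 0 ≤ (b - a) / 2)
    (hstep : ∀ l < j, ∀ y ∈ Icc a b, |y - f^[l] x| ≤ R l → R (l + 1) ≤ |deriv f y| * R l) :
    ∃ e ∈ Icc a b, |e - f^[j] x| = R j ∧
      uIcc (f^[j] x) e ⊆ f^[j] '' {y ∈ Icc a b | ∀ l ≤ j, |f^[l] y - f^[l] x| ≤ R l} := by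
  induction j with
  | zero =>
    obtain ⟨e, he, hex⟩ : ∃ e ∈ Icc a b, |e - x| = R 0 := by
      have h0 := hR 0 le_rfl
      by_cases hxm : x ≤ (a + b) / 2
      · exact ⟨x + R 0, ⟨by linarith [hx.1], by linarith⟩, by
          rw [add_sub_cancel_left, abs_of_nonneg h0]⟩
      · push Not at hxm
        exact ⟨x - R 0, ⟨by linarith, by linarith [hx.2]⟩, by
          rw [sub_sub_cancel_left, abs_neg, abs_of_nonneg h0]⟩
    refine ⟨e, he, hex, fun y hy => ⟨y, ⟨uIcc_subset_Icc hx he hy, fun l hl => ?_⟩, rfl⟩⟩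
    obtain rfl : l = 0 := by omega
    exact (abs_sub_left_of_mem_uIcc hy).trans hex.le
  | succ j ih =>
    obtain ⟨e, he, hex, hsub⟩ := ih (fun l hl => hR l (by omega)) (fun l hl => hstep l (by omega))
    have hxj := hf.mapsTo.iterate j hx
    obtain ⟨z, hz, hfz⟩ := exists_abs_sub_eq_deriv_mul hf hxj he
    have hzx : |z - f^[j] x| ≤ R j := (abs_sub_left_of_mem_uIcc hz).trans hex.le
    have h1 : R (j + 1) ≤ |f e - f (f^[j] x)| := by
      rw [hfz, hex]
      exact hstep j (by omega) z (uIcc_subset_Icc hxj he hz) hzx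
    obtain ⟨e', he', hex'⟩ := exists_mem_uIcc_abs_sub_eq (hR (j + 1) le_rfl) h1
    have hIe : uIcc (f^[j] x) e ⊆ Icc a b := uIcc_subset_Icc hxj he
    have hcont : ContinuousOn f (uIcc (f^[j] x) e) := fun z hz =>
      (hf.diff z (hIe hz)).continuousAt.continuousWithinAt
    rw [Function.iterate_succ_apply']
    refine ⟨e', uIcc_subset_Icc (hf.mapsTo hxj) (hf.mapsTo he) he', hex', fun w hw => ?_⟩
    have hw' : w ∈ uIcc (f (f^[j] x)) (f e) := uIcc_subset_uIcc_left he' hw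
    obtain ⟨v, hv, rfl⟩ := intermediate_value_uIcc hcont hw'
    obtain ⟨y, ⟨hyI, hy⟩, rfl⟩ := hsub hv
    refine ⟨y, ⟨hyI, fun l hl => ?_⟩, Function.iterate_succ_apply' f j y⟩
    rcases Nat.lt_or_ge j l with h | h
    · obtain rfl : l = j + 1 := by omega
      rw [Function.iterate_succ_apply', Function.iterate_succ_apply']
      exact (abs_sub_left_of_mem_uIcc hw).trans hex'.le
    · exact hy l h

/-- Expansion rate of `f` at `x`, with a margin and a penalty for being close to a critical
point. -/
def expansionGauge (f : ℝ → ℝ) (σ s B x : ℝ) : ℝ :=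
  Real.log |deriv f x| - 2 * σ + min 0 (s * Real.log |deriv f x| + B)

theorem exists_hyperbolic_pullback (hf : IsC3NonflatIntervalMap f a b) {σ s κ ρ B r : ℝ}
    (hσ : 0 < σ)
    (hdist : ∀ x ∈ Icc a b, ∀ y ∈ Icc a b, |y - x| ≤ ρ →
      |y - x| ≤ κ * |deriv f x| ^ s → Real.exp (-σ) * |deriv f x| ≤ |deriv f y|)
    (hr : 0 < r) (hrρ : r ≤ ρ) (hrab : r ≤ (b - a) / 2) (hrB : r * Real.exp B ≤ κ)
    {x : ℝ} (hx : x ∈ Icc a b) {j : ℕ} (hcrit : ∀ l < j, deriv f (f^[l] x) ≠ 0)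
    (hhyp : ∀ l < j, 0 ≤ ∑ i ∈ Finset.Ico l j, expansionGauge f σ s B (f^[i] x)) :
    ∃ e ∈ Icc a b, |e - f^[j] x| = r ∧
      uIcc (f^[j] x) e ⊆ f^[j] '' {y ∈ Icc a b | ∀ l ≤ j,
        |f^[l] y - f^[l] x| ≤ r * Real.exp (-σ * ((j - l : ℕ) : ℝ))} := by
  set Λ : ℕ → ℝ := fun i => Real.log |deriv f (f^[i] x)| with hΛ
  set R : ℕ → ℝ := fun l => r * Real.exp (-∑ i ∈ Finset.Ico l j, (Λ i - σ)) with hRdef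
  have hRpos : ∀ l, 0 < R l := fun l => by positivity
  have hsum : ∀ l < j, σ * ((j - l : ℕ) : ℝ) - min 0 (s * Λ l + B) ≤
      ∑ i ∈ Finset.Ico l j, (Λ i - σ) := by
    intro l hl
    have h1 := hhyp l hl
    have h2 : ∑ i ∈ Finset.Ico l j, expansionGauge f σ s B (f^[i] x) =
        ∑ i ∈ Finset.Ico l j, (Λ i - σ) - σ * ((j - l : ℕ) : ℝ) +
          ∑ i ∈ Finset.Ico l j, min 0 (s * Λ i + B) := by
      rw [← Nat.card_Ico, mul_comm σ, ← nsmul_eq_mul, ← Finset.sum_const,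
        ← Finset.sum_sub_distrib, ← Finset.sum_add_distrib]
      refine Finset.sum_congr rfl fun i _ => ?_
      simp only [expansionGauge, hΛ]
      ring
    have h3 : ∑ i ∈ Finset.Ico l j, min 0 (s * Λ i + B) ≤ min 0 (s * Λ l + B) := by
      rw [Finset.sum_eq_sum_Ico_succ_bot hl]
      have : ∑ i ∈ Finset.Ico (l + 1) j, min 0 (s * Λ i + B) ≤ 0 :=
        Finset.sum_nonpos fun i _ => min_le_left _ _
      linarith
    linarith
  have hR1 : ∀ l ≤ j, R l ≤ r * Real.exp (-σ * ((j - l : ℕ) : ℝ)) := by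
    intro l hl
    rcases hl.eq_or_lt with rfl | hl
    · simp [hRdef]
    · refine mul_le_mul_of_nonneg_left (Real.exp_le_exp.2 ?_) hr.le
      have := hsum l hl
      have := min_le_left 0 (s * Λ l + B)
      linarith
  have hR2 : ∀ l < j, R l ≤ κ * |deriv f (f^[l] x)| ^ s := by
    intro l hl
    have h1 : R l ≤ r * Real.exp (B + Λ l * s) := by
      refine mul_le_mul_of_nonneg_left (Real.exp_le_exp.2 ?_) hr.le
      have := hsum l hl
      have := min_le_right 0 (s * Λ l + B)
      have : 0 ≤ σ * ((j - l : ℕ) : ℝ) := by positivity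
      linarith
    rw [Real.exp_add, ← mul_assoc] at h1
    rw [Real.rpow_def_of_pos (abs_pos.2 (hcrit l hl))]
    exact h1.trans (mul_le_mul_of_nonneg_right hrB (Real.exp_nonneg _))
  have hR3 : ∀ l ≤ j, R l ≤ r := fun l hl => (hR1 l hl).trans
    (mul_le_of_le_one_right hr.le (Real.exp_le_one_iff.2 (by
      have : 0 ≤ σ * ((j - l : ℕ) : ℝ) := by positivity
      linarith)))
  obtain ⟨e, he, hex, hsub⟩ := exists_pullback_chain hf hx (j := j) (R := R)
    (fun l _ => (hRpos l).le) ((hR3 0 (Nat.zero_le _)).trans hrab) (by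
      intro l hl y hy hyx
      have h1 := hdist _ (hf.mapsTo.iterate l hx) y hy (hyx.trans ((hR3 l hl.le).trans hrρ))
        (hyx.trans (hR2 l hl))
      refine le_trans (le_of_eq ?_) (mul_le_mul_of_nonneg_right h1 (hRpos l).le)
      have h2 : |deriv f (f^[l] x)| = Real.exp (Λ l) :=
        (Real.exp_log (abs_pos.2 (hcrit l hl))).symm
      simp only [hRdef]
      rw [h2, Finset.sum_eq_sum_Ico_succ_bot hl, ← Real.exp_add, mul_left_comm, ← Real.exp_add]
      congr 2
      ring)
  refine ⟨e, he, by simpa [hRdef] using hex, hsub.trans (image_mono ?_)⟩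
  exact fun y hy => ⟨hy.1, fun l hl => (hy.2 l hl).trans (hR1 l hl)⟩

end HyperbolicTimes

section Records

theorem exists_count_eq {p : ℕ → Prop} [DecidablePred p] {n q : ℕ} (h : q < Nat.count p n) :
    ∃ j < n, p j ∧ Nat.count p j = q := by
  induction n with
  | zero => simp at h
  | succ n ih =>
    by_cases hq : q < Nat.count p n
    · obtain ⟨j, hj, h⟩ := ih hq
      exact ⟨j, hj.trans n.lt_succ_self, h⟩
    · rw [Nat.count_succ] at h
      split_ifs at h with hp
      · exact ⟨n, n.lt_succ_self, hp, by omega⟩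
      · omega

open scoped Classical in
theorem sum_le_mul_count_record {u : ℕ → ℝ} {M : ℝ} (hM : ∀ i, u i ≤ M) (hM0 : 0 ≤ M) (n : ℕ) :
    ∑ i ∈ Finset.range n, u i ≤
      M * Nat.count (fun j => ∀ l < j, 0 ≤ ∑ i ∈ Finset.Ico l j, u i) (n + 1) := by
  induction n using Nat.strong_induction_on with
  | _ n ih =>
    rcases n with _ | n
    · simp only [Finset.range_zero, Finset.sum_empty]
      positivity
    by_cases hrec : ∀ l < n + 1, 0 ≤ ∑ i ∈ Finset.Ico l (n + 1), u i
    · rw [Nat.count_succ, if_pos hrec, Finset.sum_range_succ]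
      push_cast
      have := ih n n.lt_succ_self
      have := hM n
      linarith
    · push Not at hrec
      obtain ⟨l, hl, hlt⟩ := hrec
      have h1 := Finset.sum_range_add_sum_Ico u hl.le
      have h2 := ih l hl
      refine le_trans (by linarith) (h2.trans (mul_le_mul_of_nonneg_left ?_ hM0))
      exact_mod_cast Nat.count_monotone _ (by omega)

/-- If `u` grows linearly while `w` stays almost balanced, then after a suitable time `i` there
are `Q` record times of `u` along which `w` has not lost more than `1` since time `i`. -/
theorem exists_record_times {u w : ℕ → ℝ} {M c ε D : ℝ} {Q n : ℕ} (hM : ∀ i, u i ≤ M)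
    (hM0 : 0 < M) (hQ : 0 < Q) (hu : c * n ≤ ∑ i ∈ Finset.range n, u i)
    (hw : -ε * n ≤ ∑ i ∈ Finset.range n, w i)
    (hw' : ∀ i ≤ n, ∑ l ∈ Finset.Ico i n, w l ≤ ε * n + D)
    (hn : M * Q * (2 * ε * n + D + 2) < c * n) :
    ∃ (i : ℕ) (J : ℕ → ℕ), (∀ k < Q, i < J k ∧ (∀ l < J k, 0 ≤ ∑ r ∈ Finset.Ico l (J k), u r) ∧
      -1 ≤ ∑ r ∈ Finset.Ico i (J k), w r) ∧ ∀ k l, k < l → l < Q → J k < J l := by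
  classical
  set p : ℕ → Prop := fun j => ∀ l < j, 0 ≤ ∑ i ∈ Finset.Ico l j, u i with hp
  have hQ' : (0 : ℝ) < Q := by exact_mod_cast hQ
  set t : ℕ → ℝ := fun j => ∑ i ∈ Finset.range j, w i + (Nat.count p (j + 1) : ℝ) / Q with ht
  obtain ⟨i, hi, hmin⟩ := (Finset.range (n + 1)).exists_min_image t ⟨0, by simp⟩
  have hin : i ≤ n := by simpa [Nat.lt_succ_iff] using hi
  have hloss : ∀ j, i ≤ j → j ≤ n →
      -(((Nat.count p (j + 1) : ℝ) - Nat.count p (i + 1)) / Q) ≤ ∑ r ∈ Finset.Ico i j, w r := by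
    intro j hij hjn
    have h1 := hmin j (by simp; omega)
    simp only [ht] at h1
    have h2 := Finset.sum_range_add_sum_Ico w hij
    rw [sub_div]
    linarith
  have hcount : Nat.count p (i + 1) + Q ≤ Nat.count p (n + 1) := by
    by_contra hcon
    push Not at hcon
    have hcon' : (Nat.count p (n + 1) : ℝ) / Q ≤ (Nat.count p (i + 1) : ℝ) / Q + 1 := by
      rw [← div_add_same hQ'.ne']
      exact div_le_div_of_nonneg_right (by exact_mod_cast hcon.le) hQ'.le
    have h1 := hmin 0 (by simp)
    have h0 : t 0 ≤ 1 := by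
      have : Nat.count p (0 + 1) ≤ 1 := Nat.count_le p
      simp only [ht, Finset.range_zero, Finset.sum_empty, zero_add]
      rw [div_le_one hQ']
      exact_mod_cast this.trans hQ
    have h2 := Finset.sum_range_add_sum_Ico w hin
    have h3 := hw' i hin
    have h4 : (Nat.count p (n + 1) : ℝ) / Q ≤ 2 * ε * n + D + 2 := by
      simp only [ht] at h1 h0
      linarith
    rw [div_le_iff₀ hQ'] at h4
    have h5 := sum_le_mul_count_record hM hM0.le n
    have h6 := mul_le_mul_of_nonneg_left h4 hM0.le
    have : M * ((2 * ε * n + D + 2) * Q) = M * Q * (2 * ε * n + D + 2) := by ring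
    have h7 : ∑ i ∈ Finset.range n, u i ≤ M * Nat.count p (n + 1) := h5
    linarith
  have hJ : ∀ k, ∃ j, k < Q → j < n + 1 ∧ p j ∧ Nat.count p j = Nat.count p (i + 1) + k := by
    intro k
    by_cases hk : k < Q
    · obtain ⟨j, h1, h2⟩ := exists_count_eq (p := p) (n := n + 1) (q := Nat.count p (i + 1) + k)
        (by omega)
      exact ⟨j, fun _ => ⟨h1, h2⟩⟩
    · exact ⟨0, fun h => absurd h hk⟩
  choose J hJ using hJ
  refine ⟨i, J, fun k hk => ?_, fun k l hkl hl => ?_⟩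
  · obtain ⟨h1, h2, h3⟩ := hJ k hk
    have h4 : Nat.count p (J k + 1) = Nat.count p (J k) + 1 := by
      rw [Nat.count_succ, if_pos h2]
    have hlt : i < J k := by
      by_contra hcon
      have := Nat.count_monotone p (show J k + 1 ≤ i + 1 by omega)
      omega
    refine ⟨hlt, h2, le_trans ?_ (hloss (J k) hlt.le (by omega))⟩
    rw [neg_le_neg_iff, div_le_one hQ', h4, h3]
    push_cast
    have : (k : ℝ) + 1 ≤ Q := by exact_mod_cast hk
    linarith
  · by_contra hcon
    have h1 := (hJ k (hkl.trans hl)).2.2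
    have h2 := (hJ l hl).2.2
    have := Nat.count_monotone p (show J l ≤ J k by omega)
    omega

end Records

section ReturnBranches

variable {a b : ℝ} {f : ℝ → ℝ}

theorem sum_exp_neg_le {θ : ℝ} (hθ : 0 < θ) (j : ℕ) :
    ∑ l ∈ Finset.range j, Real.exp (-θ * ((j - l : ℕ) : ℝ)) ≤ 1 / (1 - Real.exp (-θ)) := by
  have h1 : Real.exp (-θ) < 1 := Real.exp_lt_one_iff.2 (by linarith)
  have h2 : ∀ i : ℕ, Real.exp (-θ * i) = Real.exp (-θ) ^ i := fun i => by
    rw [← Real.exp_nat_mul, mul_comm]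
  simp only [h2]
  rw [← Finset.sum_range_reflect, one_div, ← tsum_geometric_of_lt_one (Real.exp_nonneg _) h1]
  calc _ ≤ ∑ l ∈ Finset.range j, Real.exp (-θ) ^ l :=
        Finset.sum_le_sum fun l hl => by
          refine pow_le_pow_of_le_one (Real.exp_nonneg _) h1.le ?_
          have := Finset.mem_range.1 hl
          omega
    _ ≤ _ := (summable_geometric_of_lt_one (Real.exp_nonneg _) h1).sum_le_tsum _
        fun i _ => pow_nonneg (Real.exp_nonneg _) _

/-- Points that stay exponentially close to the orbit of `z` up to time `j`, and that land in
`[u, v]` at time `j + N`. -/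
def branchSet (f : ℝ → ℝ) (a b σ r z : ℝ) (j N : ℕ) (u v : ℝ) : Set (Icc a b) :=
  {y | (∀ l ≤ j, |f^[l] y - f^[l] z| ≤ r * Real.exp (-σ * ((j - l : ℕ) : ℝ))) ∧
    f^[j + N] y ∈ Icc u v}

theorem isClosed_branchSet (hmaps : MapsTo f (Icc a b) (Icc a b))
    (hF : Continuous (hmaps.restrict f _ _)) (σ r z : ℝ) (j N : ℕ) (u v : ℝ) :
    IsClosed (branchSet f a b σ r z j N u v) := by
  have hc : ∀ l, Continuous fun y : Icc a b => f^[l] y := fun l => by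
    simp only [← val_iterate_restrict hmaps]
    exact continuous_subtype_val.comp (hF.iterate l)
  have : branchSet f a b σ r z j N u v =
      (⋂ l, ⋂ (_ : l ≤ j), {y : Icc a b |
        |f^[l] y - f^[l] z| ≤ r * Real.exp (-σ * ((j - l : ℕ) : ℝ))}) ∩
      (fun y : Icc a b => f^[j + N] y) ⁻¹' Icc u v := by
    ext y
    simp [branchSet]
  rw [this]
  refine IsClosed.inter (isClosed_iInter fun l => isClosed_iInter fun _ => ?_)
    (isClosed_Icc.preimage (hc _))
  exact isClosed_le ((hc l).sub continuous_const).abs continuous_const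

theorem exists_mem_branchSet (hmaps : MapsTo f (Icc a b) (Icc a b)) {σ r z u v : ℝ} {j N : ℕ}
    (hN : ∀ u v, a ≤ u → v ≤ b → r ≤ v - u → f^[N] '' Icc u v = Icc a b)
    (hz : z ∈ Icc a b) {e : ℝ} (he : e ∈ Icc a b) (hez : |e - f^[j] z| = r)
    (hsub : uIcc (f^[j] z) e ⊆ f^[j] '' {y ∈ Icc a b | ∀ l ≤ j,
        |f^[l] y - f^[l] z| ≤ r * Real.exp (-σ * ((j - l : ℕ) : ℝ))})
    (hu : a ≤ u) (hv : v ≤ b) (huv : r ≤ v - u) (x : Icc a b) :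
    ∃ y ∈ branchSet f a b σ r z j N u v, (hmaps.restrict f _ _)^[j + 2 * N] y = x := by
  have hzj := hmaps.iterate j hz
  obtain ⟨w, hw, hwx⟩ : (x : ℝ) ∈ f^[N] '' Icc u v := by
    rw [hN u v hu hv huv]; exact x.2
  obtain ⟨p, hp, hpw⟩ : w ∈ f^[N] '' uIcc (f^[j] z) e := by
    rw [uIcc, hN _ _ (le_inf hzj.1 he.1) (sup_le hzj.2 he.2)]
    · exact ⟨hu.trans hw.1, hw.2.trans hv⟩
    · rw [max_sub_min_eq_abs, hez]
  obtain ⟨y, ⟨hyI, hy⟩, rfl⟩ := hsub hp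
  have h1 : f^[j + N] y = w := by rw [add_comm, Function.iterate_add_apply, hpw]
  refine ⟨⟨y, hyI⟩, ⟨hy, by rw [h1]; exact hw⟩, Subtype.ext ?_⟩
  rw [val_iterate_restrict, ← hwx, ← h1, show j + 2 * N = N + (j + N) by omega,
    Function.iterate_add_apply]

theorem le_birkhoffSum_of_mem_branchSet (hmaps : MapsTo f (Icc a b) (Icc a b)) {ψ : ℝ → ℝ}
    {C α D σ r z u v : ℝ} (hα : 0 < α) (hC : 0 ≤ C) (hr : 0 ≤ r) (hσ : 0 < σ)
    (hψ : ∀ x ∈ Icc a b, ∀ y ∈ Icc a b, |ψ x - ψ y| ≤ C * |x - y| ^ α)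
    (hD : ∀ x ∈ Icc a b, -D ≤ ψ x) (hz : z ∈ Icc a b) {j N : ℕ} {y : Icc a b}
    (hy : y ∈ branchSet f a b σ r z j N u v)
    (hzs : -1 ≤ ∑ i ∈ Finset.range j, ψ (f^[i] z)) :
    -(1 + C * r ^ α * (1 / (1 - Real.exp (-(σ * α)))) + 2 * N * D) ≤
      birkhoffSum (hmaps.restrict f _ _) (fun x : Icc a b => ψ x) (j + 2 * N) y := by
  simp only [birkhoffSum, val_iterate_restrict]
  rw [Finset.sum_range_add]
  have h1 : -(2 * N * D) ≤ ∑ i ∈ Finset.range (2 * N), ψ (f^[j + i] y) := by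
    calc -(2 * N * D) = ∑ i ∈ Finset.range (2 * N), -D := by
          rw [Finset.sum_const, Finset.card_range, nsmul_eq_mul]; push_cast; ring
      _ ≤ _ := Finset.sum_le_sum fun i _ => hD _ (hmaps.iterate _ y.2)
  have h2 : ∑ i ∈ Finset.range j, ψ (f^[i] z) - ∑ i ∈ Finset.range j, ψ (f^[i] y) ≤
      C * r ^ α * (1 / (1 - Real.exp (-(σ * α)))) := by
    rw [← Finset.sum_sub_distrib]
    calc _ ≤ ∑ i ∈ Finset.range j, C * r ^ α * Real.exp (-(σ * α) * ((j - i : ℕ) : ℝ)) := by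
          refine Finset.sum_le_sum fun i hi => (le_abs_self _).trans ?_
          refine (hψ _ (hmaps.iterate i hz) _ (hmaps.iterate i y.2)).trans ?_
          rw [mul_assoc]
          refine mul_le_mul_of_nonneg_left ?_ hC
          rw [abs_sub_comm]
          refine (Real.rpow_le_rpow (abs_nonneg _) (hy.1 i (Finset.mem_range.1 hi).le)
            hα.le).trans (le_of_eq ?_)
          rw [Real.mul_rpow hr (Real.exp_nonneg _), ← Real.exp_mul]
          congr 2
          ring
      _ ≤ _ := by
          rw [← Finset.mul_sum]
          exact mul_le_mul_of_nonneg_left (sum_exp_neg_le (by positivity) j) (by positivity)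
  linarith

theorem exists_third (hab : a ≤ b) (q : ℝ) : ∃ u v, a ≤ u ∧ v ≤ b ∧ (b - a) / 3 ≤ v - u ∧
    ∀ y ∈ Icc u v, (b - a) / 6 ≤ |y - q| := by
  by_cases h : q ≤ (a + b) / 2
  · refine ⟨b - (b - a) / 3, b, by linarith, le_rfl, by linarith, fun y hy => ?_⟩
    exact le_trans (by linarith [hy.1]) (le_abs_self _)
  · push Not at h
    refine ⟨a, a + (b - a) / 3, le_rfl, by linarith, by linarith, fun y hy => ?_⟩
    exact le_trans (by linarith [hy.2]) (neg_le_abs _)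

theorem disjoint_branchSet {σ r z u v u' v' : ℝ} {j j' N : ℕ} (hjj : j + N ≤ j')
    (hfar : ∀ y ∈ Icc u v, (b - a) / 6 ≤ |y - f^[j + N] z|)
    (hsmall : r * Real.exp (-σ * ((j' - (j + N) : ℕ) : ℝ)) < (b - a) / 6) :
    Disjoint (branchSet f a b σ r z j N u v) (branchSet f a b σ r z j' N u' v') := by
  rw [Set.disjoint_left]
  intro y hy hy'
  have h1 := hfar _ hy.2
  have h2 := hy'.1 (j + N) hjj
  linarith

end ReturnBranches

section GoodSegments

theorem exists_le_expansionGauge_integral {a b : ℝ} {f : ℝ → ℝ} {μ : Measure (Icc a b)}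
    [IsProbabilityMeasure μ] {σ : ℝ} (hσ : 0 < σ) (s : ℝ)
    (hint : Integrable (fun x : Icc a b => Real.log |deriv f x|) μ)
    (hle : 4 * σ ≤ ∫ x : Icc a b, Real.log |deriv f x| ∂μ) :
    ∃ B, Integrable (fun x : Icc a b => expansionGauge f σ s B x) μ ∧
      σ ≤ ∫ x : Icc a b, expansionGauge f σ s B x ∂μ := by
  set Λ : Icc a b → ℝ := fun x => Real.log |deriv f x| with hΛ
  have hmin : ∀ B, Integrable (fun x => min 0 (s * Λ x + B)) μ := fun B =>
    (integrable_const 0).inf ((hint.const_mul s).add (integrable_const B))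
  have hlim : Tendsto (fun n : ℕ => ∫ x, min 0 (s * Λ x + n) ∂μ) atTop (nhds (∫ _, (0 : ℝ) ∂μ)) := by
    refine tendsto_integral_of_dominated_convergence (fun x => |s * Λ x|)
      (fun n => (hmin n).aestronglyMeasurable) (hint.const_mul s).abs
      (fun n => Eventually.of_forall fun x => ?_) (Eventually.of_forall fun x => ?_)
    · rw [Real.norm_eq_abs, abs_of_nonpos (min_le_left _ _), ← max_neg_neg, neg_zero]
      refine max_le (abs_nonneg _) ?_
      have := neg_le_abs (s * Λ x)
      have : (0 : ℝ) ≤ n := n.cast_nonneg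
      linarith
    · obtain ⟨N, hN⟩ := exists_nat_ge (-(s * Λ x))
      refine tendsto_const_nhds.congr' ?_
      filter_upwards [eventually_ge_atTop N] with n hn
      have : (N : ℝ) ≤ n := by exact_mod_cast hn
      rw [min_eq_left (by linarith)]
  rw [integral_zero] at hlim
  obtain ⟨n, hn⟩ := (hlim.eventually (lt_mem_nhds (show -σ < 0 by linarith))).exists
  have h1 : Integrable (fun x => Λ x - 2 * σ) μ := hint.sub (integrable_const _)
  refine ⟨n, h1.add (hmin n), ?_⟩
  have h2 : ∫ x : Icc a b, expansionGauge f σ s n x ∂μ =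
      ∫ x, Λ x ∂μ - 2 * σ + ∫ x, min 0 (s * Λ x + n) ∂μ := by
    have h3 : ∫ x, (Λ x - 2 * σ) ∂μ = ∫ x, Λ x ∂μ - 2 * σ := by
      rw [integral_sub hint (integrable_const _)]
      simp
    rw [← h3, ← integral_add h1 (hmin n)]
    rfl
  rw [h2]
  linarith

theorem birkhoffSum_le_of_sup {X : Type*} {F : X → X} {ψ : X → ℝ} {ε D : ℝ} {p : ℕ} (hp : 1 ≤ p)
    (hε : 0 ≤ ε) (hD : ∀ x, ψ x ≤ D) (hD0 : 0 ≤ D) (h : ∀ x, birkhoffSum F ψ p x ≤ ε * p) (l : ℕ) :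
    ∀ x, birkhoffSum F ψ l x ≤ ε * l + p * D := by
  induction l using Nat.strong_induction_on with
  | _ l ih =>
    intro x
    rcases lt_or_ge l p with hl | hl
    · have h1 : birkhoffSum F ψ l x ≤ l * D := by
        rw [birkhoffSum]
        exact (Finset.sum_le_card_nsmul _ _ D fun i _ => hD _).trans (by simp)
      have h2 : (l : ℝ) * D ≤ p * D := mul_le_mul_of_nonneg_right (by exact_mod_cast hl.le) hD0
      have : 0 ≤ ε * l := by positivity
      linarith
    · obtain ⟨k, rfl⟩ := Nat.exists_eq_add_of_le hl
      rw [birkhoffSum_add]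
      have h1 := ih k (by omega) (F^[p] x)
      have h2 := h x
      push_cast
      linarith

theorem integral_birkhoffSum_eq {X : Type*} [MeasurableSpace X] {μ : Measure X} {F : X → X}
    (hF : MeasurePreserving F μ μ) {g : X → ℝ} (hg : Integrable g μ) (n : ℕ) :
    Integrable (birkhoffSum F g n) μ ∧ ∫ x, birkhoffSum F g n x ∂μ = n * ∫ x, g x ∂μ := by
  have h1 : ∀ i, Integrable (fun x => g (F^[i] x)) μ := fun i =>
    (hF.iterate i).integrable_comp_of_integrable hg
  have h2 : ∀ i, ∫ x, g (F^[i] x) ∂μ = ∫ x, g x ∂μ := fun i => by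
    have hi := hF.iterate i
    rw [← integral_map hi.aemeasurable (by rw [hi.map_eq]; exact hg.aestronglyMeasurable),
      hi.map_eq]
  refine ⟨?_, ?_⟩
  · have := integrable_finsetSum (Finset.range n) fun i _ => h1 i
    exact this
  · simp only [birkhoffSum]
    rw [integral_finsetSum _ fun i _ => h1 i]
    simp [h2]

/-- If `g` has positive mean and `ψ` has nonnegative mean but asymptotically nonpositive maximal
averages, then there are arbitrarily long orbit segments along which `g` grows linearly while `ψ`
is almost balanced. -/
theorem exists_good_segment {X : Type*} [MeasurableSpace X] {μ : Measure X}
    [IsProbabilityMeasure μ] {F : X → X} (hF : MeasurePreserving F μ μ) {g ψ : X → ℝ}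
    (hg : Integrable g μ) (hψ : Integrable ψ μ) {M σ ε : ℝ} (hM : 0 < M) (hσ : 0 < σ) (hε : 0 < ε)
    (hgM : ∀ x, g x ≤ M) (hgσ : σ ≤ ∫ x, g x ∂μ) (hψ0 : 0 ≤ ∫ x, ψ x ∂μ)
    (hsup : ∀ η : ℝ, 0 < η → ∃ D, ∀ (l : ℕ) x, birkhoffSum F ψ l x ≤ η * l + D)
    {Z : Set X} (hZ : μ Z = 0) :
    ∃ D, (∀ (l : ℕ) x, birkhoffSum F ψ l x ≤ ε * l + D) ∧ ∀ n₀ : ℕ, ∃ n ≥ n₀, ∃ x,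
      (∀ i, F^[i] x ∉ Z) ∧ σ / 2 * n ≤ birkhoffSum F g n x ∧ -ε * n ≤ birkhoffSum F ψ n x := by
  set t := M / ε with ht
  have ht0 : 0 < t := by positivity
  obtain ⟨D, hD⟩ := hsup (min ε (σ / (4 * t))) (by positivity)
  refine ⟨D, fun l x => (hD l x).trans ?_, fun n₀ => ?_⟩
  · have := mul_le_mul_of_nonneg_right (min_le_left ε (σ / (4 * t))) l.cast_nonneg
    linarith
  obtain ⟨n, hn⟩ := exists_nat_ge (max (n₀ : ℝ) (4 * t * D / σ))
  have hn1 : n₀ ≤ n := by exact_mod_cast (le_max_left _ _).trans hn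
  have hn2 : 4 * t * D ≤ n * σ := by
    rw [← div_le_iff₀ hσ]
    exact (le_max_right _ _).trans hn
  obtain ⟨hgi, hge⟩ := integral_birkhoffSum_eq hF hg n
  obtain ⟨hψi, hψe⟩ := integral_birkhoffSum_eq hF hψ n
  have hnull : μ (⋃ i, F^[i] ⁻¹' Z) = 0 := by
    rw [measure_iUnion_null_iff]
    exact fun i => (hF.iterate i).quasiMeasurePreserving.preimage_null hZ
  obtain ⟨x, hxZ, hx⟩ := exists_notMem_null_integral_le (hgi.add (hψi.const_mul t)) hnull
  have hint : ∫ x, (birkhoffSum F g n + fun x => t * birkhoffSum F ψ n x) x ∂μ =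
      n * ∫ x, g x ∂μ + t * (n * ∫ x, ψ x ∂μ) := by
    simp only [Pi.add_apply]
    rw [integral_add hgi (hψi.const_mul t), integral_const_mul, hge, hψe]
  rw [hint] at hx
  simp only [Pi.add_apply] at hx
  have hlow : σ * n ≤ birkhoffSum F g n x + t * birkhoffSum F ψ n x := by
    refine le_trans ?_ hx
    have h1 := mul_le_mul_of_nonneg_left hgσ n.cast_nonneg
    have h2 : 0 ≤ t * (n * ∫ x, ψ x ∂μ) := by positivity
    linarith
  refine ⟨n, hn1, x, fun i hi => hxZ (mem_iUnion.2 ⟨i, hi⟩), ?_, ?_⟩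
  · have h1 : birkhoffSum F ψ n x ≤ σ / (4 * t) * n + D :=
      (hD n x).trans (by
        have := mul_le_mul_of_nonneg_right (min_le_right ε (σ / (4 * t))) n.cast_nonneg
        linarith)
    have h2 := mul_le_mul_of_nonneg_left h1 ht0.le
    have h3 : t * (σ / (4 * t) * n + D) = σ / 4 * n + t * D := by field_simp
    linarith
  · have h1 : birkhoffSum F g n x ≤ n * M := by
      rw [birkhoffSum]
      exact (Finset.sum_le_card_nsmul _ _ M fun i _ => hgM _).trans (by simp)
    have h2 : 0 ≤ σ * n := by positivity
    have h3 : -(n * M) ≤ t * birkhoffSum F ψ n x := by linarith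
    have h4 : t * (-ε * n) = -(n * M) := by rw [ht]; field_simp
    exact le_of_mul_le_mul_left (h4.le.trans h3) ht0

end GoodSegments

section Hyperbolicity

variable {a b : ℝ} {f : ℝ → ℝ}

theorem HolderOn.continuous_restrict {φ : ℝ → ℝ} {I : Set ℝ} (h : HolderOn φ I) :
    Continuous fun x : I => φ x := by
  obtain ⟨C, α, hα, -, hC, h⟩ := h
  refine continuous_iff_continuousAt.2 fun x => ?_
  rw [ContinuousAt, tendsto_iff_dist_tendsto_zero]
  refine squeeze_zero (fun _ => dist_nonneg) (fun y => h y y.2 x x.2) ?_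
  have hc : Continuous fun y : I => C * |(y : ℝ) - x| ^ α :=
    continuous_const.mul ((continuous_subtype_val.sub continuous_const).abs.rpow_const
      fun _ => Or.inr hα.le)
  have := hc.tendsto x
  simpa [Real.zero_rpow hα.ne'] using this

theorem expansionGauge_le {σ s B M x : ℝ} (hσ : 0 ≤ σ) (hM : 1 ≤ M) (h : |deriv f x| ≤ M) :
    expansionGauge f σ s B x ≤ M := by
  have h1 : Real.log |deriv f x| ≤ M := by
    rcases (abs_nonneg (deriv f x)).eq_or_lt with h0 | h0
    · rw [← h0, Real.log_zero]
      linarith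
    · exact (Real.log_le_sub_one_of_pos h0).trans (by linarith)
  have := min_le_left 0 (s * Real.log |deriv f x| + B)
  rw [expansionGauge]
  linarith

/-- For a potential that is not hyperbolic, the infimum `m` of the maximal Birkhoff averages
bounds the pressure from above. -/
theorem exists_sup_average_of_not_hyperbolic (hab : a ≤ b)
    (hmaps : MapsTo f (Icc a b) (Icc a b)) (hF : Continuous (hmaps.restrict f _ _)) {φ : ℝ → ℝ}
    (hφ : Continuous fun x : Icc a b => φ x) (hnot : ¬ HyperbolicPotential f (Icc a b) φ) :
    ∃ m, pressure f (Icc a b) φ ≤ m ∧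
      (∀ n : ℕ, 1 ≤ n → ∃ x, n * m ≤
        birkhoffSum (hmaps.restrict f _ _) (fun x : Icc a b => φ x) n x) ∧
      ∀ ε : ℝ, 0 < ε → ∃ n : ℕ, 1 ≤ n ∧ ∀ x,
        birkhoffSum (hmaps.restrict f _ _) (fun x : Icc a b => φ x) n x ≤ (m + ε) * n := by
  set S : ℕ → Icc a b → ℝ := fun n =>
    birkhoffSum (hmaps.restrict f _ _) (fun x : Icc a b => φ x) n with hS
  have hSc : ∀ n, Continuous (S n) := fun n =>
    continuous_finsetSum _ fun i _ => hφ.comp (hF.iterate i)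
  have hSval : ∀ n (x : Icc a b), birkhoffSum f φ n x = S n x := fun n x => by
    simp only [hS, birkhoffSum, val_iterate_restrict]
  have hmax : ∀ n : ℕ, ∃ z, ∀ x, S n x ≤ S n z := fun n => by
    obtain ⟨z, -, hz⟩ := isCompact_univ.exists_isMaxOn (s := (univ : Set (Icc a b)))
      ⟨⟨a, left_mem_Icc.2 hab⟩, mem_univ _⟩ (hSc n).continuousOn
    exact ⟨z, fun x => hz (mem_univ x)⟩
  choose z hz using hmax
  have hP : ∀ n : ℕ, 1 ≤ n → pressure f (Icc a b) φ ≤ S n (z n) / n := by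
    intro n hn
    rw [HyperbolicPotential] at hnot
    push Not at hnot
    refine (hnot n hn).trans (csSup_le ⟨_, mem_image_of_mem _ (left_mem_Icc.2 hab)⟩ ?_)
    rintro _ ⟨x, hx, rfl⟩
    have := hz n ⟨x, hx⟩
    rw [← hSval] at this
    exact div_le_div_of_nonneg_right this n.cast_nonneg
  set T : Set ℝ := (fun n : ℕ => S n (z n) / n) '' Ici 1 with hT
  have hTne : T.Nonempty := ⟨_, mem_image_of_mem _ (mem_Ici.2 le_rfl)⟩
  have hTb : pressure f (Icc a b) φ ∈ lowerBounds T := by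
    rintro _ ⟨n, hn, rfl⟩
    exact hP n hn
  refine ⟨sInf T, le_csInf hTne hTb, fun n hn => ⟨z n, ?_⟩, fun ε hε => ?_⟩
  · have h1 : sInf T ≤ S n (z n) / n := csInf_le ⟨_, hTb⟩ (mem_image_of_mem _ hn)
    have hn0 : (0 : ℝ) < n := by exact_mod_cast hn
    rw [le_div_iff₀ hn0] at h1
    rw [mul_comm]
    exact h1
  · obtain ⟨_, ⟨n, hn, rfl⟩, hlt⟩ := exists_lt_of_csInf_lt hTne (lt_add_of_pos_right (sInf T) hε)
    have hn0 : (0 : ℝ) < n := by exact_mod_cast (mem_Ici.1 hn)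
    refine ⟨n, hn, fun x => (hz n x).trans ?_⟩
    exact ((div_lt_iff₀ hn0).1 hlt).le

end Hyperbolicity

/-- **Remark (Topological Collet–Eckmann implies all Hölder potentials hyperbolic).**
If `f` is a topologically exact `C³` interval map with non-flat critical points
satisfying the Topological Collet–Eckmann condition (there is `χ > 0` with
`∫ ln|f'| dν ≥ χ` for every invariant probability measure `ν`), then every Hölder
continuous potential is hyperbolic for `f`. -/
theorem tce_implies_hyperbolic
    (a b : ℝ) (f : ℝ → ℝ)
    (hf : IsC3NonflatIntervalMap f a b)
    (hex : TopExact f (Icc a b))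
    (hTCE : ∃ χ : ℝ, 0 < χ ∧ ∀ ν : Measure ℝ, InvariantProb f (Icc a b) ν →
      χ ≤ ∫ x, Real.log |deriv f x| ∂ν) :
    ∀ φ : ℝ → ℝ, HolderOn φ (Icc a b) → HyperbolicPotential f (Icc a b) φ := by
  intro φ hφ
  by_contra hnot
  obtain ⟨χ, hχ, hTCE⟩ := hTCE
  have hab := hf.lt
  have hmaps := hf.mapsTo
  obtain ⟨L, hL⟩ := exists_lipschitzWith_restrict hf
  set F : Icc a b → Icc a b := hmaps.restrict f _ _ with hFdef
  have hF : Continuous F := hL.continuous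
  have hφc := hφ.continuous_restrict
  obtain ⟨m, hPm, hmge, hmle⟩ := exists_sup_average_of_not_hyperbolic hab.le hmaps hF hφc hnot
  have hψc : Continuous fun x : Icc a b => φ x - m := hφc.sub continuous_const
  have hψsum : ∀ n x, birkhoffSum F (fun x : Icc a b => φ x - m) n x =
      birkhoffSum F (fun x : Icc a b => φ x) n x - n * m := fun n x => by
    simp [birkhoffSum, Finset.sum_sub_distrib]
  obtain ⟨D, hD⟩ : ∃ D, ∀ x : Icc a b, |φ x - m| ≤ D := by
    obtain ⟨D, hD⟩ := isCompact_univ.exists_bound_of_continuousOn hψc.continuousOn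
    exact ⟨D, fun x => hD x (mem_univ x)⟩
  have hD0 : 0 ≤ D := (abs_nonneg _).trans (hD ⟨a, left_mem_Icc.2 hab.le⟩)
  have hsup : ∀ η : ℝ, 0 < η → ∃ D', ∀ (l : ℕ) x,
      birkhoffSum F (fun x : Icc a b => φ x - m) l x ≤ η * l + D' := by
    intro η hη
    obtain ⟨p, hp, hpx⟩ := hmle η hη
    refine ⟨p * D, birkhoffSum_le_of_sup hp hη.le (fun x => (le_abs_self _).trans (hD x)) hD0
      fun x => ?_⟩
    rw [hψsum]
    have := hpx x
    linarith
  obtain ⟨ν, hν, hνinv, hνφ⟩ := exists_invariant_integral_ge (F := F) hF hψc (c := 0)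
    (fun n hn => by
      obtain ⟨x, hx⟩ := hmge n hn
      exact ⟨x, by rw [hψsum, mul_zero]; linarith⟩)
  obtain ⟨hΛint, hΛ⟩ := integrable_log_abs_deriv hf hχ hTCE ν hνinv
  obtain ⟨σ, hσ, hσχ⟩ : ∃ σ : ℝ, 0 < σ ∧ 4 * σ = χ := ⟨χ / 4, by linarith, by ring⟩
  obtain ⟨s, κ, ρ, -, hκ, hρ, hdist⟩ := exists_distortion hf hσ
  obtain ⟨B, hgint, hgσ⟩ := exists_le_expansionGauge_integral hσ s hΛint (hσχ.trans_le hΛ)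
  obtain ⟨M, hM1, hM⟩ := exists_abs_deriv_le hf
  have hM0 : 0 < M := by linarith
  obtain ⟨r, hr, hrρ, hrκ, hrab⟩ : ∃ r : ℝ, 0 < r ∧ r ≤ ρ ∧ r * Real.exp B ≤ κ ∧
      r ≤ (b - a) / 3 := by
    have := sub_pos.2 hab
    refine ⟨min ρ (min (κ / Real.exp B) ((b - a) / 3)), by positivity, min_le_left _ _, ?_,
      (min_le_right _ _).trans (min_le_right _ _)⟩
    rw [← le_div_iff₀ (Real.exp_pos B)]
    exact (min_le_right _ _).trans (min_le_left _ _)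
  obtain ⟨N, hN⟩ := hex.exists_image_Icc hab hmaps hr
  obtain ⟨C, α, hα, -, hC, hH⟩ := hφ
  have hψH : ∀ x ∈ Icc a b, ∀ y ∈ Icc a b, |(φ x - m) - (φ y - m)| ≤ C * |x - y| ^ α := by
    intro x hx y hy
    rw [sub_sub_sub_cancel_right]
    exact hH x hx y hy
  set E := 1 + C * r ^ α * (1 / (1 - Real.exp (-(σ * α)))) + 2 * N * D with hE
  obtain ⟨K, hK⟩ := exists_nat_ge (2 * Real.exp E)
  have hK0 : 0 < K := by
    have : (0 : ℝ) < K := lt_of_lt_of_le (by positivity) hK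
    exact_mod_cast this
  obtain ⟨N', hN'1, hN'⟩ : ∃ N' : ℕ, 1 ≤ N' ∧ r * Real.exp (-σ * N') < (b - a) / 6 := by
    have h0 : Tendsto (fun n : ℕ => r * Real.exp (-σ * n)) atTop (nhds (r * 0)) := by
      refine Tendsto.const_mul r (Real.tendsto_exp_atBot.comp ?_)
      exact tendsto_natCast_atTop_atTop.const_mul_atTop_of_neg (by linarith)
    rw [mul_zero] at h0
    have := sub_pos.2 hab
    obtain ⟨n, h1, h2⟩ := ((eventually_ge_atTop 1).and
      (h0.eventually (gt_mem_nhds (show 0 < (b - a) / 6 by linarith)))).exists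
    exact ⟨n, h1, h2⟩
  set Q := K * (N + N') with hQ
  have hQ0 : 0 < Q := Nat.mul_pos hK0 (by omega)
  have hQ0' : (0 : ℝ) < Q := by exact_mod_cast hQ0
  obtain ⟨D', hD', hseg⟩ := exists_good_segment hνinv hgint (integrable_of_continuous hψc ν) hM0 hσ
    (ε := σ / (8 * (M * Q))) (by positivity) (fun x => expansionGauge_le hσ.le hM1 (hM x x.2))
    hgσ hνφ hsup (hex.measure_critical hf ν hνinv)
  obtain ⟨n₀, hn₀⟩ := exists_nat_gt (M * Q * (D' + 2) / (σ / 4))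
  obtain ⟨n, hn, x, hxcrit, hxg, hxφ⟩ := hseg n₀
  have hncount : M * Q * (2 * (σ / (8 * (M * Q))) * n + D' + 2) < σ / 2 * n := by
    have h1 : M * Q * (2 * (σ / (8 * (M * Q))) * n + D' + 2) =
        σ / 4 * n + M * Q * (D' + 2) := by field_simp; ring
    have h2 : M * Q * (D' + 2) / (σ / 4) < n := hn₀.trans_le (by exact_mod_cast hn)
    rw [div_lt_iff₀ (by linarith)] at h2
    linarith
  obtain ⟨i, J, hJ, hJmono⟩ := exists_record_times
    (u := fun i => expansionGauge f σ s B (F^[i] x)) (w := fun i => φ (F^[i] x) - m)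
    (fun i => expansionGauge_le hσ.le hM1 (hM _ (F^[i] x).2)) hM0 hQ0 hxg hxφ
    (fun l hl => by
      have h1 : ∑ r ∈ Finset.Ico l n, (φ (F^[r] x) - m) =
          birkhoffSum F (fun x : Icc a b => φ x - m) (n - l) (F^[l] x) := by
        rw [Finset.sum_Ico_eq_sum_range, birkhoffSum]
        refine Finset.sum_congr rfl fun t _ => ?_
        rw [← Function.iterate_add_apply, add_comm]
      rw [h1]
      refine (hD' _ _).trans ?_
      have : ((n - l : ℕ) : ℝ) ≤ n := by exact_mod_cast Nat.sub_le n l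
      have := mul_le_mul_of_nonneg_left this (show 0 ≤ σ / (8 * (M * Q)) by positivity)
      linarith) hncount
  set z : ℝ := ((F^[i] x : Icc a b) : ℝ) with hz
  have hzI : z ∈ Icc a b := (F^[i] x).2
  have hzit : ∀ l, f^[l] z = F^[i + l] x := fun l => by
    rw [hz, ← val_iterate_restrict hmaps, ← hFdef, ← Function.iterate_add_apply, add_comm]
  have hindex : ∀ k : Fin K, k * (N + N') < Q := fun k =>
    Nat.mul_lt_mul_of_pos_right k.2 (by omega)
  set j : Fin K → ℕ := fun k => J (k * (N + N')) - i with hj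
  have hij : ∀ k, i + j k = J (k * (N + N')) := fun k => by
    have := (hJ _ (hindex k)).1
    simp only [hj]
    omega
  have hJgap : ∀ t l, l + t < Q → J l + t ≤ J (l + t) := by
    intro t
    induction t with
    | zero => intro l _; simp
    | succ t ih =>
      intro l hl
      have h1 := ih l (by omega)
      have h2 := hJmono (l + t) (l + (t + 1)) (by omega) hl
      omega
  have hgap : ∀ k k' : Fin K, k < k' → j k + N + N' ≤ j k' := by
    intro k k' hkk
    have h1 : (k : ℕ) * (N + N') + (N + N') ≤ k' * (N + N') := by
      rw [← Nat.succ_mul]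
      exact Nat.mul_le_mul_right _ hkk
    obtain ⟨d, hd⟩ := Nat.exists_eq_add_of_le h1
    have h2 := hJgap (N + N' + d) (k * (N + N')) (by rw [← add_assoc, ← hd]; exact hindex k')
    rw [← add_assoc (_ * _), ← hd, ← hij, ← hij] at h2
    omega
  have hpull : ∀ k, ∃ e ∈ Icc a b, |e - f^[j k] z| = r ∧
      uIcc (f^[j k] z) e ⊆ f^[j k] '' {y ∈ Icc a b | ∀ l ≤ j k,
        |f^[l] y - f^[l] z| ≤ r * Real.exp (-σ * ((j k - l : ℕ) : ℝ))} := by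
    intro k
    refine exists_hyperbolic_pullback hf hσ hdist hr hrρ (by linarith) hrκ hzI (fun l _ => ?_)
      fun l hl => ?_
    · rw [hzit]
      exact hxcrit _
    · have h1 := (hJ _ (hindex k)).2.1 (i + l) (by rw [← hij]; omega)
      rw [← hij, add_comm i l, add_comm i (j k), ← Finset.sum_Ico_add] at h1
      simpa only [hzit] using h1
  choose e heI her hesub using hpull
  choose u v hu hv huv hfar using fun k => exists_third hab.le (f^[j k + N] z)
  have hlt : m < pressure f (Icc a b) φ := by
    refine lt_pressure_of_returns hmaps hab.le hL hφc hK
      (A := fun k => branchSet f a b σ r z (j k) N (u k) (v k)) (τ := fun k => j k + 2 * N)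
      (fun k => isClosed_branchSet hmaps hF _ _ _ _ _ _ _) ?_ (fun k => ?_) (fun k y => ?_)
      fun k y hy => ?_
    · have hdisj : ∀ k k' : Fin K, k < k' → Disjoint (branchSet f a b σ r z (j k) N (u k) (v k))
          (branchSet f a b σ r z (j k') N (u k') (v k')) := by
        intro k k' hkk
        have := hgap k k' hkk
        refine disjoint_branchSet (by omega) (hfar k) (lt_of_le_of_lt ?_ hN')
        refine mul_le_mul_of_nonneg_left (Real.exp_le_exp.2 ?_) hr.le
        have h1 : (N' : ℝ) ≤ ((j k' - (j k + N) : ℕ) : ℝ) := by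
          exact_mod_cast (show N' ≤ j k' - (j k + N) by omega)
        nlinarith
      intro k k' hne
      rcases lt_or_gt_of_ne hne with h | h
      · exact hdisj k k' h
      · exact (hdisj k' k h).symm
    · have := (hJ _ (hindex k)).1
      rw [← hij] at this
      omega
    · exact exists_mem_branchSet hmaps hN hzI (heI k) (her k) (hesub k) (hu k) (hv k)
        (hrab.trans (huv k)) y
    · refine le_birkhoffSum_of_mem_branchSet (ψ := fun x => φ x - m) hmaps hα hC hr.le hσ hψH
        (fun x hx => (abs_le.1 (hD ⟨x, hx⟩)).1) hzI hy ?_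
      have h1 := (hJ _ (hindex k)).2.2
      rw [← hij, Finset.sum_Ico_eq_sum_range, add_tsub_cancel_left] at h1
      simpa only [hzit] using h1
  exact absurd hlt (not_lt.2 hPm)

end
end

section
/- Let I be a compact interval of ℝ, let f: I → I be an interval map of class C^3 with non-flat critical points, let B₀ ⊆ I be compact and connected, and let (φ_l)_{l≥1} be an IMFS generated by f with time sequence (m_l)_{l≥1}, defined on B₀. Suppose x₀ ∈ B₀ witnesses that the IMFS is free, i.e. for every pair of distinct finite words ul, ul' with m_{ul} = m_{ul'}, the sets φ_{ul}(x₀) and φ_{ul'}(x₀) are disjoint. Let φ: I → ℝ be continuous and suppose there are c ∈ ℝ and D > 0 such that for every l ≥ 1 and every y ∈ φ_l(B₀) we have S_{m_l}(φ)(y) ≥ m_l c − D. Then limsup_{n→∞} (1/n) log Σ_{y ∈ f^{−n}(x₀)} exp(S_n(φ)(y)) > c. -/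
open MeasureTheory Filter Set Metric

noncomputable section

/-- `Σ_{y ∈ f^{-n}(x₀) ∩ I} exp(Sₙ(φ)(y))`, as a finite sum (`finsum`);
for interval maps in our class each preimage set is finite. -/
def preimSum (f φ : ℝ → ℝ) (I : Set ℝ) (n : ℕ) (x₀ : ℝ) : ℝ :=
  ∑ᶠ y ∈ {y | y ∈ I ∧ f^[n] y = x₀}, Real.exp (birkhoffSum f φ n y)

/-- An Iterated Multivalued Function System (IMFS) generated by `f : I → I`, defined on a
set `B₀ ⊆ I`: for each `l` there are an integer `m l ≥ 1` and a pull-back `W l` of `B₀`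
by `f^[m l]` (i.e. a connected component of `f^[m l] ⁻¹' B₀ ∩ I`) contained in `B₀` with
`f^[m l] '' (W l) = B₀`; the `l`-th multivalued map is `A ↦ f^[m l] ⁻¹' A ∩ W l`. -/
structure IMFS (f : ℝ → ℝ) (I B₀ : Set ℝ) where
  /-- the time sequence -/
  m : ℕ → ℕ
  /-- the pull-backs -/
  W : ℕ → Set ℝ
  one_le : ∀ l, 1 ≤ m l
  sub : ∀ l, W l ⊆ B₀
  pullback : ∀ l, ∃ x ∈ W l, W l = connectedComponentIn (f^[m l] ⁻¹' B₀ ∩ I) x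
  onto : ∀ l, f^[m l] '' W l = B₀

/-- The `l`-th multivalued map of the IMFS, `φ_l(A) = f^{-m_l}(A) ∩ W_l`. -/
def IMFS.apply {f : ℝ → ℝ} {I B₀ : Set ℝ} (S : IMFS f I B₀) (l : ℕ) (A : Set ℝ) : Set ℝ :=
  f^[S.m l] ⁻¹' A ∩ S.W l

/-- `φ_{l₁ ⋯ l_k} = φ_{l₁} ∘ ⋯ ∘ φ_{l_k}` applied to a set. -/
def IMFS.applyWord {f : ℝ → ℝ} {I B₀ : Set ℝ} (S : IMFS f I B₀) :
    List ℕ → Set ℝ → Set ℝ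
  | [], A => A
  | l :: u, A => S.apply l (S.applyWord u A)

/-- `m_{l₁ ⋯ l_k} = m_{l₁} + ⋯ + m_{l_k}`. -/
def IMFS.time {f : ℝ → ℝ} {I B₀ : Set ℝ} (S : IMFS f I B₀) (u : List ℕ) : ℕ :=
  (u.map S.m).sum

/-- The IMFS is free at `x₀`: distinct nonempty words with the same total time have
disjoint images of `{x₀}`. -/
def IMFS.FreeAt {f : ℝ → ℝ} {I B₀ : Set ℝ} (S : IMFS f I B₀) (x₀ : ℝ) : Prop :=
  ∀ u v : List ℕ, u ≠ [] → v ≠ [] → u ≠ v → S.time u = S.time v →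
    Disjoint (S.applyWord u {x₀}) (S.applyWord v {x₀})

/-- The IMFS is free. -/
def IMFS.Free {f : ℝ → ℝ} {I B₀ : Set ℝ} (S : IMFS f I B₀) : Prop :=
  ∃ x₀ ∈ B₀, S.FreeAt x₀

/-- Between two distinct points of a fibre of `f` there is a critical point, so fibres are
finite, of uniformly bounded cardinality. -/
theorem IsC3NonflatIntervalMap.exists_fiber_card_le {a b : ℝ} {f : ℝ → ℝ}
    (hf : IsC3NonflatIntervalMap f a b) :
    ∃ K : ℕ, 1 ≤ K ∧ ∀ z : ℝ, ∃ T : Finset ℝ,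
      (T : Set ℝ) = {y | y ∈ Icc a b ∧ f y = z} ∧ T.card ≤ K := by
  classical
  set C : Finset ℝ := hf.critFinite.toFinset with hC
  refine ⟨C.card + 1, by omega, fun z => ?_⟩
  let A : Set ℝ := {y | y ∈ Icc a b ∧ f y = z}
  let r : ℝ → ℕ := fun y => (C.filter (· < y)).card
  have hr : StrictMonoOn r A := by
    rintro x ⟨hx, hxz⟩ y ⟨hy, hyz⟩ hxy
    have hsub : Icc x y ⊆ Icc a b := Icc_subset_Icc hx.1 hy.2
    obtain ⟨t, ht, ht0⟩ := exists_deriv_eq_zero hxy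
      (fun w hw => (hf.diff w (hsub hw)).continuousAt.continuousWithinAt) (hxz.trans hyz.symm)
    refine Finset.card_lt_card (Finset.ssubset_iff_of_subset ?_ |>.2 ⟨t, ?_, ?_⟩)
    · exact Finset.monotone_filter_right C fun w _ hw => lt_trans hw hxy
    · rw [Finset.mem_filter]
      exact ⟨by rw [hC, Set.Finite.mem_toFinset]; exact ⟨hsub (Ioo_subset_Icc_self ht), ht0⟩, ht.2⟩
    · simp [ht.1.le]
  have hmaps : MapsTo r A (Finset.range (C.card + 1) : Finset ℕ) := fun y _ => by
    simpa [Nat.lt_succ_iff] using Finset.card_filter_le C (· < y)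
  have hfin : A.Finite := Finite.of_finite_image
    ((Finset.finite_toSet _).subset hmaps.image_subset) hr.injOn
  refine ⟨hfin.toFinset, hfin.coe_toFinset, ?_⟩
  simpa using Finset.card_le_card_of_injOn r
    (t := Finset.range (C.card + 1)) (by simpa using hmaps) (by simpa using hr.injOn)

/-- Iterated fibres grow at most exponentially if fibres are uniformly bounded. -/
theorem exists_iterate_fiber_card_le {α : Type*} {f : α → α} {I : Set α} (hI : MapsTo f I I)
    {K : ℕ} (hK : ∀ z : α, ∃ T : Finset α, (T : Set α) = {y | y ∈ I ∧ f y = z} ∧ T.card ≤ K)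
    (n : ℕ) {x : α} (hx : x ∈ I) :
    ∃ T : Finset α, (T : Set α) = {y | y ∈ I ∧ f^[n] y = x} ∧ T.card ≤ K ^ n := by
  classical
  induction n with
  | zero =>
    refine ⟨{x}, ?_, by simp⟩
    ext y
    simp only [Finset.coe_singleton, mem_singleton_iff, Function.iterate_zero, id, mem_ofPred_eq]
    exact ⟨fun h => ⟨h ▸ hx, h⟩, fun h => h.2⟩
  | succ n ih =>
    obtain ⟨T, hT, hTc⟩ := ih
    choose F hF hFc using hK
    refine ⟨T.biUnion F, ?_, ?_⟩
    · ext y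
      have hT' : ∀ w, w ∈ T ↔ w ∈ I ∧ f^[n] w = x := fun w => by
        rw [← Finset.mem_coe, hT, mem_ofPred_eq]
      have hF' : ∀ z w, w ∈ F z ↔ w ∈ I ∧ f w = z := fun z w => by
        rw [← Finset.mem_coe, hF, mem_ofPred_eq]
      simp only [Finset.coe_biUnion, mem_iUnion, Finset.mem_coe, hT', hF', mem_ofPred_eq,
        Function.iterate_succ_apply, exists_prop]
      constructor
      · rintro ⟨_, ⟨-, h⟩, hy, rfl⟩
        exact ⟨hy, h⟩
      · rintro ⟨hy, h⟩
        exact ⟨f y, ⟨hI hy, h⟩, hy, rfl⟩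
    · calc (T.biUnion F).card ≤ T.card * K := Finset.card_biUnion_le_card_mul _ _ _ fun z _ => hFc z
        _ ≤ K ^ (n + 1) := by rw [pow_succ]; gcongr

theorem birkhoffSum_le_mul {α : Type*} {f : α → α} {I : Set α} (hI : MapsTo f I I)
    {φ : α → ℝ} {M : ℝ} (hM : ∀ y ∈ I, φ y ≤ M) (n : ℕ) {y : α} (hy : y ∈ I) :
    birkhoffSum f φ n y ≤ n * M := by
  simpa [birkhoffSum] using
    Finset.sum_le_card_nsmul (Finset.range n) _ M fun k _ => hM _ (hI.iterate k hy)

theorem preimSum_eq_sum {f φ : ℝ → ℝ} {I : Set ℝ} {n : ℕ} {x : ℝ} {T : Finset ℝ}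
    (hT : (T : Set ℝ) = {y | y ∈ I ∧ f^[n] y = x}) :
    preimSum f φ I n x = ∑ y ∈ T, Real.exp (birkhoffSum f φ n y) := by
  rw [preimSum, ← hT, finsum_mem_coe_finset]

/-- The normalized logarithms of the preimage sums are bounded above. -/
theorem IsC3NonflatIntervalMap.isBoundedUnder_log_preimSum {a b : ℝ} {f : ℝ → ℝ}
    (hf : IsC3NonflatIntervalMap f a b) {φ : ℝ → ℝ} (hφ : ContinuousOn φ (Icc a b))
    {x : ℝ} (hx : x ∈ Icc a b) :
    IsBoundedUnder (· ≤ ·) atTop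
      fun n : ℕ => Real.log (preimSum f φ (Icc a b) n x) / n := by
  obtain ⟨K, hK1, hK⟩ := hf.exists_fiber_card_le
  obtain ⟨M, hM⟩ := (isCompact_Icc.image_of_continuousOn hφ).bddAbove
  have hM' : ∀ y ∈ Icc a b, φ y ≤ max M 0 := fun y hy =>
    (hM (mem_image_of_mem φ hy)).trans (le_max_left M 0)
  refine isBoundedUnder_of_eventually_le (a := Real.log K + max M 0) ?_
  filter_upwards [eventually_gt_atTop 0] with n hn
  obtain ⟨T, hT, hTc⟩ := exists_iterate_fiber_card_le hf.mapsTo hK n hx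
  have hn' : (0 : ℝ) < n := by exact_mod_cast hn
  have hKpos : (0 : ℝ) < K := by exact_mod_cast hK1
  rw [div_le_iff₀ hn', preimSum_eq_sum hT]
  have hle : ∑ y ∈ T, Real.exp (birkhoffSum f φ n y) ≤ (K : ℝ) ^ n * Real.exp (n * max M 0) := by
    calc ∑ y ∈ T, Real.exp (birkhoffSum f φ n y) ≤ T.card • Real.exp (n * max M 0) := by
          refine Finset.sum_le_card_nsmul _ _ _ fun y hy => Real.exp_le_exp.2 ?_
          rw [← Finset.mem_coe, hT] at hy
          exact birkhoffSum_le_mul hf.mapsTo hM' n hy.1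
      _ ≤ (K : ℝ) ^ n * Real.exp (n * max M 0) := by
          rw [nsmul_eq_mul]
          gcongr
          exact_mod_cast hTc
  rcases T.eq_empty_or_nonempty with rfl | hTne
  · have hM₀ : 0 ≤ Real.log K + max M 0 := by positivity
    simpa using mul_nonneg hM₀ hn'.le
  calc _ ≤ Real.log ((K : ℝ) ^ n * Real.exp (n * max M 0)) :=
        Real.log_le_log (Finset.sum_pos (fun y _ => Real.exp_pos _) hTne) hle
    _ = (Real.log K + max M 0) * n := by
      rw [Real.log_mul (by positivity) (by positivity), Real.log_pow, Real.log_exp]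
      ring

namespace IMFS

variable {f : ℝ → ℝ} {I B₀ : Set ℝ} (S : IMFS f I B₀)

theorem applyWord_subset {A : Set ℝ} (hA : A ⊆ B₀) (u : List ℕ) : S.applyWord u A ⊆ B₀ := by
  cases u with
  | nil => exact hA
  | cons l u => exact inter_subset_right.trans (S.sub l)

theorem applyWord_nonempty {A : Set ℝ} (hA : A ⊆ B₀) (hne : A.Nonempty) (u : List ℕ) :
    (S.applyWord u A).Nonempty := by
  induction u with
  | nil => exact hne
  | cons l u ih =>
    obtain ⟨z, hz⟩ := ih
    obtain ⟨y, hy, rfl⟩ := (S.onto l).symm ▸ S.applyWord_subset hA u hz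
    exact ⟨y, hz, hy⟩

theorem iterate_time_mem {A : Set ℝ} (u : List ℕ) {y : ℝ} (hy : y ∈ S.applyWord u A) :
    f^[S.time u] y ∈ A := by
  induction u generalizing y with
  | nil => exact hy
  | cons l u ih =>
    have := ih hy.1
    rwa [← Function.iterate_add_apply, add_comm] at this

theorem time_cons (l : ℕ) (u : List ℕ) : S.time (l :: u) = S.m l + S.time u := rfl

theorem le_birkhoffSum_of_mem_applyWord {φ : ℝ → ℝ} {c D : ℝ}
    (hest : ∀ l : ℕ, ∀ y ∈ S.apply l B₀, (S.m l : ℝ) * c - D ≤ birkhoffSum f φ (S.m l) y)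
    {A : Set ℝ} (hA : A ⊆ B₀) (u : List ℕ) {y : ℝ} (hy : y ∈ S.applyWord u A) :
    (S.time u : ℝ) * c - u.length * D ≤ birkhoffSum f φ (S.time u) y := by
  induction u generalizing y with
  | nil => simp [time]
  | cons l u ih =>
    have h₁ := hest l y ⟨S.applyWord_subset hA u hy.1, hy.2⟩
    have h₂ := ih hy.1
    rw [time_cons, birkhoffSum_add, List.length_cons]
    push_cast
    linarith

/-- Distinct words of length `k` and total time `n` contribute distinct points to the
preimage sum. -/
theorem card_mul_exp_le_preimSum (hB₀ : B₀ ⊆ I) {x₀ : ℝ} (hx₀ : x₀ ∈ B₀) (hfree : S.FreeAt x₀)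
    {φ : ℝ → ℝ} {c D : ℝ}
    (hest : ∀ l : ℕ, ∀ y ∈ S.apply l B₀, (S.m l : ℝ) * c - D ≤ birkhoffSum f φ (S.m l) y)
    {n k : ℕ} (hk : k ≠ 0) (hfin : {y | y ∈ I ∧ f^[n] y = x₀}.Finite)
    (V : Finset (List ℕ)) (hlen : ∀ u ∈ V, u.length = k) (htime : ∀ u ∈ V, S.time u = n) :
    (V.card : ℝ) * Real.exp (n * c - k * D) ≤ preimSum f φ I n x₀ := by
  classical
  have hsub : ({x₀} : Set ℝ) ⊆ B₀ := singleton_subset_iff.2 hx₀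
  choose p hp using S.applyWord_nonempty hsub (singleton_nonempty x₀)
  have hne : ∀ u ∈ V, u ≠ [] := fun u hu h => hk (by simpa [h] using (hlen u hu).symm)
  have hinj : InjOn p V := fun u hu v hv huv => by
    by_contra h
    exact Set.disjoint_left.1 (hfree u v (hne u hu) (hne v hv) h
      ((htime u hu).trans (htime v hv).symm)) (hp u) (huv ▸ hp v)
  have hmem : V.image p ⊆ hfin.toFinset := fun y hy => by
    obtain ⟨u, hu, rfl⟩ := Finset.mem_image.1 hy
    have := S.iterate_time_mem u (hp u)
    rw [htime u hu] at this
    exact hfin.mem_toFinset.2 ⟨hB₀ (S.applyWord_subset hsub u (hp u)), this⟩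
  rw [preimSum_eq_sum hfin.coe_toFinset]
  calc (V.card : ℝ) * Real.exp (n * c - k * D)
      ≤ ∑ u ∈ V, Real.exp (birkhoffSum f φ n (p u)) := by
        rw [← nsmul_eq_mul]
        refine Finset.card_nsmul_le_sum _ _ _ fun u hu => Real.exp_le_exp.2 ?_
        simpa only [htime u hu, hlen u hu] using
          S.le_birkhoffSum_of_mem_applyWord hest hsub u (hp u)
    _ = ∑ y ∈ V.image p, Real.exp (birkhoffSum f φ n y) :=
        (Finset.sum_image (f := fun y => Real.exp (birkhoffSum f φ n y)) hinj).symm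
    _ ≤ _ := Finset.sum_le_sum_of_subset_of_nonneg hmem fun _ _ _ => (Real.exp_pos _).le

/-- Among the words of length `k` in the first `N` letters, some total time between `k` and
`k * M` is attained by at least a proportion `1 / (k * M)`. -/
theorem exists_many_words {N M : ℕ} (hM : ∀ l < N, S.m l ≤ M) (hM1 : 1 ≤ M)
    {k : ℕ} (hk : k ≠ 0) :
    ∃ n ∈ Finset.Icc k (k * M), ∃ V : Finset (List ℕ),
      (∀ u ∈ V, u.length = k) ∧ (∀ u ∈ V, S.time u = n) ∧
      (N : ℝ) ^ k / (k * M) ≤ V.card := by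
  classical
  let w : (Fin k → Fin N) → List ℕ := fun g => List.ofFn fun i => (g i : ℕ)
  have hw : Function.Injective w := fun g h hgh => by
    have := List.ofFn_injective hgh
    exact funext fun i => Fin.ext (congrFun this i)
  have htime : ∀ g, S.time (w g) = ∑ i, S.m (g i) := fun g => by
    simp [time, w, List.map_ofFn, List.sum_ofFn]
  have hmaps : ∀ g ∈ (Finset.univ : Finset (Fin k → Fin N)),
      S.time (w g) ∈ Finset.Icc k (k * M) := fun g _ => by
    rw [htime, Finset.mem_Icc]
    constructor
    · simpa using Finset.card_nsmul_le_sum Finset.univ (fun i => S.m (g i)) 1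
        fun i _ => S.one_le _
    · simpa using Finset.sum_le_card_nsmul Finset.univ (fun i => S.m (g i)) M
        fun i _ => hM _ (g i).2
  have hkM : k ≤ k * M := Nat.le_mul_of_pos_right k hM1
  have hpos : (0 : ℝ) < k * M := by
    have := Nat.pos_of_ne_zero hk
    positivity
  obtain ⟨n, hn, hcard⟩ := Finset.exists_le_card_fiber_of_nsmul_le_card_of_maps_to
    (b := (N : ℝ) ^ k / (k * M)) hmaps ⟨k, by simp [hkM]⟩ (by
      have h : ((Finset.Icc k (k * M)).card : ℝ) ≤ k * M := by
        rw [Nat.card_Icc]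
        exact_mod_cast (by omega : k * M + 1 - k ≤ k * M)
      rw [nsmul_eq_mul]
      calc _ ≤ (k * M : ℝ) * ((N : ℝ) ^ k / (k * M)) := by gcongr
        _ = _ := by simp [mul_div_cancel₀ _ hpos.ne'])
  refine ⟨n, hn, (Finset.univ.filter fun g => S.time (w g) = n).image w, ?_, ?_, ?_⟩
  · intro u hu
    obtain ⟨g, -, rfl⟩ := Finset.mem_image.1 hu
    simp [w]
  · intro u hu
    obtain ⟨g, hg, rfl⟩ := Finset.mem_image.1 hu
    exact (Finset.mem_filter.1 hg).2
  · rwa [Finset.card_image_of_injective _ hw]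

end IMFS

/-- **Lemma (free IMFS forces a pressure gap at `x₀`).** Let `f` be a `C³` interval map
with non-flat critical points, `B₀ ⊆ I` compact and connected, `(φ_l)` an IMFS generated
by `f` defined on `B₀` with time sequence `(m_l)`, and `x₀ ∈ B₀` a witness of freeness.
If `φ` is continuous and `S_{m_l}(φ)(y) ≥ m_l c − D` for every `l` and `y ∈ φ_l(B₀)`,
then `limsup (1/n) log Σ_{y ∈ f^{-n}(x₀)} exp(Sₙ(φ)(y)) > c`. -/
theorem free_IMFS_pressure_gap
    (a b : ℝ) (f : ℝ → ℝ)
    (hf : IsC3NonflatIntervalMap f a b)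
    (B₀ : Set ℝ) (hB₀cpt : IsCompact B₀) (hB₀conn : IsConnected B₀)
    (hB₀sub : B₀ ⊆ Icc a b)
    (S : IMFS f (Icc a b) B₀)
    (x₀ : ℝ) (hx₀ : x₀ ∈ B₀) (hfree : S.FreeAt x₀)
    (φ : ℝ → ℝ) (hφ : ContinuousOn φ (Icc a b))
    (c D : ℝ) (hD : 0 < D)
    (hest : ∀ l : ℕ, ∀ y ∈ S.apply l B₀,
      (S.m l : ℝ) * c - D ≤ birkhoffSum f φ (S.m l) y) :
    c < atTop.limsup (fun n : ℕ => Real.log (preimSum f φ (Icc a b) n x₀) / n) := by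
  have hx₀I := hB₀sub hx₀
  obtain ⟨N, hN⟩ := exists_nat_ge (Real.exp (D + 2))
  obtain ⟨M, hM1, hM⟩ : ∃ M : ℕ, 1 ≤ M ∧ ∀ l < N, S.m l ≤ M :=
    ⟨(Finset.range N).sup S.m + 1, by omega, fun l hl =>
      (Finset.le_sup (f := S.m) (Finset.mem_range.2 hl)).trans (Nat.le_succ _)⟩
  have hMpos : (0 : ℝ) < M := by exact_mod_cast hM1
  refine lt_of_lt_of_le (lt_add_of_pos_right c (inv_pos.2 hMpos))
    (le_limsup_of_frequently_le ?_ (hf.isBoundedUnder_log_preimSum hφ hx₀I))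
  obtain ⟨K, -, hK⟩ := hf.exists_fiber_card_le
  have hev : ∀ᶠ k : ℕ in atTop, (k : ℝ) * M ≤ Real.exp k := by
    have h := (((Real.isLittleO_pow_exp_atTop (n := 1)).comp_tendsto
      tendsto_natCast_atTop_atTop).const_mul_left (M : ℝ)).bound one_pos
    filter_upwards [h] with k hk
    simpa [abs_of_pos hMpos, mul_comm] using hk
  rw [frequently_atTop]
  intro n₀
  obtain ⟨k, hkM, hk₀, hk1⟩ :=
    (hev.and ((eventually_ge_atTop n₀).and (eventually_ge_atTop 1))).exists
  obtain ⟨n, hn, V, hlen, htime, hcard⟩ := S.exists_many_words hM hM1 (k := k) (by omega)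
  rw [Finset.mem_Icc] at hn
  refine ⟨n, hk₀.trans hn.1, ?_⟩
  obtain ⟨T, hT, -⟩ := exists_iterate_fiber_card_le hf.mapsTo hK n hx₀I
  have hmain := S.card_mul_exp_le_preimSum hB₀sub hx₀ hfree hest (by omega : k ≠ 0)
    (hT ▸ T.finite_toSet) V hlen htime
  have hkpos : (0 : ℝ) < k := by exact_mod_cast hk1
  have hnpos : (0 : ℝ) < n := by exact_mod_cast (by omega : 0 < n)
  have hcard' : Real.exp (k * (D + 1)) ≤ V.card := by
    refine le_trans ?_ hcard
    rw [le_div_iff₀ (by positivity)]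
    calc Real.exp (k * (D + 1)) * (k * M) ≤ Real.exp (k * (D + 1)) * Real.exp k := by gcongr
      _ = Real.exp (D + 2) ^ k := by rw [← Real.exp_add, ← Real.exp_nat_mul]; ring_nf
      _ ≤ (N : ℝ) ^ k := by gcongr
  have hexp : Real.exp (n * c + k) ≤ preimSum f φ (Icc a b) n x₀ := by
    refine le_trans ?_ hmain
    calc Real.exp (n * c + k) = Real.exp (k * (D + 1)) * Real.exp (n * c - k * D) := by
          rw [← Real.exp_add]; ring_nf
      _ ≤ _ := by gcongr
  have hlog := Real.log_le_log (Real.exp_pos _) hexp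
  rw [Real.log_exp] at hlog
  have hnk : (M : ℝ)⁻¹ * n ≤ k := by
    rw [inv_mul_le_iff₀ hMpos, mul_comm]
    exact_mod_cast hn.2
  rw [le_div_iff₀ hnpos]
  linarith

end
end

section
/- Let I be a compact interval of ℝ, let f: I → I be an interval map of class C^3 with non-flat critical points that is topologically exact, and let φ: I → ℝ be continuous. Then φ is hyperbolic for f if and only if P(f, φ) > sup{ ∫_I φ dν : ν ∈ M(I, f) }. -/
open MeasureTheory Filter Set Metric

noncomputable section

/-- On a compact metrizable space, a uniform lower bound on one Birkhoff average of each length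
passes to the integral of an invariant probability measure (Krylov–Bogoliubov). -/
theorem exists_map_eq_self_le_integral {X : Type*} [TopologicalSpace X] [CompactSpace X]
    [TopologicalSpace.MetrizableSpace X] [MeasurableSpace X] [BorelSpace X]
    {F : X → X} (hF : Continuous F) (g : BoundedContinuousFunction X ℝ) {c : ℝ}
    (x : ℕ → X) (hx : ∀ n, c ≤ birkhoffAverage ℝ F g (n + 1) (x n)) :
    ∃ μ : Measure X, IsProbabilityMeasure μ ∧ μ.map F = μ ∧ c ≤ ∫ y, g y ∂μ := by
  let m : ℕ → Measure X := fun n =>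
    ((n + 1 : ℕ) : NNReal)⁻¹ • ∑ i ∈ Finset.range (n + 1), Measure.dirac (F^[i] (x n))
  have hm (n : ℕ) : IsProbabilityMeasure (m n) := by
    refine ⟨?_⟩
    simp only [m, Measure.smul_apply, Measure.finsetSum_apply, measure_univ, Finset.sum_const,
      Finset.card_range, nsmul_eq_mul, mul_one, ENNReal.smul_def, smul_eq_mul]
    rw [ENNReal.coe_inv (by positivity), ENNReal.coe_natCast]
    exact ENNReal.inv_mul_cancel (by simp) (by simp)
  have hint (n : ℕ) (h : BoundedContinuousFunction X ℝ) :
      ∫ y, h y ∂(m n) = birkhoffAverage ℝ F h (n + 1) (x n) := by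
    simp only [m, integral_smul_nnreal_measure]
    rw [integral_finsetSum_measure fun i _ => h.integrable _]
    simp [birkhoffAverage, birkhoffSum, integral_dirac, NNReal.smul_def]
  let ν : ℕ → ProbabilityMeasure X := fun n => ⟨m n, hm n⟩
  let U : Ultrafilter ℕ := hyperfilter ℕ
  obtain ⟨μ, -, hμ⟩ := isCompact_univ.ultrafilter_le_nhds (U.map ν) (by simp)
  have hlim (h : BoundedContinuousFunction X ℝ) :
      Tendsto (fun n => birkhoffAverage ℝ F h (n + 1) (x n)) U
        (nhds (∫ y, h y ∂(μ : Measure X))) := by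
    have := ProbabilityMeasure.tendsto_iff_forall_integral_tendsto.1
      (show Tendsto ν U (nhds μ) from hμ) h
    simpa only [ν, ProbabilityMeasure.coe_mk, hint] using this
  have hU : (U : Filter ℕ) ≤ atTop := Nat.hyperfilter_le_atTop
  refine ⟨μ, inferInstance, ?_, ge_of_tendsto' (hlim g) hx⟩
  have : IsProbabilityMeasure ((μ : Measure X).map F) :=
    Measure.isProbabilityMeasure_map hF.aemeasurable
  refine ext_of_forall_integral_eq_of_IsFiniteMeasure fun h => ?_
  rw [integral_map hF.aemeasurable h.continuous.aestronglyMeasurable]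
  have h1 := hlim (h.compContinuous ⟨F, hF⟩)
  have h2 := h1.sub (hlim h)
  have h3 : Tendsto (fun n : ℕ => birkhoffAverage ℝ F (h.compContinuous ⟨F, hF⟩) (n + 1) (x n)
      - birkhoffAverage ℝ F h (n + 1) (x n)) atTop (nhds 0) := by
    have h4 : Tendsto (fun n : ℕ => 2 * ‖h‖ * (1 / ((n : ℝ) + 1))) atTop (nhds 0) := by
      simpa using tendsto_one_div_add_atTop_nhds_zero_nat.const_mul (2 * ‖h‖)
    refine squeeze_zero_norm (fun n => ?_) h4
    have h5 : birkhoffAverage ℝ F (h.compContinuous ⟨F, hF⟩) (n + 1) (x n)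
        = birkhoffAverage ℝ F h (n + 1) (F (x n)) := by
      simp only [birkhoffAverage, birkhoffSum, ← Function.iterate_succ_apply,
        Function.iterate_succ_apply', BoundedContinuousFunction.compContinuous_apply,
        ContinuousMap.coe_mk]
    rw [h5, ← dist_eq_norm, dist_birkhoffAverage_apply_birkhoffAverage, div_eq_mul_one_div]
    push_cast
    gcongr
    exact h.dist_le_two_norm _ _
  exact sub_eq_zero.1 (tendsto_nhds_unique h2 (h3.mono_left hU))

/-- The orbit terms of a function continuous on an invariant set are continuous there. -/
theorem continuousOn_comp_iterate {f φ : ℝ → ℝ} {I : Set ℝ} (hf : ContinuousOn f I)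
    (hI : MapsTo f I I) (hφ : ContinuousOn φ I) (n : ℕ) :
    ContinuousOn (fun x => φ (f^[n] x)) I :=
  hφ.comp (hf.iterate hI n) (hI.iterate n)

namespace InvariantProb

variable {f φ : ℝ → ℝ} {I : Set ℝ} {μ : Measure ℝ}

theorem ae_mem (h : InvariantProb f I μ) (hI : MeasurableSet I) : ∀ᵐ x ∂μ, x ∈ I := by
  have := h.1
  exact (prob_compl_eq_zero_iff hI).2 h.2.1

theorem restrict_eq (h : InvariantProb f I μ) (hI : MeasurableSet I) : μ.restrict I = μ :=
  Measure.restrict_eq_self_of_ae_mem (h.ae_mem hI)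

theorem integrable (h : InvariantProb f I μ) (hI : IsCompact I) (hφ : ContinuousOn φ I) :
    Integrable φ μ := by
  have := h.1
  have := hφ.integrableOn_compact (μ := μ) hI
  rwa [IntegrableOn, h.restrict_eq hI.measurableSet] at this

theorem integral_comp_iterate (h : InvariantProb f I μ) (hI : IsCompact I)
    (hf : ContinuousOn f I) (hfI : MapsTo f I I) (hφ : ContinuousOn φ I) (n : ℕ) :
    ∫ x, φ (f^[n] x) ∂μ = ∫ x, φ x ∂μ := by
  have hfm : AEMeasurable f μ := by
    have := hf.aemeasurable (μ := μ) hI.measurableSet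
    rwa [h.restrict_eq hI.measurableSet] at this
  have hmap : μ.map f = μ := by
    ext A hA
    rw [Measure.map_apply_of_aemeasurable hfm hA, h.2.2 A hA]
  induction n with
  | zero => rfl
  | succ n ih =>
    rw [← ih]
    have hm := (h.integrable hI (continuousOn_comp_iterate hf hfI hφ n)).aestronglyMeasurable
    conv_rhs => rw [← hmap]
    rw [integral_map hfm (by rwa [hmap])]
    rfl

theorem integral_birkhoffSum (h : InvariantProb f I μ) (hI : IsCompact I)
    (hf : ContinuousOn f I) (hfI : MapsTo f I I) (hφ : ContinuousOn φ I) (n : ℕ) :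
    ∫ x, birkhoffSum f φ n x ∂μ = n * ∫ x, φ x ∂μ := by
  simp only [birkhoffSum]
  rw [integral_finsetSum _ fun i _ => h.integrable hI (continuousOn_comp_iterate hf hfI hφ i)]
  simp [h.integral_comp_iterate hI hf hfI hφ]

/-- The integral of a continuous function is at most the supremum of its Birkhoff averages of any
fixed length. -/
theorem integral_le_sSup (h : InvariantProb f I μ) (hI : IsCompact I)
    (hf : ContinuousOn f I) (hfI : MapsTo f I I) (hφ : ContinuousOn φ I) {n : ℕ} (hn : 1 ≤ n) :
    ∫ x, φ x ∂μ ≤ sSup ((fun x => birkhoffSum f φ n x / n) '' I) := by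
  have := h.1
  have hc : ContinuousOn (fun x => birkhoffSum f φ n x / n) I := by
    simp only [birkhoffSum]
    exact (continuousOn_finsetSum _ fun i _ => continuousOn_comp_iterate hf hfI hφ i).div_const _
  have hn0 : (n : ℝ) ≠ 0 := by positivity
  calc ∫ x, φ x ∂μ = ∫ x, birkhoffSum f φ n x / n ∂μ := by
        rw [integral_div, h.integral_birkhoffSum hI hf hfI hφ]
        field_simp
    _ ≤ ∫ _, sSup ((fun x => birkhoffSum f φ n x / n) '' I) ∂μ := by
        refine integral_mono_ae (h.integrable hI hc) (integrable_const _) ?_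
        filter_upwards [h.ae_mem hI.measurableSet] with x hx
        exact le_csSup (hI.image_of_continuousOn hc).bddAbove (mem_image_of_mem _ hx)
    _ = _ := by simp

end InvariantProb

theorem invariantProb_dirac {f : ℝ → ℝ} {I : Set ℝ} {p : ℝ} (hp : p ∈ I) (hfp : f p = p) :
    InvariantProb f I (Measure.dirac p) := by
  refine ⟨inferInstance, by simp [hp], fun A _ => ?_⟩
  have : p ∈ f ⁻¹' A ↔ p ∈ A := by rw [mem_preimage, hfp]
  classical
  simp only [Measure.dirac_apply, indicator_apply, this]

/-- If the Birkhoff averages of every length attain values at least `c` on a compact invariant set,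
then so does the integral against some invariant probability measure. -/
theorem exists_invariantProb_le_integral {f φ : ℝ → ℝ} {I : Set ℝ} (hI : IsCompact I)
    (hf : ContinuousOn f I) (hfI : MapsTo f I I) (hφ : ContinuousOn φ I) {c : ℝ}
    (h : ∀ n : ℕ, ∃ x ∈ I, c ≤ birkhoffSum f φ (n + 1) x / (n + 1 : ℕ)) :
    ∃ μ, InvariantProb f I μ ∧ c ≤ ∫ x, φ x ∂μ := by
  choose x hxI hx using h
  have := isCompact_iff_compactSpace.1 hI
  have hF : Continuous (hfI.restrict f I I) := hf.mapsToRestrict hfI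
  let g : BoundedContinuousFunction I ℝ :=
    BoundedContinuousFunction.mkOfCompact ⟨I.domRestrict φ, hφ.domRestrict⟩
  obtain ⟨μ, hμ, hinv, hle⟩ := exists_map_eq_self_le_integral hF g (fun n => ⟨x n, hxI n⟩)
    (c := c) fun n => by
      refine (hx n).trans_eq ?_
      rw [birkhoffAverage, birkhoffSum, birkhoffSum, smul_eq_mul, div_eq_inv_mul]
      congr 1
      refine Finset.sum_congr rfl fun i _ => ?_
      rw [hfI.iterate_restrict i]
      rfl
  have hval : MeasurableEmbedding (Subtype.val : I → ℝ) :=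
    MeasurableEmbedding.subtype_coe hI.measurableSet
  refine ⟨μ.map Subtype.val, ⟨Measure.isProbabilityMeasure_map hval.measurable.aemeasurable, ?_,
    fun A hA => ?_⟩, ?_⟩
  · rw [hval.map_apply]
    simp
  · rw [hval.map_apply, hval.map_apply]
    conv_rhs => rw [← hinv, Measure.map_apply hF.measurable (hval.measurable hA)]
    rfl
  · rw [hval.integral_map]
    exact hle

/-- **Lemma (hyperbolicity is a pressure gap).** For a topologically exact `C³` interval
map with non-flat critical points and a continuous potential `φ`, `φ` is hyperbolic for
`f` if and only if `P(f, φ) > sup { ∫ φ dν : ν ∈ M(I, f) }`. -/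
theorem hyperbolic_iff_pressure_gap
    (a b : ℝ) (f : ℝ → ℝ)
    (hf : IsC3NonflatIntervalMap f a b)
    (hex : TopExact f (Icc a b))
    (φ : ℝ → ℝ) (hφ : ContinuousOn φ (Icc a b)) :
    HyperbolicPotential f (Icc a b) φ ↔
      sSup { r : ℝ | ∃ ν : Measure ℝ, InvariantProb f (Icc a b) ν ∧ r = ∫ x, φ x ∂ν }
        < pressure f (Icc a b) φ := by
  have hI : IsCompact (Icc a b) := isCompact_Icc
  have hfc : ContinuousOn f (Icc a b) := fun x hx => (hf.diff x hx).continuousAt.continuousWithinAt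
  have hne : (Icc a b).Nonempty := nonempty_Icc.2 hf.lt.le
  constructor
  · rintro ⟨n, hn, hlt⟩
    refine lt_of_le_of_lt (csSup_le ?_ ?_) hlt
    · obtain ⟨p, hp, hfp⟩ := exists_mem_Icc_isFixedPt_of_mapsTo hfc hf.lt.le hf.mapsTo
      exact ⟨_, _, invariantProb_dirac hp hfp, rfl⟩
    · rintro _ ⟨ν, hν, rfl⟩
      exact hν.integral_le_sSup hI hfc hf.mapsTo hφ hn
  · intro hlt
    by_contra hnot
    simp only [HyperbolicPotential, not_exists, not_and, not_lt] at hnot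
    obtain ⟨μ, hμ, hle⟩ := exists_invariantProb_le_integral hI hfc hf.mapsTo hφ
        (c := pressure f (Icc a b) φ) fun n => by
      have hc : ContinuousOn (fun x => birkhoffSum f φ (n + 1) x / (n + 1 : ℕ)) (Icc a b) := by
        simp only [birkhoffSum]
        exact (continuousOn_finsetSum _ fun i _ =>
          continuousOn_comp_iterate hfc hf.mapsTo hφ i).div_const _
      obtain ⟨x, hx, hxs⟩ := hI.exists_sSup_image_eq hne hc
      exact ⟨x, hx, (hnot (n + 1) (by omega)).trans_eq hxs⟩
    have hbdd : BddAbove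
        {r : ℝ | ∃ ν : Measure ℝ, InvariantProb f (Icc a b) ν ∧ r = ∫ x, φ x ∂ν} := by
      refine ⟨sSup ((fun x => birkhoffSum f φ 1 x / (1 : ℕ)) '' Icc a b), ?_⟩
      rintro _ ⟨ν, hν, rfl⟩
      exact hν.integral_le_sSup hI hfc hf.mapsTo hφ le_rfl
    exact hlt.not_ge (hle.trans (le_csSup hbdd ⟨μ, hμ, rfl⟩))

end
end
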